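/- (Unique solvability and Sobolev estimate for the linearized problem.) Suppose f ∈ H^s(𝕊) with f_φ ∈ H^{s−1/2}(𝕊) and h ∈ H^{s+3/4}(ℰ) for some s > 1. Then the problem Δv = 0 in Ω, −2 sin θ · v_r + cos θ · v_θ = f/2 on 𝕊, v → 0 uniformly as r → ∞, v = h on ℰ, has a unique classical solution v ∈ C²(Ω) ∩ C¹(cl Ω); moreover v|_𝕊 ∈ H^{s+1}(𝕊) with ‖v‖_{H^{s+1}(𝕊)} ≤ C (‖f‖_{H^s(𝕊)} + ‖f_φ‖_{H^{s−1/2}(𝕊)} + ‖h‖_{H^{s+3/4}(ℰ)}) for a constant C > 0 independent of f and h. In particular, if f ∈ H^s_ax(𝕊) and h is a constant, then v|_𝕊 ∈ H^{s+1}_ax(𝕊) and ‖v‖_{H^{s+1}(𝕊)} ≤ C (‖f‖_{H^s(𝕊)} + |h|). -/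

import Mathlib

noncomputable section

open MeasureTheory Real Filter

/-- The Legendre polynomial of degree `n`, via Rodrigues' formula. -/
def legendreP (n : ℕ) : Polynomial ℝ :=
  Polynomial.C ((2 ^ n * n.factorial : ℝ)⁻¹) *
    Polynomial.derivative^[n] ((Polynomial.X ^ 2 - 1) ^ n)

/-- The associated Legendre function `P_l^m` (with Condon–Shortley phase),
so that `P_{|m|+2k}^{|m|}(0) = (-1)^{|m|+k} (2|m|+2k-1)!!/(2k)!!`. -/
def assocLegendre (l m : ℕ) (x : ℝ) : ℝ :=
  (-1 : ℝ) ^ m * (1 - x ^ 2) ^ ((m : ℝ) / 2) *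
    (Polynomial.derivative^[m] (legendreP l)).eval x

/-- The normalizing constant `α_l^m` of the spherical harmonics. -/
def alphaY (l : ℕ) (m : ℤ) : ℝ :=
  (-1 : ℝ) ^ ((m + |m|) / 2) *
    Real.sqrt ((2 * l + 1) * (l - m.natAbs).factorial /
      (4 * Real.pi * (l + m.natAbs).factorial))

/-- The spherical harmonic `Y_l^m` in latitude/longitude coordinates `(θ, φ)`. -/
def Ylm (l : ℕ) (m : ℤ) (θ φ : ℝ) : ℂ :=
  ((alphaY l m * assocLegendre l m.natAbs (Real.sin θ) : ℝ) : ℂ) *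
    Complex.exp (Complex.I * m * φ)

/-- The surface measure `dS = cos θ dθ dφ` of the unit sphere, in the coordinate box
`[-π/2, π/2] × [-π, π)`. -/
def sphereMeasure : Measure (ℝ × ℝ) :=
  ((volume : Measure (ℝ × ℝ)).restrict
      (Set.Icc (-(Real.pi / 2)) (Real.pi / 2) ×ˢ Set.Ico (-Real.pi) Real.pi)).withDensity
    fun p => ENNReal.ofReal (Real.cos p.1)

/-- The Fourier–Laplace coefficient `ψ̂_l^m = ∫_𝕊 ψ conj(Y_l^m) dS`. -/
def flCoeff (ψ : ℝ → ℝ → ℂ) (l : ℕ) (m : ℤ) : ℂ :=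
  ∫ p : ℝ × ℝ, ψ p.1 p.2 * (starRingEnd ℂ) (Ylm l m p.1 p.2) ∂sphereMeasure

/-- Membership in the fractional Sobolev space `H^s(𝕊)`:
`ψ ∈ L²(𝕊)` and `Σ_{l,m} (l+1)^{2s} |ψ̂_l^m|² < ∞`.
(The coefficients with `|m| > l` vanish automatically.) -/
def MemHs (s : ℝ) (ψ : ℝ → ℝ → ℂ) : Prop :=
  MeasureTheory.MemLp (fun p : ℝ × ℝ => ψ p.1 p.2) 2 sphereMeasure ∧
    Summable fun p : ℕ × ℤ =>
      ((p.1 : ℝ) + 1) ^ (2 * s) * ‖flCoeff ψ p.1 p.2‖ ^ 2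

/-- The `H^s(𝕊)` norm. -/
def HsNorm (s : ℝ) (ψ : ℝ → ℝ → ℂ) : ℝ :=
  Real.sqrt (∑' p : ℕ × ℤ, ((p.1 : ℝ) + 1) ^ (2 * s) * ‖flCoeff ψ p.1 p.2‖ ^ 2)

/-- Axially symmetric functions on the sphere: functions not depending on the longitude. -/
def Axial (ψ : ℝ → ℝ → ℂ) : Prop := ∀ θ φ₁ φ₂, ψ θ φ₁ = ψ θ φ₂

/-- Spherical (latitude/longitude) coordinates on the unit sphere of `ℝ³`. -/
def sphCoord (θ φ : ℝ) : EuclideanSpace ℝ (Fin 3) :=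
  (WithLp.equiv 2 (Fin 3 → ℝ)).symm
    ![Real.cos θ * Real.cos φ, Real.cos θ * Real.sin φ, Real.sin θ]

/-- The open exterior `Ω` of the unit sphere. -/
def extDomain : Set (EuclideanSpace ℝ (Fin 3)) := {x | 1 < ‖x‖}

/-- The closed exterior `cl Ω` of the unit sphere. -/
def closedExt : Set (EuclideanSpace ℝ (Fin 3)) := {x | 1 ≤ ‖x‖}

/-- The Laplacian of a function on `ℝ³`. -/
def lap {F : Type*} [NormedAddCommGroup F] [NormedSpace ℝ F]
    (u : EuclideanSpace ℝ (Fin 3) → F) (x : EuclideanSpace ℝ (Fin 3)) : F :=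
  ∑ i : Fin 3, fderiv ℝ (fun y => fderiv ℝ u y (EuclideanSpace.single i 1)) x
    (EuclideanSpace.single i 1)

/-- The radial derivative `u_r` at a point of the unit sphere (taken from outside). -/
def radialDeriv {F : Type*} [NormedAddCommGroup F] [NormedSpace ℝ F]
    (u : EuclideanSpace ℝ (Fin 3) → F) (θ φ : ℝ) : F :=
  derivWithin (fun r : ℝ => u (r • sphCoord θ φ)) (Set.Ici 1) 1

/-- The latitudinal derivative `u_θ` at a point of the unit sphere. -/
def thetaDeriv {F : Type*} [NormedAddCommGroup F] [NormedSpace ℝ F]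
    (u : EuclideanSpace ℝ (Fin 3) → F) (θ φ : ℝ) : F :=
  deriv (fun t => u (sphCoord t φ)) θ

/-- The boundary trace on the unit sphere of a real-valued function, in coordinates. -/
def traceR (u : EuclideanSpace ℝ (Fin 3) → ℝ) (θ φ : ℝ) : ℂ := (u (sphCoord θ φ) : ℂ)

/-- The boundary trace on the unit sphere of a complex-valued function, in coordinates. -/
def traceC (u : EuclideanSpace ℝ (Fin 3) → ℂ) (θ φ : ℝ) : ℂ := u (sphCoord θ φ)

/-- The Fourier coefficient on the equator `ℰ`. -/
def equatorCoeff (h : ℝ → ℂ) (m : ℤ) : ℂ :=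
  (1 / (2 * Real.pi)) * ∫ φ in (-Real.pi)..Real.pi, h φ * Complex.exp (-(Complex.I * m * φ))

/-- Membership in the fractional Sobolev space `H^s(ℰ)` on the equator. -/
def MemHsE (s : ℝ) (h : ℝ → ℂ) : Prop :=
  MeasureTheory.MemLp h 2 (volume.restrict (Set.Ico (-Real.pi) Real.pi)) ∧
    Summable fun m : ℤ => ((m.natAbs : ℝ) + 1) ^ (2 * s) * ‖equatorCoeff h m‖ ^ 2

/-- The `H^s(ℰ)` norm. -/
def HsNormE (s : ℝ) (h : ℝ → ℂ) : ℝ :=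
  Real.sqrt (∑' m : ℤ, ((m.natAbs : ℝ) + 1) ^ (2 * s) * ‖equatorCoeff h m‖ ^ 2)

/-- The constant `β_l^m`. -/
def betaLM (l : ℕ) (m : ℤ) : ℝ :=
  Real.sqrt (((l : ℝ) - m.natAbs) * ((l : ℝ) + m.natAbs) /
    ((2 * (l : ℝ) - 1) * (2 * (l : ℝ) + 1)))

/-- The constant `γ_l^m = -(l+1)β_l^m / (3(l+2)β_{l+1}^m)`. -/
def gammaLM (l : ℕ) (m : ℤ) : ℝ :=
  -(((l : ℝ) + 1) * betaLM l m) / (3 * ((l : ℝ) + 2) * betaLM (l + 1) m)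

/-- The product `Γ_k^m = ∏_{j=1}^k γ_{|m|+2j-1}^m` (with `Γ_0^m = 1`). -/
def GammaKM (m : ℤ) (k : ℕ) : ℝ :=
  ∏ j ∈ Finset.Icc 1 k, gammaLM (m.natAbs + 2 * j - 1) m

/-- The value `α_{|m|+2k}^m P_{|m|+2k}^{|m|}(0)`. -/
def PzeroM (m : ℤ) (k : ℕ) : ℝ :=
  alphaY (m.natAbs + 2 * k) m * assocLegendre (m.natAbs + 2 * k) m.natAbs 0

/-- The coefficient `a_l^m = f̂_l^m / (6(l+2)β_{l+1}^m)`. -/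
def aCoef (f : ℝ → ℝ → ℂ) (l : ℕ) (m : ℤ) : ℂ :=
  flCoeff f l m / ((6 * ((l : ℝ) + 2) * betaLM (l + 1) m : ℝ) : ℂ)

/-- The solution of the recurrence `b_{|m|-1}^m = b_{|m|}^m = 0`,
`b_{l+1}^m = γ_l^m b_{l-1}^m + a_l^m`; here `bSeq f m n = b_{|m|-1+n}^m`. -/
def bSeq (f : ℝ → ℝ → ℂ) (m : ℤ) : ℕ → ℂ
  | 0 => 0
  | 1 => 0
  | n + 2 => ((gammaLM (m.natAbs + n) m : ℝ) : ℂ) * bSeq f m n + aCoef f (m.natAbs + n) m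

/-- The coefficient `b_l^m`. -/
def bCoef (f : ℝ → ℝ → ℂ) (l : ℕ) (m : ℤ) : ℂ := bSeq f m (l + 1 - m.natAbs)

/-- The constant `ã^m`. -/
def aTilde (f : ℝ → ℝ → ℂ) (h : ℝ → ℂ) (m : ℤ) : ℂ :=
  (equatorCoeff h m - ∑' k : ℕ, bCoef f (m.natAbs + 2 * k) m * ((PzeroM m k : ℝ) : ℂ)) /
    (((∑' k : ℕ, GammaKM m k * PzeroM m k : ℝ)) : ℂ)

/-- The coefficient `c_l^m`: `c_{|m|+2k}^m = Γ_k^m ã^m` and `c_{|m|+2k-1}^m = 0`. -/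
def cCoef (f : ℝ → ℝ → ℂ) (h : ℝ → ℂ) (l : ℕ) (m : ℤ) : ℂ :=
  if m.natAbs ≤ l ∧ (l - m.natAbs) % 2 = 0 then
    ((GammaKM m ((l - m.natAbs) / 2) : ℝ) : ℂ) * aTilde f h m
  else 0

/-- The boundary trace `v(1, θ, φ)` of the formal series solution. -/
def vTraceS (f : ℝ → ℝ → ℂ) (h : ℝ → ℂ) (θ φ : ℝ) : ℂ :=
  ∑' p : ℕ × ℤ, (bCoef f p.1 p.2 + cCoef f h p.1 p.2) * Ylm p.1 p.2 θ φ

/-- The latitude of a point of `ℝ³`. -/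
def latitude (x : EuclideanSpace ℝ (Fin 3)) : ℝ := Real.arcsin (x 2 / ‖x‖)

/-- The longitude of a point of `ℝ³`. -/
def longitude (x : EuclideanSpace ℝ (Fin 3)) : ℝ :=
  Complex.arg ((x 0 : ℂ) + (x 1 : ℂ) * Complex.I)

/-- The formal series solution `v = Σ (b_l^m + c_l^m) r^{-l-1} Y_l^m(θ, φ)`. -/
def vFun (f : ℝ → ℝ → ℂ) (h : ℝ → ℂ) (x : EuclideanSpace ℝ (Fin 3)) : ℂ :=
  ∑' p : ℕ × ℤ, (bCoef f p.1 p.2 + cCoef f h p.1 p.2) * ((‖x‖ : ℂ) ^ (-(p.1 : ℤ) - 1)) *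
    Ylm p.1 p.2 (latitude x) (longitude x)

/-- `v` is a classical solution of the linearized (oblique derivative) problem
`Δv = 0` in `Ω`, `∇d⋅∇v = -2 sin θ v_r + cos θ v_θ = f/2` on `𝕊`, `v → 0` at infinity,
`v = h` on the equator; complex-valued version. -/
def SolvesObliqueC (v : EuclideanSpace ℝ (Fin 3) → ℂ) (f : ℝ → ℝ → ℂ) (h : ℝ → ℂ) : Prop :=
  ContDiffOn ℝ 2 v extDomain ∧ ContDiffOn ℝ 1 v closedExt ∧
    (∀ x ∈ extDomain, lap v x = 0) ∧
    (∀ θ ∈ Set.Icc (-(Real.pi / 2)) (Real.pi / 2), ∀ φ : ℝ,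
      -2 * (Real.sin θ : ℂ) * radialDeriv v θ φ + (Real.cos θ : ℂ) * thetaDeriv v θ φ
        = f θ φ / 2) ∧
    Filter.Tendsto v (Bornology.cobounded _) (nhds 0) ∧
    (∀ φ : ℝ, v (sphCoord 0 φ) = h φ)

/-- Real-valued version of `SolvesObliqueC`. -/
def SolvesObliqueR (v : EuclideanSpace ℝ (Fin 3) → ℝ) (f : ℝ → ℝ → ℝ) (h : ℝ → ℝ) : Prop :=
  ContDiffOn ℝ 2 v extDomain ∧ ContDiffOn ℝ 1 v closedExt ∧
    (∀ x ∈ extDomain, lap v x = 0) ∧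
    (∀ θ ∈ Set.Icc (-(Real.pi / 2)) (Real.pi / 2), ∀ φ : ℝ,
      -2 * Real.sin θ * radialDeriv v θ φ + Real.cos θ * thetaDeriv v θ φ = f θ φ / 2) ∧
    Filter.Tendsto v (Bornology.cobounded _) (nhds 0) ∧
    (∀ φ : ℝ, v (sphCoord 0 φ) = h φ)


section Part1

open MeasureTheory Real Filter

set_option linter.all false

open Polynomial in
lemma leg_C2 : (C (2:ℝ) : ℝ[X]) = 2 := map_ofNat C 2

open Polynomial in
lemma legendreP_zero : legendreP 0 = 1 := by
  simp [legendreP]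

/-- abbreviation for the derivatives of Legendre polynomials -/
def DP (m n : ℕ) : Polynomial ℝ := Polynomial.derivative^[m] (legendreP n)

lemma DP_succ (m n : ℕ) : DP (m + 1) n = Polynomial.derivative (DP m n) := by
  simp only [DP, Function.iterate_succ_apply']

lemma DP_zero (n : ℕ) : DP 0 n = legendreP n := rfl

open Polynomial in
lemma leg_X_iter (k : ℕ) (u : ℝ[X]) :
    derivative^[k+1] (X * u) = X * derivative^[k+1] u + (k+1 : ℝ[X]) * derivative^[k] u := by
  induction k with
  | zero => simp; ring
  | succ k ih =>
    rw [Function.iterate_succ_apply', ih]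
    simp only [derivative_add, derivative_mul, derivative_X, Function.iterate_succ_apply']
    push_cast
    simp
    ring

open Polynomial in
lemma leg_I2 (n : ℕ) : DP 1 (n+1) = (n+1 : ℝ[X]) * DP 0 n + X * DP 1 n := by
  have h1 : derivative ((X^2 - 1 : ℝ[X])^(n+1)) = C (2*(n+1:ℝ)) * (X * (X^2-1)^n) := by
    rw [derivative_pow]
    simp [leg_C2]
    ring
  have h2 : derivative^[n+2] ((X^2 - 1 : ℝ[X])^(n+1)) =
      C (2*(n+1:ℝ)) * (X * derivative^[n+1] ((X^2-1 : ℝ[X])^n) +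
        (n+1 : ℝ[X]) * derivative^[n] ((X^2-1 : ℝ[X])^n)) := by
    rw [Function.iterate_succ_apply, h1, iterate_derivative_C_mul, leg_X_iter]
  have e1 : DP 1 (n+1) = C ((2 ^ (n+1) * (n+1).factorial : ℝ)⁻¹) *
      derivative^[n+2] ((X^2 - 1 : ℝ[X])^(n+1)) := by
    rw [DP, legendreP, iterate_derivative_C_mul, ← Function.iterate_add_apply]; congr 2; ring_nf
  have e2 : DP 1 n = C ((2 ^ n * n.factorial : ℝ)⁻¹) *
      derivative^[n+1] ((X^2 - 1 : ℝ[X])^n) := by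
    rw [DP, legendreP, iterate_derivative_C_mul, ← Function.iterate_add_apply]; congr 2; ring_nf
  have e3 : DP 0 n = C ((2 ^ n * n.factorial : ℝ)⁻¹) *
      derivative^[n] ((X^2 - 1 : ℝ[X])^n) := rfl
  rw [e1, e2, e3, h2, ← mul_assoc, ← C_mul]
  have : (2 ^ (n+1) * (n+1).factorial : ℝ)⁻¹ * (2*(n+1:ℝ)) = (2 ^ n * n.factorial : ℝ)⁻¹ := by
    rw [Nat.factorial_succ]; push_cast
    have : (n.factorial : ℝ) ≠ 0 := by positivity
    field_simp
    ring
  rw [this]; ring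

open Polynomial in
lemma leg_X2_iter (k : ℕ) (u : ℝ[X]) :
    derivative^[k+2] ((X^2-1) * u) = (X^2-1) * derivative^[k+2] u +
      C (2*(k+2:ℝ)) * X * derivative^[k+1] u + C ((k+2:ℝ)*(k+1)) * derivative^[k] u := by
  induction k with
  | zero => simp [C_mul, leg_C2]; ring
  | succ k ih =>
    rw [Function.iterate_succ_apply', ih]
    simp only [derivative_add, derivative_mul, derivative_X, Function.iterate_succ_apply',
      derivative_C, derivative_sub, derivative_one, derivative_X_pow]
    push_cast
    simp [leg_C2]
    ring

open Polynomial in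
lemma leg_I1 (n : ℕ) : (1 - X^2) * DP 2 n - 2 * X * DP 1 n + C ((n:ℝ)*(n+1)) * DP 0 n = 0 := by
  rcases n with _ | n
  · simp [DP, legendreP_zero]
  set u : ℝ[X] := (X^2-1)^(n+1) with hu
  have h1 : (X^2 - 1) * derivative u = C (2*(n+1:ℝ)) * (X * u) := by
    rw [hu, derivative_pow]
    simp [leg_C2]
    ring
  have h2 := congrArg (fun p => derivative^[n+2] p) h1
  rw [leg_X2_iter, iterate_derivative_C_mul, leg_X_iter] at h2
  simp only [← Function.iterate_succ_apply] at h2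
  have e : ∀ k, DP k (n+1) = C ((2 ^ (n+1) * (n+1).factorial : ℝ)⁻¹) *
      derivative^[n+1+k] u := by
    intro k
    rw [DP, legendreP, iterate_derivative_C_mul, ← Function.iterate_add_apply]; congr 2; ring_nf
  rw [e 2, e 1, e 0]
  simp only [Nat.succ_eq_add_one, add_assoc, Nat.reduceAdd] at h2 ⊢
  simp only [map_mul, map_add, leg_C2, map_one, map_natCast] at h2 ⊢
  push_cast at h2 ⊢
  linear_combination (-C ((2 ^ (n+1) * (n+1).factorial : ℝ)⁻¹)) * h2

open Polynomial in
lemma leg_eval_one (n : ℕ) : (DP 0 n).eval 1 = 1 := by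
  have ode : ∀ n, 2 * (DP 1 n).eval 1 = n * (n+1) * (DP 0 n).eval 1 := by
    intro n
    have := congrArg (eval 1) (leg_I1 n)
    simp at this
    linarith
  induction n with
  | zero => simp [DP, legendreP_zero]
  | succ n ih =>
    have h := congrArg (eval 1) (leg_I2 n)
    have o1 := ode n
    have o2 := ode (n+1)
    simp [ih] at h o1 o2
    push_cast at o2
    have : ((n:ℝ)+1)*(n+2) * eval 1 (DP 0 (n+1)) = (n+1)*(n+2) * 1 := by linear_combination - o2 + 2 * h + o1
    exact mul_left_cancel₀ (by positivity) this

open Polynomial in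
lemma leg_J1 (m n : ℕ) : (1 - X^2) * DP (m+2) n - 2 * (m+1 : ℝ[X]) * X * DP (m+1) n +
    (n - m : ℝ[X]) * (n + m + 1 : ℝ[X]) * DP m n = 0 := by
  induction m with
  | zero =>
    have := leg_I1 n
    simp only [map_mul, map_add, map_natCast, map_one] at this
    push_cast; linear_combination this
  | succ m ih =>
    have h := congrArg derivative ih
    simp only [derivative_add, derivative_sub, derivative_mul, ← DP_succ, derivative_one,
      derivative_X_pow, derivative_X, derivative_natCast, derivative_zero, derivative_ofNat] at h
    push_cast at h ⊢
    simp [leg_C2] at h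
    linear_combination h

open Polynomial in
lemma leg_J2 (m n : ℕ) : DP (m+1) (n+1) = (n+1+m : ℝ[X]) * DP m n + X * DP (m+1) n := by
  induction m with
  | zero => simpa using leg_I2 n
  | succ m ih =>
    rw [DP_succ, ih]
    simp only [derivative_add, derivative_mul, ← DP_succ, derivative_one, derivative_X,
      derivative_natCast]
    push_cast; ring

open Polynomial in
lemma leg_J3 (m n : ℕ) : (1 - X^2) * DP (m+1) n - (n+1+m : ℝ[X]) * X * DP m n +
    (n+1-m : ℝ[X]) * DP m (n+1) = 0 := by
  induction m with
  | zero =>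
    have hd : derivative ((1 - X^2) * DP 1 n - (n+1 : ℝ[X]) * X * DP 0 n +
      (n+1 : ℝ[X]) * DP 0 (n+1)) = 0 := by
      have h1 := leg_J1 0 n
      have h2 := leg_I2 n
      simp only [derivative_add, derivative_sub, derivative_mul, ← DP_succ, derivative_one,
        derivative_X_pow, derivative_X, derivative_natCast]
      push_cast at h1 ⊢
      simp [leg_C2]
      simp at h1
      linear_combination h1 + (n+1 : ℝ[X]) * h2
    have hc := derivative_eq_zero.1 hd
    obtain ⟨c, hc⟩ := natDegree_eq_zero.1 hc
    have h0 := congrArg (eval 1) hc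
    simp [leg_eval_one] at h0
    rw [h0] at hc
    simp at hc ⊢
    exact hc.symm
  | succ m ih =>
    have h := congrArg derivative ih
    have h2 := leg_J2 m n
    simp only [derivative_add, derivative_sub, derivative_mul, ← DP_succ, derivative_one,
      derivative_X_pow, derivative_X, derivative_natCast, derivative_zero, derivative_ofNat] at h
    push_cast at h ⊢
    simp [leg_C2] at h
    linear_combination h - h2

open Polynomial in
lemma leg_J3' (m n : ℕ) : (1 - X^2) * DP (m+1) (n+1) + (n+1-m : ℝ[X]) * X * DP m (n+1)
    - (n+1+m : ℝ[X]) * DP m n = 0 := by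
  have h2 := leg_J2 m n
  have h3 := leg_J3 m n
  linear_combination (1 - X^2) * h2 + X * h3

open Polynomial in
lemma leg_three (m n : ℕ) : (2*n+3 : ℝ[X]) * X * DP m (n+1) = (n+2-m : ℝ[X]) * DP m (n+2) +
    (n+1+m : ℝ[X]) * DP m n := by
  have h3 := leg_J3 m (n+1)
  have h3' := leg_J3' m n
  push_cast at h3
  linear_combination h3' - h3

open Polynomial in
lemma leg_Dminus (m n : ℕ) : 2 * (m+1 : ℝ[X]) * DP (m+1) n - (1-X^2) * DP (m+2) (n+1) =
    (n - m : ℝ[X]) * (n - m + 1 : ℝ[X]) * DP m (n+1) := by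
  have h1 := leg_J1 m (n+1)
  have h2 := leg_J2 m n
  have h3 := leg_J3 m n
  have h3' := leg_J3' m n
  have h4 := leg_J2 (m+1) n
  have h5 := leg_J1 m n
  push_cast at *
  have key : X * DP (m+1) (n+1) - DP (m+1) n - (n+1-m : ℝ[X]) * DP m (n+1) = 0 := by
    linear_combination X * h2 - h3
  linear_combination 2 * (m+1 : ℝ[X]) * (-key) - h1

end Part1

section Part2

open MeasureTheory Real Filter
set_option linter.all false

open Polynomial in
lemma natDegree_iter_der (k : ℕ) (p : ℝ[X]) : (derivative^[k] p).natDegree = p.natDegree - k := by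
  induction k with
  | zero => simp
  | succ k ih =>
    rw [Function.iterate_succ_apply']
    rcases Nat.eq_zero_or_pos (derivative^[k] p).natDegree with h | h
    · rw [derivative_of_natDegree_zero h]; simp; omega
    · rw [natDegree_derivative, ih]; omega

open Polynomial in
lemma natDegree_legendreP (n : ℕ) : (legendreP n).natDegree = n := by
  rw [legendreP, natDegree_C_mul (by positivity), natDegree_iter_der]
  have : ((X^2 - 1 : ℝ[X])^n).natDegree = n * 2 := by
    rw [natDegree_pow]
    congr 1
    have := natDegree_X_pow_sub_C (n := 2) (r := (1:ℝ))
    simpa using this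
  omega

lemma natDegree_DP (m n : ℕ) : (DP m n).natDegree = n - m := by
  rw [DP, natDegree_iter_der, natDegree_legendreP]

lemma DP_eq_zero {m n : ℕ} (h : n < m) : DP m n = 0 := by
  rw [DP]
  exact Polynomial.iterate_derivative_eq_zero (by rw [natDegree_legendreP]; exact h)

open Polynomial in
lemma DP_ne_zero {m n : ℕ} (h : m ≤ n) : DP m n ≠ 0 := by
  rcases h.lt_or_eq with h | h
  · intro h0
    have := natDegree_DP m n
    rw [h0] at this; simp at this; omega
  · subst h
    have key : ∀ m : ℕ, eval 0 (DP m m) ≠ 0 := by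
      intro m
      induction m with
      | zero => simp [DP, legendreP_zero]
      | succ m ih =>
        rw [leg_J2]
        simp
        refine ⟨by positivity, ih⟩
    intro h0
    have := key m
    rw [h0] at this
    simp at this

open Polynomial in
lemma leg_three' (m n : ℕ) : (2*n+1 : ℝ[X]) * X * DP m n = (n+1-m : ℝ[X]) * DP m (n+1) +
    (n+m : ℝ[X]) * DP m (n-1) := by
  rcases n with _ | n
  · have h := leg_J3 m 0
    rw [DP_eq_zero (show 0 < m+1 by omega)] at h
    rcases m with _ | m
    · simp at h ⊢; linear_combination -h
    · rw [DP_eq_zero (show 0 < m+1 by omega)] at h ⊢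
      simp at h ⊢; exact h
  · have := leg_three m n
    simp
    linear_combination this

open Polynomial in
lemma leg_J3'' (m n : ℕ) : (1 - X^2) * DP (m+1) n - (m : ℝ[X]) * X * DP m n =
    (n+1 : ℝ[X]) * X * DP m n - (n+1-m : ℝ[X]) * DP m (n+1) := by
  linear_combination leg_J3 m n

/-- integral over [-1,1] of a polynomial -/
def pint (p : Polynomial ℝ) : ℝ := ∫ t in (-1:ℝ)..1, p.eval t

lemma pint_add (p q : Polynomial ℝ) : pint (p + q) = pint p + pint q := by
  unfold pint
  rw [← intervalIntegral.integral_add]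
  · simp
  · exact (p.continuous.intervalIntegrable _ _)
  · exact (q.continuous.intervalIntegrable _ _)

lemma pint_C_mul (c : ℝ) (q : Polynomial ℝ) : pint (Polynomial.C c * q) = c * pint q := by
  unfold pint
  rw [← intervalIntegral.integral_const_mul]
  simp

lemma pint_deriv (p : Polynomial ℝ) : pint (Polynomial.derivative p) = p.eval 1 - p.eval (-1) := by
  unfold pint
  apply intervalIntegral.integral_eq_sub_of_hasDerivAt (f := fun t => p.eval t)
  · intro x _; exact p.hasDerivAt x
  · exact ((Polynomial.derivative p).continuous.intervalIntegrable _ _)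

/-- the weighted inner products -/
def hgram (m l k : ℕ) : ℝ := pint ((1 - Polynomial.X^2)^m * DP m l * DP m k)

open Polynomial in
lemma hgram_succ (m l k : ℕ) : hgram (m+1) l k = ((l:ℝ) - m) * (l + m + 1) * hgram m l k := by
  have h : derivative ((1 - X^2)^(m+1) * DP (m+1) l * DP m k) =
      (1-X^2)^(m+1) * DP (m+1) l * DP (m+1) k +
        C (- (((l:ℝ) - m) * (l + m + 1))) * ((1-X^2)^m * DP m l * DP m k) := by
    rw [derivative_mul, derivative_mul, derivative_pow]
    simp only [← DP_succ]
    have := leg_J1 m l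
    simp [leg_C2]
    linear_combination ((1-X^2)^m * DP m k) * this
  have h2 := congrArg pint h
  rw [pint_deriv, pint_add, pint_C_mul] at h2
  simp at h2
  unfold hgram
  linarith

lemma hgram_symm (m l k : ℕ) : hgram m l k = hgram m k l := by
  unfold hgram; congr 1; ring

lemma hgram_zero_off (l k : ℕ) (h : l ≠ k) : hgram 0 l k = 0 := by
  have h1 := hgram_succ 0 l k
  have h2 := hgram_succ 0 k l
  rw [hgram_symm 1, hgram_symm 0 k] at h2
  have h3 : (((l:ℝ) - k) * (l + k + 1)) * hgram 0 l k = 0 := by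
    push_cast at h1 h2
    linear_combination - h1 + h2
  have : ((l:ℝ) - k) * (l + k + 1) ≠ 0 := by
    refine mul_ne_zero ?_ (by positivity)
    rw [sub_ne_zero]; exact_mod_cast h
  exact (mul_eq_zero.1 h3).resolve_left this

lemma hgram_off (m l k : ℕ) (h : l ≠ k) : hgram m l k = 0 := by
  induction m with
  | zero => exact hgram_zero_off l k h
  | succ m ih => rw [hgram_succ, ih]; simp

open Polynomial in
lemma hgram_zero_diag (l : ℕ) : hgram 0 l l = 2 / (2 * l + 1) := by
  induction l with
  | zero => simp [hgram, DP, legendreP_zero, pint]; norm_num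
  | succ n ih =>
    have e1 := congrArg (fun p => pint (p * DP 0 (n+1))) (leg_three' 0 n)
    have e2 := congrArg (fun p => pint (p * DP 0 n)) (leg_three' 0 (n+1))
    beta_reduce at e1 e2
    have t1 : (2*n+1 : ℝ[X]) * X * DP 0 n * DP 0 (n+1) = C (2*n+1:ℝ) * (X * DP 0 n * DP 0 (n+1)) := by
      simp [leg_C2]; ring
    have t2 : (2*(n+1 : ℕ)+1 : ℝ[X]) * X * DP 0 (n+1) * DP 0 n = C (2*n+3:ℝ) * (X * DP 0 n * DP 0 (n+1)) := by
      simp [leg_C2]; rw [show (C (3:ℝ) : ℝ[X]) = 3 from map_ofNat C 3]; ring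
    have t3 : ((n+1-(0:ℕ) : ℝ[X]) * DP 0 (n+1) + (n+(0:ℕ) : ℝ[X]) * DP 0 (n-1)) * DP 0 (n+1) =
        C (n+1:ℝ) * ((1-X^2)^0 * DP 0 (n+1) * DP 0 (n+1)) +
          C (n:ℝ) * ((1-X^2)^0 * DP 0 (n-1) * DP 0 (n+1)) := by
      simp; ring
    have t4 : (((n+1:ℕ)+1-(0:ℕ) : ℝ[X]) * DP 0 (n+1+1) + ((n+1:ℕ)+(0:ℕ) : ℝ[X]) * DP 0 (n+1-1)) * DP 0 n =
        C (n+2:ℝ) * ((1-X^2)^0 * DP 0 (n+2) * DP 0 n) +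
          C (n+1:ℝ) * ((1-X^2)^0 * DP 0 n * DP 0 n) := by
      simp [leg_C2]; ring
    rw [t1, t3, pint_C_mul, pint_add, pint_C_mul, pint_C_mul] at e1
    rw [t2, t4, pint_C_mul, pint_add, pint_C_mul, pint_C_mul] at e2
    change _ = _ * hgram 0 (n+1) (n+1) + _ * hgram 0 (n-1) (n+1) at e1
    change _ = _ * hgram 0 (n+2) n + _ * hgram 0 n n at e2
    rw [hgram_off _ _ _ (show n - 1 ≠ n + 1 by omega)] at e1
    rw [hgram_off _ _ _ (show n + 2 ≠ n by omega), ih] at e2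
    set Q := pint (X * DP 0 n * DP 0 (n+1))
    have hQ : Q = (n+1) * 2 / ((2*n+1) * (2*n+3)) := by
      field_simp
      field_simp at e2
      linarith
    rw [hQ] at e1
    push_cast
    have : (n+1:ℝ) * hgram 0 (n+1) (n+1) = (n+1) * (2/(2*(n+1)+1)) := by
      rw [show (2*((n:ℝ)+1)+1) = 2*n+3 by ring]
      field_simp at e1 ⊢
      have h9 : ((n:ℝ)+1)*((2*n+3)*hgram 0 (n+1) (n+1)) = (n+1)*2 := by linarith
      exact mul_left_cancel₀ (by positivity) h9
    exact mul_left_cancel₀ (by positivity) this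

lemma hgram_diag (m l : ℕ) (h : m ≤ l) :
    hgram m l l = 2 / (2 * l + 1) * ((l+m).factorial / (l-m).factorial) := by
  induction m with
  | zero =>
    rw [hgram_zero_diag]
    have : (l.factorial : ℝ) ≠ 0 := by positivity
    simp [div_self this]
  | succ m ih =>
    rw [hgram_succ, ih (by omega)]
    obtain ⟨k, rfl⟩ : ∃ k, l = m + 1 + k := ⟨l - (m+1), by omega⟩
    rw [show m + 1 + k - m = k + 1 by omega, show m + 1 + k - (m+1) = k by omega,
      show m + 1 + k + (m+1) = (m+1+k+m) + 1 by omega, Nat.factorial_succ, Nat.factorial_succ]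
    push_cast
    have : (k.factorial : ℝ) ≠ 0 := by positivity
    field_simp
    ring

open Polynomial in
lemma leg_sum_aux (l M : ℕ) (hM : M ≤ l) :
    derivative ((DP 0 l)^2 + ∑ m ∈ Finset.range M,
      C (2 * ((l-(m+1)).factorial / (l+(m+1)).factorial : ℝ)) *
        ((1-X^2)^(m+1) * (DP (m+1) l)^2)) =
    C (2 * ((l-M).factorial / (l+M).factorial : ℝ)) * ((1-X^2)^M * DP M l * DP (M+1) l) := by
  induction M with
  | zero =>
    have : (l.factorial : ℝ) ≠ 0 := by positivity
    simp [derivative_pow, ← DP_succ, div_self this, leg_C2]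
    ring
  | succ M ih =>
    rw [Finset.sum_range_succ, ← add_assoc, derivative_add, ih (by omega)]
    obtain ⟨k, rfl⟩ : ∃ k, l = M + 1 + k := ⟨l - (M+1), by omega⟩
    rw [show M + 1 + k - M = k + 1 by omega, show M + 1 + k - (M+1) = k by omega,
      show M + 1 + k + (M+1) = (M+1+k+M) + 1 by omega, Nat.factorial_succ, Nat.factorial_succ]
    push_cast
    have e : (2 * (((k:ℝ) + 1) * k.factorial / (M+1+k+M).factorial)) =
       (2 * (k.factorial / ((M+1+k+M+1) * (M+1+k+M).factorial))) * ((k+1) * (M+1+k+M+1)) := by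
      field_simp
    rw [e, C_mul]
    set c := C (2 * ((k.factorial:ℝ) / ((M+1+k+M+1) * (M+1+k+M).factorial)))
    have := leg_J1 M (M+1+k)
    rw [derivative_mul, derivative_mul, derivative_pow, derivative_pow]
    simp only [← DP_succ]
    simp [leg_C2, c]
    push_cast at this
    linear_combination (2 * C ((k.factorial:ℝ) / ((M+1+k+M+1) * (M+1+k+M).factorial))) * ((1-X^2)^M * DP (M+1) (M+1+k)) * this
open Polynomial in
lemma leg_sum (l : ℕ) (t : ℝ) : ((DP 0 l).eval t)^2 + ∑ m ∈ Finset.range l,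
      (2 * ((l-(m+1)).factorial / (l+(m+1)).factorial : ℝ)) *
        ((1-t^2)^(m+1) * ((DP (m+1) l).eval t)^2) = 1 := by
  have h := leg_sum_aux l l le_rfl
  rw [DP_eq_zero (show l < l + 1 by omega), mul_zero, mul_zero] at h
  obtain ⟨c, hc⟩ := natDegree_eq_zero.1 (derivative_eq_zero.1 h)
  have h1 := congrArg (eval 1) hc
  have h2 := congrArg (eval t) hc
  simp [eval_finset_sum, leg_eval_one] at h1 h2
  rw [h1] at h2
  simp [← h2]

end Part2

section Part3

open MeasureTheory Real Filter
set_option linter.all false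

/-- normalisation -/
def NN (l m : ℕ) : ℝ := Real.sqrt ((2 * l + 1) * (l - m).factorial / (4 * Real.pi * (l + m).factorial))

def sg (m : ℤ) : ℝ := if 0 ≤ m then 1 else (-1) ^ m.natAbs

lemma sg_sq (m : ℤ) : sg m * sg m = 1 := by
  unfold sg; split_ifs
  · simp
  · rw [← mul_pow]; simp

lemma abs_sg (m : ℤ) : |sg m| = 1 := by
  unfold sg; split_ifs <;> simp

lemma NN_pos (l m : ℕ) : 0 < NN l m := by
  unfold NN; apply Real.sqrt_pos.2; positivity

lemma NN_sq (l m : ℕ) : NN l m * NN l m =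
    (2 * l + 1) * (l - m).factorial / (4 * Real.pi * (l + m).factorial) := by
  unfold NN; rw [Real.mul_self_sqrt (by positivity)]

def yr (l : ℕ) (m : ℤ) (θ : ℝ) : ℝ :=
  sg m * NN l m.natAbs * (Real.cos θ) ^ m.natAbs * (DP m.natAbs l).eval (Real.sin θ)

def Yb (l : ℕ) (m : ℤ) (θ φ : ℝ) : ℂ := (yr l m θ : ℂ) * Complex.exp (Complex.I * m * φ)

lemma yr_eq_zero {l : ℕ} {m : ℤ} (h : l < m.natAbs) (θ : ℝ) : yr l m θ = 0 := by
  simp [yr, DP_eq_zero h]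

lemma sign_alpha (m : ℤ) : (-1 : ℝ) ^ ((m + |m|) / 2) * (-1 : ℝ) ^ m.natAbs = sg m := by
  unfold sg
  split_ifs with h
  · rw [abs_of_nonneg h]
    obtain ⟨n, rfl⟩ := Int.eq_ofNat_of_zero_le h
    rw [show ((n:ℤ) + n) / 2 = n by omega]
    simp [← mul_pow]
  · rw [abs_of_neg (by omega)]
    simp

lemma Ylm_eq (l : ℕ) (m : ℤ) (θ φ : ℝ) (h : 0 ≤ Real.cos θ) : Ylm l m θ φ = Yb l m θ φ := by
  unfold Ylm Yb
  congr 2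
  unfold alphaY assocLegendre yr
  have h1 : (1 - Real.sin θ ^ 2) ^ ((m.natAbs : ℝ) / 2) = Real.cos θ ^ m.natAbs := by
    rw [show 1 - Real.sin θ ^ 2 = Real.cos θ ^ 2 by rw [← Real.cos_sq_add_sin_sq θ]; ring]
    rw [← Real.rpow_natCast, ← Real.rpow_natCast, ← Real.rpow_mul h]
    congr 1; push_cast; ring
  rw [h1, ← sign_alpha]
  unfold DP NN
  ring

lemma yr_continuous (l : ℕ) (m : ℤ) : Continuous (yr l m) := by
  unfold yr
  have := (DP m.natAbs l).continuous
  fun_prop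

lemma Yb_continuous (l : ℕ) (m : ℤ) : Continuous (fun q : ℝ × ℝ => Yb l m q.1 q.2) := by
  unfold Yb
  have := yr_continuous l m
  fun_prop

def box : Set (ℝ × ℝ) :=
  Set.Icc (-(Real.pi / 2)) (Real.pi / 2) ×ˢ Set.Ico (-Real.pi) Real.pi

lemma box_meas : MeasurableSet box := measurableSet_Icc.prod measurableSet_Ico

lemma sphereMeasure_eq : sphereMeasure = ((volume : Measure (ℝ × ℝ)).restrict box).withDensity
    fun p => ENNReal.ofReal (Real.cos p.1) := rfl

lemma ae_box : ∀ᵐ p ∂sphereMeasure, p ∈ box := by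
  have h1 : sphereMeasure ≪ (volume : Measure (ℝ × ℝ)).restrict box :=
    withDensity_absolutelyContinuous _ _
  exact h1.ae_le (ae_restrict_mem box_meas)

lemma cos_nonneg_box {p : ℝ × ℝ} (h : p ∈ box) : 0 ≤ Real.cos p.1 :=
  Real.cos_nonneg_of_mem_Icc h.1

lemma flCoeff_eq (ψ : ℝ → ℝ → ℂ) (l : ℕ) (m : ℤ) : flCoeff ψ l m =
    ∫ p : ℝ × ℝ, ψ p.1 p.2 * (starRingEnd ℂ) (Yb l m p.1 p.2) ∂sphereMeasure := by
  unfold flCoeff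
  apply integral_congr_ae
  filter_upwards [ae_box] with p hp
  rw [Ylm_eq _ _ _ _ (cos_nonneg_box hp)]

lemma volume_box_lt_top : volume box < ⊤ := by
  unfold box
  rw [Measure.volume_eq_prod, Measure.prod_prod]
  simp [ENNReal.mul_lt_top_iff]

instance : IsFiniteMeasure sphereMeasure := by
  rw [sphereMeasure_eq]
  have : IsFiniteMeasure ((volume : Measure (ℝ × ℝ)).restrict box) :=
    ⟨by rw [Measure.restrict_apply_univ]; exact volume_box_lt_top⟩
  apply isFiniteMeasure_withDensity_ofReal
  refine HasFiniteIntegral.of_bounded (C := 1) ?_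
  filter_upwards with p
  simpa using Real.abs_cos_le_one p.1

lemma integral_sphere (g : ℝ × ℝ → ℂ) :
    ∫ p, g p ∂sphereMeasure = ∫ p in box, (Real.cos p.1 : ℂ) * g p := by
  rw [sphereMeasure_eq]
  rw [show (fun p : ℝ × ℝ => ENNReal.ofReal (Real.cos p.1)) =
    (fun p => ((Real.toNNReal (Real.cos p.1) : NNReal) : ENNReal)) from rfl]
  rw [integral_withDensity_eq_integral_smul (by fun_prop)]
  apply setIntegral_congr_fun box_meas
  intro p hp
  simp only [NNReal.smul_def, Real.coe_toNNReal _ (cos_nonneg_box hp)]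
  simp

lemma integrable_sphere_iff (g : ℝ × ℝ → ℂ) :
    Integrable g sphereMeasure ↔ IntegrableOn (fun p => (Real.cos p.1 : ℂ) * g p) box := by
  rw [sphereMeasure_eq]
  rw [show (fun p : ℝ × ℝ => ENNReal.ofReal (Real.cos p.1)) =
    (fun p => ((Real.toNNReal (Real.cos p.1) : NNReal) : ENNReal)) from rfl]
  rw [integrable_withDensity_iff_integrable_smul (by fun_prop)]
  apply integrable_congr
  filter_upwards [ae_restrict_mem box_meas] with p hp
  simp only [NNReal.smul_def, Real.coe_toNNReal _ (cos_nonneg_box hp)]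
  simp

lemma ioc_box (g : ℝ → ℝ → ℂ) (hg : IntegrableOn (fun p : ℝ × ℝ => g p.1 p.2) box) :
    ∫ p in box, g p.1 p.2 = ∫ θ in (-(π/2))..(π/2), ∫ φ in (-π)..π, g θ φ := by
  unfold box at *
  rw [Measure.volume_eq_prod] at *
  rw [setIntegral_prod _ hg, intervalIntegral.integral_of_le (by linarith [pi_pos]),
    integral_Icc_eq_integral_Ioc]
  congr 1
  ext θ
  rw [intervalIntegral.integral_of_le (by linarith [pi_pos]), integral_Ico_eq_integral_Ioc]

lemma integrableOn_box {g : ℝ × ℝ → ℂ} (hg : Continuous g) : IntegrableOn g box := by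
  apply IntegrableOn.mono_set (t := Set.Icc (-(π/2)) (π/2) ×ˢ Set.Icc (-π) π)
  · exact hg.continuousOn.integrableOn_compact (isCompact_Icc.prod isCompact_Icc)
  · exact Set.prod_mono le_rfl Set.Ico_subset_Icc_self

lemma integrable_sphere {g : ℝ × ℝ → ℂ} (hg : Continuous g) : Integrable g sphereMeasure := by
  rw [integrable_sphere_iff]
  apply integrableOn_box
  fun_prop

lemma conj_Yb (l : ℕ) (m : ℤ) (θ φ : ℝ) : (starRingEnd ℂ) (Yb l m θ φ) =
    (yr l m θ : ℂ) * Complex.exp (-(Complex.I * m * φ)) := by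
  unfold Yb
  rw [map_mul, Complex.conj_ofReal, ← Complex.exp_conj]
  simp

lemma flCoeff_cont {ψ : ℝ → ℝ → ℂ} (hψ : Continuous (fun q : ℝ × ℝ => ψ q.1 q.2)) (l : ℕ) (m : ℤ) :
    flCoeff ψ l m = ∫ θ in (-(π/2))..(π/2),
      (∫ φ in (-π)..π, ψ θ φ * Complex.exp (-(Complex.I * m * φ))) * ((yr l m θ * Real.cos θ : ℝ) : ℂ) := by
  rw [flCoeff_eq, integral_sphere]
  have hY := Yb_continuous l m
  rw [ioc_box (fun θ φ => (Real.cos θ : ℂ) * (ψ θ φ * (starRingEnd ℂ) (Yb l m θ φ)))]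
  · apply intervalIntegral.integral_congr
    intro θ _
    beta_reduce
    rw [← intervalIntegral.integral_mul_const]
    apply intervalIntegral.integral_congr
    intro φ _
    beta_reduce
    rw [conj_Yb]
    push_cast; ring
  · apply integrableOn_box
    have := Complex.continuous_conj
    fun_prop

lemma integral_exp_int (k : ℤ) : ∫ φ in (-π)..π, Complex.exp (Complex.I * k * φ) =
    if k = 0 then (2 * π : ℂ) else 0 := by
  split_ifs with h
  · subst h; simp; ring
  · have hk : Complex.I * (k:ℂ) ≠ 0 := mul_ne_zero Complex.I_ne_zero (by exact_mod_cast h)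
    rw [integral_exp_mul_complex hk]
    have : Complex.exp (Complex.I * k * (π:ℝ)) = Complex.exp (Complex.I * k * ((-π : ℝ) : ℂ)) := by
      rw [Complex.exp_eq_exp_iff_exists_int]
      exact ⟨k, by push_cast; ring⟩
    rw [this]; simp

lemma integral_yr (l l' : ℕ) (m : ℤ) : ∫ θ in (-(π/2))..(π/2), yr l m θ * (yr l' m θ * Real.cos θ) =
    NN l m.natAbs * NN l' m.natAbs * hgram m.natAbs l l' := by
  have h := intervalIntegral.integral_comp_mul_deriv (a := -(π/2)) (b := π/2) (f := Real.sin)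
    (f' := Real.cos) (g := fun t => Polynomial.eval t ((1 - Polynomial.X^2)^m.natAbs * DP m.natAbs l * DP m.natAbs l'))
    (fun x _ => Real.hasDerivAt_sin x) Real.continuous_cos.continuousOn (Polynomial.continuous _)
  rw [hgram, pint]
  simp only [Real.sin_neg, Real.sin_pi_div_two] at h
  rw [← h, ← intervalIntegral.integral_const_mul]
  apply intervalIntegral.integral_congr
  intro θ _
  simp only [yr, Function.comp]
  simp
  rw [← Real.cos_sq' θ, ← pow_mul]
  linear_combination (NN l m.natAbs * NN l' m.natAbs * Real.cos θ ^ (2 * m.natAbs) *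
    Polynomial.eval (sin θ) (DP m.natAbs l) * Polynomial.eval (sin θ) (DP m.natAbs l') * cos θ) * sg_sq m

lemma Yb_orth (l l' : ℕ) (m m' : ℤ) (hm : m.natAbs ≤ l) :
    flCoeff (Yb l m) l' m' = if l = l' ∧ m = m' then 1 else 0 := by
  rw [flCoeff_cont (Yb_continuous l m)]
  have h1 : ∀ θ : ℝ, ∫ φ in (-π)..π, Yb l m θ φ * Complex.exp (-(Complex.I * m' * φ)) =
      (yr l m θ : ℂ) * if m - m' = 0 then (2 * π : ℂ) else 0 := by
    intro θ
    rw [← integral_exp_int, ← intervalIntegral.integral_const_mul]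
    apply intervalIntegral.integral_congr
    intro φ _
    simp only [Yb]
    rw [mul_assoc, ← Complex.exp_add]
    congr 2; push_cast; ring
  simp_rw [h1]
  by_cases hmm : m = m'
  · subst hmm
    simp only [sub_self, if_true, and_true]
    have h2 : ∀ θ : ℝ, (yr l m θ : ℂ) * (2 * π : ℂ) * ((yr l' m θ * Real.cos θ : ℝ) : ℂ) =
        ((2 * π * (yr l m θ * (yr l' m θ * Real.cos θ)) : ℝ) : ℂ) := by
      intro θ; push_cast; ring
    simp_rw [h2]
    rw [intervalIntegral.integral_ofReal, intervalIntegral.integral_const_mul, integral_yr]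
    split_ifs with hl
    · subst hl
      rw [hgram_diag _ _ hm, NN_sq]
      have h3 : ((l - m.natAbs).factorial : ℝ) ≠ 0 := by positivity
      have h4 : ((l + m.natAbs).factorial : ℝ) ≠ 0 := by positivity
      have h5 := pi_pos.ne'
      rw [← Complex.ofReal_one]
      congr 1
      field_simp
      try ring
    · rw [hgram_off _ _ _ hl]; simp
  · have : m - m' ≠ 0 := sub_ne_zero.2 hmm
    simp [this, hmm]

lemma flCoeff_of_lt (ψ : ℝ → ℝ → ℂ) {l : ℕ} {m : ℤ} (h : l < m.natAbs) : flCoeff ψ l m = 0 := by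
  rw [flCoeff_eq]
  simp [Yb, yr_eq_zero h]

lemma sum_yr_sq (l : ℕ) (θ : ℝ) : ∑ m ∈ Finset.Icc (-(l:ℤ)) l, yr l m θ ^ 2 = (2 * l + 1) / (4 * π) := by
  have hs := leg_sum l (Real.sin θ)
  have key : ∀ L : ℕ, ∀ g : ℤ → ℝ, (∀ m, g (-m) = g m) → ∑ m ∈ Finset.Icc (-(L:ℤ)) L, g m =
      g 0 + ∑ m ∈ Finset.range L, 2 * g ((m:ℤ) + 1) := by
    intro L g hg
    induction L with
    | zero => simp
    | succ L ih =>
      rw [Finset.sum_range_succ, ← add_assoc, ← ih]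
      have : Finset.Icc (-((L+1:ℕ):ℤ)) ((L+1:ℕ):ℤ) =
        insert (-((L:ℤ)+1)) (insert ((L:ℤ)+1) (Finset.Icc (-(L:ℤ)) L)) := by
        ext x; simp; omega
      rw [this, Finset.sum_insert (by simp; omega), Finset.sum_insert (by simp), hg]
      ring
  have hsq : ∀ m : ℤ, yr l m θ ^ 2 = ((2 * l + 1) / (4 * π)) * (((l - m.natAbs).factorial / (l + m.natAbs).factorial) *
      ((1 - Real.sin θ ^ 2)^m.natAbs * ((DP m.natAbs l).eval (Real.sin θ))^2)) := by
    intro m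
    rw [← Real.cos_sq', ← pow_mul]
    have h1 := sg_sq m
    have h2 := NN_sq l m.natAbs
    have : yr l m θ ^ 2 = (sg m * sg m) * (NN l m.natAbs * NN l m.natAbs) *
      (Real.cos θ ^ (2 * m.natAbs) * ((DP m.natAbs l).eval (Real.sin θ))^2) := by
      unfold yr; ring
    rw [this, h1, h2]
    field_simp
  rw [key l _ (by intro m; rw [hsq, hsq]; simp)]
  rw [hsq 0]
  have e : ∀ m : ℕ, 2 * yr l ((m:ℤ)+1) θ ^ 2 = ((2 * l + 1) / (4 * π)) * ((2 * ((l-(m+1)).factorial / (l+(m+1)).factorial : ℝ)) *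
        ((1-Real.sin θ^2)^(m+1) * ((DP (m+1) l).eval (Real.sin θ))^2)) := by
    intro m
    rw [hsq]
    rw [show ((m:ℤ)+1).natAbs = m + 1 by omega]
    ring
  simp_rw [e]
  rw [← Finset.mul_sum, ← mul_add]
  have : (l.factorial : ℝ) ≠ 0 := by positivity
  simp [div_self this] at hs ⊢
  rw [hs]; simp

end Part3

section Part4

open MeasureTheory Real Filter
set_option linter.all false

lemma fourier_uniq {g : ℝ → ℂ} (hg : Continuous g) (hp : ∀ φ, g (φ + 2 * π) = g φ)
    (h0 : ∀ m : ℤ, ∫ φ in (-π)..π, g φ * Complex.exp (-(Complex.I * m * φ)) = 0) : g = 0 := by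
  haveI : Fact (0 < 2 * π) := ⟨by positivity⟩
  have hper : Function.Periodic g (2 * π) := hp
  let G : C(AddCircle (2 * π), ℂ) := ⟨hper.lift, by
    exact continuous_coinduced_dom.2 hg⟩
  have hG : ∀ x : ℝ, G (x : AddCircle (2*π)) = g x := fun x => hper.lift_coe x
  have hc : ∀ n, fourierCoeff G n = 0 := by
    intro n
    rw [fourierCoeff_eq_intervalIntegral _ n (-π)]
    rw [show -π + 2 * π = π by ring]
    have : ∀ x : ℝ, (fourier (-n) (x : AddCircle (2*π))) • G x = g x * Complex.exp (-(Complex.I * n * x)) := by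
      intro x
      rw [hG, fourier_coe_apply, smul_eq_mul, mul_comm]
      congr 2
      have := pi_pos.ne'
      have : (π : ℂ) ≠ 0 := by exact_mod_cast this
      push_cast
      field_simp
    simp_rw [this, h0 n]; simp
  have hs : Summable (fourierCoeff G) := by
    rw [show fourierCoeff (G : AddCircle (2*π) → ℂ) = fun _ => 0 from funext hc]; exact summable_zero
  ext x
  have := has_pointwise_sum_fourier_series_of_summable hs (x : AddCircle (2*π))
  rw [hG] at this
  simp only [hc, zero_smul] at this
  simpa using this.unique hasSum_zero

open Polynomial in
lemma DP_span (M : ℕ) (p : ℝ[X]) : p ∈ Submodule.span ℝ (Set.range fun l => DP M (M + l)) := by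
  have hd : ∀ l, (DP M (M+l)).degree = l := by
    intro l
    rw [Polynomial.degree_eq_natDegree (DP_ne_zero (by omega)), natDegree_DP]; simp
  let S : Polynomial.Sequence ℝ := ⟨fun l => DP M (M+l), hd⟩
  have := S.span (fun i => by
    apply IsUnit.mk0
    exact Polynomial.leadingCoeff_ne_zero.2 (DP_ne_zero (by omega)))
  have h2 : p ∈ (⊤ : Submodule ℝ ℝ[X]) := trivial
  rw [← this] at h2
  exact h2

/-- a continuous function on [-1,1]-type weight orthogonal to polynomials vanishes -/
lemma weierstrass_zero {F : ℝ → ℂ} (hF : Continuous F)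
    (h : ∀ p : Polynomial ℝ, ∫ θ in (-(π/2))..(π/2), F θ * ((p.eval (Real.sin θ) * Real.cos θ : ℝ) : ℂ) = 0) :
    ∀ θ ∈ Set.Icc (-(π/2)) (π/2), F θ = 0 := by
  -- real version
  have key : ∀ G : ℝ → ℝ, Continuous G →
      (∀ p : Polynomial ℝ, ∫ θ in (-(π/2))..(π/2), G θ * (p.eval (Real.sin θ) * Real.cos θ) = 0) →
      ∀ θ ∈ Set.Icc (-(π/2)) (π/2), G θ = 0 := by
    intro G hG h
    have hle : -(π/2) ≤ π/2 := by linarith [pi_pos]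
    have hcos : ∀ θ ∈ Set.Icc (-(π/2)) (π/2), 0 ≤ Real.cos θ := fun θ hθ => Real.cos_nonneg_of_mem_Icc hθ
    -- ∫ G^2 cos = 0
    have h1 : ∫ θ in (-(π/2))..(π/2), G θ * (G θ * Real.cos θ) = 0 := by
      obtain ⟨B, hB⟩ := isCompact_Icc.exists_bound_of_continuousOn (s := Set.Icc (-(π/2)) (π/2)) hG.continuousOn
      have hB0 : 0 ≤ B := le_trans (norm_nonneg _) (hB 0 ⟨by linarith [pi_pos], by linarith [pi_pos]⟩)
      by_contra hne
      have hpos : 0 < |∫ θ in (-(π/2))..(π/2), G θ * (G θ * Real.cos θ)| := abs_pos.2 hne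
      set I := |∫ θ in (-(π/2))..(π/2), G θ * (G θ * Real.cos θ)| with hI
      have hε : 0 < I / (2 * (B + 1) * π) := by positivity
      obtain ⟨p, hp⟩ := exists_polynomial_near_of_continuousOn (-1) 1 (fun x => G (Real.arcsin x))
        (by have := Real.continuous_arcsin; fun_prop) _ hε
      have h2 := h p
      have h3 : ∫ θ in (-(π/2))..(π/2), G θ * (G θ * Real.cos θ) =
          ∫ θ in (-(π/2))..(π/2), G θ * ((G θ - p.eval (Real.sin θ)) * Real.cos θ) := by
        rw [← sub_zero (∫ θ in (-(π/2))..(π/2), G θ * (G θ * Real.cos θ)), ← h2,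
          ← intervalIntegral.integral_sub]
        · congr 1; ext θ; ring
        · apply Continuous.intervalIntegrable; fun_prop
        · apply Continuous.intervalIntegrable; have := p.continuous; fun_prop
      have h4 : I ≤ (B * (I / (2 * (B + 1) * π))) * |π/2 - -(π/2)| := by
        rw [hI, h3, ← Real.norm_eq_abs]
        apply intervalIntegral.norm_integral_le_of_norm_le_const
        intro θ hθ
        rw [Set.uIoc_of_le hle] at hθ
        have hθ' : θ ∈ Set.Icc (-(π/2)) (π/2) := ⟨hθ.1.le, hθ.2⟩
        rw [norm_mul]
        apply mul_le_mul (hB θ hθ') _ (norm_nonneg _) hB0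
        rw [norm_mul]
        have := hp (Real.sin θ) (Real.sin_mem_Icc θ)
        rw [Real.arcsin_sin hθ'.1 hθ'.2, abs_sub_comm] at this
        have h8 := mul_le_mul this.le (Real.abs_cos_le_one θ) (abs_nonneg _) hε.le
        rw [mul_one] at h8
        try rw [← h3]
        try rw [Real.norm_eq_abs, Real.norm_eq_abs]
        try rw [← Real.norm_eq_abs (∫ θ in _.._, _)]
        exact h8
      have h5 : (B * (I / (2 * (B + 1) * π))) * |π/2 - -(π/2)| = I * (B / (2 * (B+1))) := by
        rw [abs_of_nonneg (by linarith [pi_pos])]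
        field_simp; ring
      rw [h5] at h4
      have : B / (2 * (B+1)) < 1 := by rw [div_lt_one (by positivity)]; linarith
      nlinarith
    have h6 : ∀ θ ∈ Set.Ioo (-(π/2)) (π/2), G θ = 0 := by
      intro θ hθ
      by_contra hne
      have : 0 < ∫ θ in (-(π/2))..(π/2), G θ * (G θ * Real.cos θ) := by
        apply intervalIntegral.integral_pos (by linarith [pi_pos]) (by fun_prop)
        · intro x hx
          have := hcos x ⟨hx.1.le, hx.2⟩
          rw [← mul_assoc]; exact mul_nonneg (mul_self_nonneg _) this
        · refine ⟨θ, ⟨hθ.1.le, hθ.2.le⟩, ?_⟩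
          rw [← mul_assoc]
          exact mul_pos (mul_self_pos.2 hne) (Real.cos_pos_of_mem_Ioo hθ)
      linarith
    intro θ hθ
    have hcl : θ ∈ closure (Set.Ioo (-(π/2)) (π/2)) := by
      rw [closure_Ioo (by linarith [pi_pos])]; exact hθ
    exact closure_minimal (s := Set.Ioo (-(π/2)) (π/2)) (t := {x | G x = 0}) h6 (isClosed_eq hG continuous_const) hcl
  have hgram : ∀ p : Polynomial ℝ, IntervalIntegrable (fun θ => F θ * ((p.eval (Real.sin θ) * Real.cos θ : ℝ) : ℂ)) volume (-(π/2)) (π/2) := by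
    intro p
    apply Continuous.intervalIntegrable
    have := p.continuous
    fun_prop
  intro θ hθ
  apply Complex.ext
  · refine key (fun θ => (F θ).re) (by fun_prop) ?_ θ hθ
    intro p
    have := congrArg Complex.re (h p)
    rw [← Complex.reCLM_apply, ← ContinuousLinearMap.intervalIntegral_comp_comm _ (hgram p)] at this
    simpa [-Complex.ofReal_cos, -Complex.ofReal_mul] using this
  · refine key (fun θ => (F θ).im) (by fun_prop) ?_ θ hθ
    intro p
    have := congrArg Complex.im (h p)
    rw [← Complex.imCLM_apply, ← ContinuousLinearMap.intervalIntegral_comp_comm _ (hgram p)] at this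
    simpa [-Complex.ofReal_cos, -Complex.ofReal_mul] using this

/-- Fourier mode of a function in longitude -/
def mode (g : ℝ → ℝ → ℂ) (m : ℤ) (θ : ℝ) : ℂ := ∫ φ in (-π)..π, g θ φ * Complex.exp (-(Complex.I * m * φ))

lemma mode_continuous {g : ℝ → ℝ → ℂ} (hg : Continuous (fun q : ℝ × ℝ => g q.1 q.2)) (m : ℤ) :
    Continuous (mode g m) := by
  unfold mode
  apply intervalIntegral.continuous_parametric_intervalIntegral_of_continuous'
  have : Continuous (fun q : ℝ × ℝ => g q.1 q.2 * Complex.exp (-(Complex.I * m * q.2))) := by fun_prop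
  exact this

lemma mode_zero {g : ℝ → ℝ → ℂ} (hg : Continuous (fun q : ℝ × ℝ => g q.1 q.2)) (m : ℤ)
    (h : ∀ l, flCoeff g l m = 0) : ∀ θ ∈ Set.Icc (-(π/2)) (π/2), mode g m θ = 0 := by
  have hc := mode_continuous hg m
  have h1 : ∀ θ ∈ Set.Icc (-(π/2)) (π/2), mode g m θ * ((Real.cos θ ^ m.natAbs : ℝ) : ℂ) = 0 := by
    apply weierstrass_zero (by fun_prop)
    intro p
    have hp := DP_span m.natAbs p
    induction hp using Submodule.span_induction with
    | mem x hx =>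
      obtain ⟨l, rfl⟩ := hx
      have := h (m.natAbs + l)
      rw [flCoeff_cont hg] at this
      have e : ∀ θ : ℝ, (∫ φ in (-π)..π, g θ φ * Complex.exp (-(Complex.I * m * φ))) *
          ((yr (m.natAbs + l) m θ * Real.cos θ : ℝ) : ℂ) = ((sg m * NN (m.natAbs + l) m.natAbs : ℝ) : ℂ) *
          (mode g m θ * ((Real.cos θ ^ m.natAbs : ℝ) : ℂ) *
        (((DP m.natAbs (m.natAbs + l)).eval (Real.sin θ) * Real.cos θ : ℝ) : ℂ)) := by
        intro θ; unfold mode yr; push_cast; ring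
      simp_rw [e] at this
      rw [intervalIntegral.integral_const_mul] at this
      refine (mul_eq_zero.1 this).resolve_left ?_
      have h1 := NN_pos (m.natAbs + l) m.natAbs
      have h2 : sg m ≠ 0 := by intro h; have := sg_sq m; rw [h] at this; simp at this
      exact_mod_cast mul_ne_zero h2 h1.ne'
    | zero => simp
    | add p q _ _ hp hq =>
      simp only [Polynomial.eval_add, add_mul, Complex.ofReal_add, mul_add]
      rw [intervalIntegral.integral_add, hp, hq, add_zero]
      · apply Continuous.intervalIntegrable; have := p.continuous; fun_prop
      · apply Continuous.intervalIntegrable; have := q.continuous; fun_prop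
    | smul a p _ hp =>
      have e : ∀ θ : ℝ, mode g m θ * ((Real.cos θ ^ m.natAbs : ℝ) : ℂ) *
        (((a • p).eval (Real.sin θ) * Real.cos θ : ℝ) : ℂ) = (a : ℂ) * (mode g m θ * ((Real.cos θ ^ m.natAbs : ℝ) : ℂ) *
        ((p.eval (Real.sin θ) * Real.cos θ : ℝ) : ℂ)) := by
        intro θ; simp; ring
      simp_rw [e]
      rw [intervalIntegral.integral_const_mul, hp, mul_zero]
  have h6 : ∀ θ ∈ Set.Ioo (-(π/2)) (π/2), mode g m θ = 0 := by
    intro θ hθ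
    have := h1 θ ⟨hθ.1.le, hθ.2.le⟩
    refine (mul_eq_zero.1 this).resolve_right ?_
    exact_mod_cast (pow_pos (Real.cos_pos_of_mem_Ioo hθ) _).ne'
  intro θ hθ
  have hcl : θ ∈ closure (Set.Ioo (-(π/2)) (π/2)) := by
    rw [closure_Ioo (by linarith [pi_pos])]; exact hθ
  exact closure_minimal (s := Set.Ioo (-(π/2)) (π/2)) (t := {x | mode g m x = 0}) h6 (isClosed_eq hc continuous_const) hcl

lemma complete_C1 {g : ℝ → ℝ → ℂ} (hg : Continuous (fun q : ℝ × ℝ => g q.1 q.2))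
    (hp : ∀ θ φ, g θ (φ + 2 * π) = g θ φ) (h : ∀ l m, flCoeff g l m = 0) :
    ∀ θ ∈ Set.Icc (-(π/2)) (π/2), ∀ φ, g θ φ = 0 := by
  intro θ hθ φ
  have : g θ = 0 := fourier_uniq (by exact hg.comp (Continuous.prodMk_right θ)) (hp θ)
    (fun m => mode_zero hg m (fun l => h l m) θ hθ)
  rw [this]; rfl

lemma flCoeff_sub {g k : ℝ → ℝ → ℂ} (hg : Continuous (fun q : ℝ × ℝ => g q.1 q.2))
    (hk : Continuous (fun q : ℝ × ℝ => k q.1 q.2)) (l : ℕ) (m : ℤ) :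
    flCoeff (fun θ φ => g θ φ - k θ φ) l m = flCoeff g l m - flCoeff k l m := by
  simp only [flCoeff_eq]
  have hY := Yb_continuous l m
  have := Complex.continuous_conj
  rw [← integral_sub (integrable_sphere (by fun_prop)) (integrable_sphere (by fun_prop))]
  congr 1; ext p; ring

lemma flCoeff_const_mul (c : ℂ) (g : ℝ → ℝ → ℂ) (l : ℕ) (m : ℤ) :
    flCoeff (fun θ φ => c * g θ φ) l m = c * flCoeff g l m := by
  simp only [flCoeff_eq]
  rw [← integral_const_mul]
  congr 1; ext p; ring

lemma flCoeff_add {g k : ℝ → ℝ → ℂ} (hg : Continuous (fun q : ℝ × ℝ => g q.1 q.2))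
    (hk : Continuous (fun q : ℝ × ℝ => k q.1 q.2)) (l : ℕ) (m : ℤ) :
    flCoeff (fun θ φ => g θ φ + k θ φ) l m = flCoeff g l m + flCoeff k l m := by
  simp only [flCoeff_eq]
  have hY := Yb_continuous l m
  have := Complex.continuous_conj
  rw [← integral_add (integrable_sphere (by fun_prop)) (integrable_sphere (by fun_prop))]
  congr 1; ext p; ring

/-- norm bound -/
def KY : ℝ := sphereMeasure.real Set.univ

lemma yr_sq_le (l : ℕ) (m : ℤ) (θ : ℝ) : yr l m θ ^ 2 ≤ (2 * l + 1) / (4 * π) := by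
  by_cases h : l < m.natAbs
  · rw [yr_eq_zero h, zero_pow two_ne_zero]; positivity
  · rw [← sum_yr_sq l θ]
    apply Finset.single_le_sum (f := fun m => yr l m θ ^ 2) (fun i _ => sq_nonneg _)
    simp; omega

lemma norm_Yb (l : ℕ) (m : ℤ) (θ φ : ℝ) : ‖Yb l m θ φ‖ = |yr l m θ| := by
  unfold Yb
  rw [norm_mul, show Complex.I * (m:ℂ) * (φ:ℂ) = ((m * φ : ℝ) : ℂ) * Complex.I by push_cast; ring,
    Complex.norm_exp_ofReal_mul_I]
  simp

lemma norm_Yb_le (l : ℕ) (m : ℤ) (θ φ : ℝ) : ‖Yb l m θ φ‖ ≤ Real.sqrt (l + 1) := by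
  rw [norm_Yb]
  apply Real.abs_le_sqrt
  refine (yr_sq_le l m θ).trans ?_
  rw [div_le_iff₀ (by positivity)]
  nlinarith [pi_gt_three, (Nat.cast_nonneg l : (0:ℝ) ≤ l)]

lemma norm_flCoeff_le {ψ : ℝ → ℝ → ℂ} {B : ℝ} (hB : ∀ θ φ, ‖ψ θ φ‖ ≤ B) (l : ℕ) (m : ℤ) :
    ‖flCoeff ψ l m‖ ≤ B * Real.sqrt (l + 1) * KY := by
  rw [flCoeff_eq]
  apply norm_integral_le_of_norm_le_const
  filter_upwards with p
  rw [norm_mul, RCLike.norm_conj]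
  exact mul_le_mul (hB _ _) (norm_Yb_le _ _ _ _) (norm_nonneg _) (le_trans (norm_nonneg _) (hB 0 0))

end Part4

section Part5

open MeasureTheory Real Filter
set_option linter.all false

lemma flCoeff_tsum {ι : Type*} [Countable ι] {g : ι → ℝ → ℝ → ℂ} {B : ι → ℝ}
    (hg : ∀ i, Continuous (fun q : ℝ × ℝ => g i q.1 q.2)) (hB : ∀ i θ φ, ‖g i θ φ‖ ≤ B i)
    (hs : Summable B) (l : ℕ) (m : ℤ) :
    HasSum (fun i => flCoeff (g i) l m) (flCoeff (fun θ φ => ∑' i, g i θ φ) l m) := by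
  simp only [flCoeff_eq]
  have hY := Yb_continuous l m
  have hcc := Complex.continuous_conj
  have hbd : ∀ i (p : ℝ × ℝ), ‖g i p.1 p.2 * (starRingEnd ℂ) (Yb l m p.1 p.2)‖ ≤ B i * Real.sqrt (l+1) := by
    intro i p
    rw [norm_mul, RCLike.norm_conj]
    exact mul_le_mul (hB _ _ _) (norm_Yb_le _ _ _ _) (norm_nonneg _) (le_trans (norm_nonneg _) (hB i 0 0))
  have hgram : ∀ i, Integrable (fun p : ℝ × ℝ => g i p.1 p.2 * (starRingEnd ℂ) (Yb l m p.1 p.2)) sphereMeasure := by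
    intro i
    have := hg i
    apply integrable_sphere; fun_prop
  have := hasSum_integral_of_summable_integral_norm hgram (by
    refine Summable.of_nonneg_of_le (fun i => integral_nonneg (fun _ => norm_nonneg _)) ?_
      ((hs.mul_right (Real.sqrt (l+1))).mul_right KY)
    intro i
    have h1 := norm_integral_le_of_norm_le_const (μ := sphereMeasure)
      (f := fun p : ℝ × ℝ => ‖g i p.1 p.2 * (starRingEnd ℂ) (Yb l m p.1 p.2)‖)
      (C := B i * Real.sqrt (l+1)) (by filter_upwards with p; rw [norm_norm]; exact hbd i p)
    exact (Real.le_norm_self _).trans h1)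
  simp_rw [tsum_mul_right] at this
  exact this

lemma mode_Yb (l : ℕ) (m : ℤ) (θ : ℝ) : mode (Yb l m) m θ = 2 * π * yr l m θ := by
  unfold mode
  have : ∀ φ : ℝ, Yb l m θ φ * Complex.exp (-(Complex.I * m * φ)) = (yr l m θ : ℂ) := by
    intro φ
    unfold Yb; rw [mul_assoc, ← Complex.exp_add]; simp
  simp_rw [this, intervalIntegral.integral_const, Complex.real_smul]; push_cast; ring

lemma mode_hasSum {g : ℝ → ℝ → ℂ} (hg : Continuous (fun q : ℝ × ℝ => g q.1 q.2)) (m : ℤ)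
    (hs : Summable fun l => ‖flCoeff g l m‖ * Real.sqrt (l+1)) (θ : ℝ)
    (hθ : θ ∈ Set.Icc (-(π/2)) (π/2)) :
    HasSum (fun l => flCoeff g l m * (yr l m θ : ℂ)) ((1 / (2 * π)) * mode g m θ) := by
  have hpi : (2 * π : ℂ) ≠ 0 := by have := pi_pos.ne'; exact_mod_cast (by positivity : (2 * π) ≠ 0)
  set S : ℝ → ℝ → ℂ := fun θ φ => ∑' l, flCoeff g l m * Yb l m θ φ with hS
  have hb : ∀ l θ φ, ‖flCoeff g l m * Yb l m θ φ‖ ≤ ‖flCoeff g l m‖ * Real.sqrt (l+1) := by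
    intro l θ φ
    rw [norm_mul]; exact mul_le_mul_of_nonneg_left (norm_Yb_le _ _ _ _) (norm_nonneg _)
  have hcont : ∀ l, Continuous (fun q : ℝ × ℝ => flCoeff g l m * Yb l m q.1 q.2) := by
    intro l; have := Yb_continuous l m; fun_prop
  have hSc : Continuous (fun q : ℝ × ℝ => S q.1 q.2) :=
    continuous_tsum hcont hs (fun l q => hb l q.1 q.2)
  have hmc := mode_continuous hg m
  set G : ℝ → ℝ → ℂ := fun θ φ => (1 / (2 * π)) * mode g m θ * Complex.exp (Complex.I * m * φ) with hG
  have hGc : Continuous (fun q : ℝ × ℝ => G q.1 q.2) := by fun_prop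
  have hmG : ∀ θ, mode G m θ = mode g m θ := by
    intro θ
    have : ∀ φ : ℝ, G θ φ * Complex.exp (-(Complex.I * m * φ)) = (1 / (2 * π)) * mode g m θ := by
      intro φ
      simp only [hG]
      rw [mul_assoc, ← Complex.exp_add]; simp
    rw [mode]; simp_rw [this]
    simp
    field_simp
    ring
  have hfG : ∀ l, flCoeff G l m = flCoeff g l m := by
    intro l
    rw [flCoeff_cont hGc, flCoeff_cont hg]
    congr 1; ext θ; congr 1
    exact hmG θ
  have hfS : ∀ l, flCoeff S l m = flCoeff g l m := by
    intro l
    by_cases hl : l < m.natAbs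
    · rw [flCoeff_of_lt _ hl, flCoeff_of_lt _ hl]
    have h1 := flCoeff_tsum hcont hb hs l m
    refine h1.unique ?_
    convert hasSum_ite_eq l (flCoeff g l m) using 2 with l'
    rw [flCoeff_const_mul]
    by_cases hl' : l' < m.natAbs
    · rw [flCoeff_of_lt _ hl', if_neg (by omega)]; simp
    · rw [Yb_orth _ _ _ _ (by omega)]
      by_cases e : l' = l
      · subst e; simp
      · simp [e]
  have hz := mode_zero (g := fun θ φ => G θ φ - S θ φ) (by fun_prop) m
    (fun l => by rw [flCoeff_sub hGc hSc, hfG, hfS, sub_self]) θ hθ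
  -- mode of S
  have hsum : ∀ φ, Summable fun l => flCoeff g l m * Yb l m θ φ :=
    fun φ => Summable.of_norm_bounded hs (fun l => hb l θ φ)
  have hs0 : Summable fun l => flCoeff g l m * (yr l m θ : ℂ) := by
    have := hsum 0
    simpa [Yb] using this
  have hSe : ∀ φ, S θ φ = (∑' l, flCoeff g l m * (yr l m θ : ℂ)) * Complex.exp (Complex.I * m * φ) := by
    intro φ
    simp only [hS]
    rw [← tsum_mul_right]
    congr 1; ext l; unfold Yb; ring
  have hfin : mode (fun θ φ => G θ φ - S θ φ) m θ = mode g m θ - 2 * π * (∑' l, flCoeff g l m * (yr l m θ : ℂ)) := by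
    have : ∀ φ : ℝ, (G θ φ - S θ φ) * Complex.exp (-(Complex.I * m * φ)) = (1 / (2 * π)) * mode g m θ - (∑' l, flCoeff g l m * (yr l m θ : ℂ)) := by
      intro φ
      rw [hSe]
      simp only [hG]
      rw [← sub_mul, mul_assoc, ← Complex.exp_add]; simp
    rw [mode]; simp_rw [this]
    simp
    field_simp
    ring
  rw [hfin, sub_eq_zero] at hz
  rw [hz]
  convert hs0.hasSum using 1
  field_simp

lemma equator_hasSum {g : ℝ → ℝ → ℂ} (hg : Continuous (fun q : ℝ × ℝ => g q.1 q.2)) (m : ℤ)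
    (hs : Summable fun l => ‖flCoeff g l m‖ * Real.sqrt (l+1)) :
    HasSum (fun l => flCoeff g l m * (yr l m 0 : ℂ)) (equatorCoeff (g 0) m) := by
  have := mode_hasSum hg m hs 0 ⟨by linarith [pi_pos], by linarith [pi_pos]⟩
  exact this

end Part5

section Part6

open MeasureTheory Real Filter
set_option linter.all false

abbrev E3 := EuclideanSpace ℝ (Fin 3)

def zet (x : E3) : ℂ := (x 0 : ℂ) + Complex.I * (x 1 : ℂ)

def UU (l M : ℕ) (x : E3) : ℂ :=
  ((‖x‖⁻¹ : ℝ) : ℂ) ^ (l + 1 + M) * zet x ^ M * (((DP M l).eval (x 2 * ‖x‖⁻¹) : ℝ) : ℂ)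

def gradL (A B C : ℂ) : E3 →L[ℝ] ℂ :=
  (EuclideanSpace.proj (0 : Fin 3) : E3 →L[ℝ] ℝ).smulRight ((A + B) / 2) +
  (EuclideanSpace.proj (1 : Fin 3) : E3 →L[ℝ] ℝ).smulRight ((B - A) * Complex.I / 2) +
  (EuclideanSpace.proj (2 : Fin 3) : E3 →L[ℝ] ℝ).smulRight C

lemma gradL_apply (A B C : ℂ) (e : E3) : gradL A B C e =
    (e 0 : ℂ) * ((A + B) / 2) + (e 1 : ℂ) * ((B - A) * Complex.I / 2) + (e 2 : ℂ) * C := by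
  simp [gradL]

lemma norm_sq_E3 (x : E3) : ‖x‖ ^ 2 = x 0 ^ 2 + x 1 ^ 2 + x 2 ^ 2 := by
  rw [EuclideanSpace.norm_sq_eq, Fin.sum_univ_three]; simp

lemma UU_differentiableAt (l M : ℕ) {x : E3} (hx : x ≠ 0) : DifferentiableAt ℝ (UU l M) x := by
  unfold UU zet
  have h1 : DifferentiableAt ℝ (fun x : E3 => ‖x‖⁻¹) x :=
    (differentiableAt_id.norm ℝ hx).inv (norm_ne_zero_iff.2 hx)
  have hc : ∀ f : E3 → ℝ, DifferentiableAt ℝ f x → DifferentiableAt ℝ (fun y => (f y : ℂ)) x := by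
    intro f hf
    exact Complex.ofRealCLM.differentiableAt.comp x hf
  have h2 : ∀ i : Fin 3, DifferentiableAt ℝ (fun y : E3 => y i) x := fun i =>
    (EuclideanSpace.proj i : E3 →L[ℝ] ℝ).differentiableAt
  refine ((hc _ h1).pow _ |>.mul (((hc _ (h2 0)).add ((hc _ (h2 1)).const_mul _)).pow _)).mul (hc _ ?_)
  exact (DP M l).differentiable.differentiableAt.comp x ((h2 2).mul h1)

lemma hd_congr {F : Type*} [NormedAddCommGroup F] [NormedSpace ℝ F] {f g : ℝ → F} {f' g' : F} {x : ℝ}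
    (h : HasDerivAt f f' x) (h1 : ∀ y, g y = f y) (h2 : g' = f') : HasDerivAt g g' x := by
  have : g = f := funext h1
  subst this; subst h2; exact h

lemma norm_line_deriv {x : E3} (hx : x ≠ 0) (e : E3) :
    HasDerivAt (fun τ : ℝ => ‖x + τ • e‖⁻¹) (-(‖x‖⁻¹)^3 * (x 0 * e 0 + x 1 * e 1 + x 2 * e 2)) 0 := by
  have h0 : ‖x‖ ≠ 0 := norm_ne_zero_iff.2 hx
  have h1 : ∀ τ : ℝ, ‖x + τ • e‖ = Real.sqrt ((x 0 + τ * e 0)^2 + (x 1 + τ * e 1)^2 + (x 2 + τ * e 2)^2) := by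
    intro τ
    rw [← Real.sqrt_sq (norm_nonneg (x + τ • e)), norm_sq_E3]; simp
  have hl : ∀ i : Fin 3, HasDerivAt (fun τ : ℝ => (x i + τ * e i)^2) (2 * x i * e i) 0 := by
    intro i
    have := (((hasDerivAt_id (0:ℝ)).mul_const (e i)).const_add (x i)).pow 2
    refine hd_congr this (fun y => rfl) ?_
    simp
  have h2 := ((hl 0).add (hl 1)).add (hl 2)
  have h4 : (x 0 + 0 * e 0)^2 + (x 1 + 0 * e 1)^2 + (x 2 + 0 * e 2)^2 = ‖x‖^2 := by rw [norm_sq_E3]; ring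
  have h3 := (h2.sqrt (by simp only [Pi.add_apply]; rw [h4]; positivity)).inv
    (by simp only [Pi.add_apply]; rw [h4, Real.sqrt_sq (norm_nonneg _)]; exact h0)
  have h5 : (fun τ : ℝ => ‖x + τ • e‖⁻¹) = fun τ : ℝ => (Real.sqrt ((x 0 + τ * e 0)^2 + (x 1 + τ * e 1)^2 + (x 2 + τ * e 2)^2))⁻¹ := by
    ext τ; rw [h1]
  rw [h5]
  refine hd_congr h3 (fun y => rfl) ?_
  simp only [Pi.add_apply]
  rw [h4, Real.sqrt_sq (norm_nonneg _)]
  field_simp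

lemma UU_line {l M : ℕ} {x : E3} (hx : x ≠ 0) (e : E3) :
    HasDerivAt (fun τ : ℝ => UU l M (x + τ • e))
      (((l + 1 + M : ℕ) : ℂ) * ((‖x‖⁻¹ : ℝ) : ℂ) ^ (l + M) *
          (-((‖x‖⁻¹ : ℝ) : ℂ)^3 * (x 0 * e 0 + x 1 * e 1 + x 2 * e 2)) * zet x ^ M *
            (((DP M l).eval (x 2 * ‖x‖⁻¹) : ℝ) : ℂ) +
        ((‖x‖⁻¹ : ℝ) : ℂ) ^ (l + 1 + M) * (M * zet x ^ (M - 1) * zet e) * (((DP M l).eval (x 2 * ‖x‖⁻¹) : ℝ) : ℂ) +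
        ((‖x‖⁻¹ : ℝ) : ℂ) ^ (l + 1 + M) * zet x ^ M * ((((DP (M+1) l).eval (x 2 * ‖x‖⁻¹) : ℝ) : ℂ) *
          (e 2 * ((‖x‖⁻¹ : ℝ) : ℂ) + x 2 * (-((‖x‖⁻¹ : ℝ) : ℂ)^3 * (x 0 * e 0 + x 1 * e 1 + x 2 * e 2))))) 0 := by
  have hq := norm_line_deriv hx e
  have hqc := hq.ofReal_comp
  have hz : HasDerivAt (fun τ : ℝ => zet (x + τ • e)) (zet e) 0 := by
    have : (fun τ : ℝ => zet (x + τ • e)) = fun τ : ℝ => zet x + (τ : ℂ) * zet e := by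
      ext τ; simp [zet]; ring
    rw [this]
    have := (((hasDerivAt_id (0:ℝ)).ofReal_comp).mul_const (zet e)).const_add (zet x)
    simpa using this
  have h2 : HasDerivAt (fun τ : ℝ => (x + τ • e) 2) (e 2) 0 := by
    have := (((hasDerivAt_id (0:ℝ)).mul_const (e 2)).const_add (x 2))
    simpa using this
  have hp := ((DP M l).hasDerivAt _).comp (0:ℝ) (h2.mul hq)
  have hpc := hp.ofReal_comp
  have := ((hqc.pow (l+1+M)).mul (hz.pow M)).mul hpc
  unfold UU
  refine hd_congr this (fun y => rfl) ?_
  simp only [zero_smul, add_zero, DP_succ, Function.comp, Pi.mul_apply, Pi.pow_apply]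
  rw [show l + 1 + M - 1 = l + M by omega]
  push_cast
  ring

end Part6

section Part7

open MeasureTheory Real Filter
set_option linter.all false

lemma UU_of_line {l M : ℕ} {x : E3} (hx : x ≠ 0) {L : E3 →L[ℝ] ℂ}
    (h : ∀ e, HasDerivAt (fun τ : ℝ => UU l M (x + τ • e)) (L e) 0) : HasFDerivAt (UU l M) L x := by
  have h1 := (UU_differentiableAt l M hx).hasFDerivAt
  have : fderiv ℝ (UU l M) x = L := by
    ext1 e
    have h2 := (h1.hasLineDerivAt e)
    exact HasDerivAt.unique h2 (h e)
  rwa [this] at h1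

lemma zet_rel (x : E3) (hx : x ≠ 0) : ((‖x‖⁻¹ : ℝ) : ℂ)^2 * (zet x * (starRingEnd ℂ) (zet x) + (x 2 : ℂ)^2) = 1 := by
  have h1 : zet x * (starRingEnd ℂ) (zet x) + (x 2 : ℂ)^2 = ((‖x‖^2 : ℝ) : ℂ) := by
    rw [norm_sq_E3]; simp [zet]
    linear_combination (-(x 1 : ℂ)^2) * Complex.I_sq
  rw [h1]
  have h0 : ‖x‖ ≠ 0 := norm_ne_zero_iff.2 hx
  rw [← Complex.ofReal_pow, ← Complex.ofReal_mul]
  rw [show (‖x‖⁻¹)^2 * ‖x‖^2 = 1 by field_simp]; simp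

lemma dot_rel (x e : E3) : (x 0 : ℂ) * e 0 + x 1 * e 1 = (zet x * (starRingEnd ℂ) (zet e) + (starRingEnd ℂ) (zet x) * zet e) / 2 := by
  simp [zet]
  linear_combination ((x 1 : ℂ) * e 1) * Complex.I_sq

lemma gradL_zet (A B C : ℂ) (e : E3) : gradL A B C e =
    A * (starRingEnd ℂ) (zet e) / 2 + B * zet e / 2 + C * e 2 := by
  rw [gradL_apply]; simp [zet]; ring

lemma J2c (m n : ℕ) (t : ℝ) : (((DP (m+1) (n+1)).eval t : ℝ) : ℂ) = (n+1+m) * (((DP m n).eval t : ℝ) : ℂ) +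
    t * (((DP (m+1) n).eval t : ℝ) : ℂ) := by
  have := congrArg (Polynomial.eval t) (leg_J2 m n)
  simp at this
  rw [this]; push_cast; ring

lemma J3c (m n : ℕ) (t : ℝ) : (1 - (t:ℂ)^2) * (((DP (m+1) n).eval t : ℝ) : ℂ) - (n+1+m) * t * (((DP m n).eval t : ℝ) : ℂ) +
    (n+1-m) * (((DP m (n+1)).eval t : ℝ) : ℂ) = 0 := by
  have := congrArg (Polynomial.eval t) (leg_J3 m n)
  simp at this
  exact_mod_cast this

lemma Dmc (m n : ℕ) (t : ℝ) : 2 * (m+1) * (((DP (m+1) n).eval t : ℝ) : ℂ) - (1 - (t:ℂ)^2) * (((DP (m+2) (n+1)).eval t : ℝ) : ℂ) =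
    (n - m) * (n - m + 1) * (((DP m (n+1)).eval t : ℝ) : ℂ) := by
  have := congrArg (Polynomial.eval t) (leg_Dminus m n)
  simp at this
  exact_mod_cast this

lemma UU_fderiv_succ (l M : ℕ) {x : E3} (hx : x ≠ 0) : HasFDerivAt (UU l (M+1))
    (gradL (-UU (l+1) (M+2) x) ((l - M) * (l - M + 1) * UU (l+1) M x) (-((l - M) * UU (l+1) (M+1) x))) x := by
  apply UU_of_line hx
  intro e
  refine hd_congr (UU_line hx e) (fun y => rfl) ?_
  rw [gradL_zet]
  have hd := dot_rel x e
  have hr := zet_rel x hx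
  have j2 := J2c (M+1) l (x 2 * ‖x‖⁻¹)
  have j3 := J3c (M+1) l (x 2 * ‖x‖⁻¹)
  have dm := Dmc M l (x 2 * ‖x‖⁻¹)
  unfold UU
  push_cast at j2 j3 dm hd hr ⊢
  rw [show M + 1 + 1 = M + 2 from rfl] at *
  try simp only [Nat.add_sub_cancel]
  generalize (((DP (M+2) (l+1)).eval (x 2 * ‖x‖⁻¹) : ℝ) : ℂ) = p22 at *
  generalize (((DP (M+1) (l+1)).eval (x 2 * ‖x‖⁻¹) : ℝ) : ℂ) = p12 at *
  generalize (((DP M (l+1)).eval (x 2 * ‖x‖⁻¹) : ℝ) : ℂ) = p02 at *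
  generalize (((DP (M+1) l).eval (x 2 * ‖x‖⁻¹) : ℝ) : ℂ) = p11 at *
  generalize (((DP (M+2) l).eval (x 2 * ‖x‖⁻¹) : ℝ) : ℂ) = p21 at *
  rw [hd]
  generalize (starRingEnd ℂ) (zet x) = w' at *
  generalize (starRingEnd ℂ) (zet e) = E' at *
  generalize zet x = w at *
  generalize zet e = E at *
  generalize (x 2 : ℂ) = z at *
  generalize ((‖x‖ : ℂ))⁻¹ = q at *
  generalize (e 2 : ℂ) = e2 at *
  rw [show l + 1 + 1 + M = l + M + 2 by ring, show l + (M + 1) = l + M + 1 by ring,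
    show l + 1 + (M + 1) = l + M + 2 by ring, show l + 1 + 1 + (M + 2) = l + M + 4 by ring,
    show l + 1 + 1 + (M + 1) = l + M + 3 by ring]
  simp only [pow_succ] at *
  generalize q ^ (l + M) = Q
  generalize w ^ M = W
  linear_combination (-Q*q*q*q*q*W*w*w*E'/2 - Q*q*q*q*q*W*w*w'*E/2) * j2 - (Q*q*q*q*W*w*e2) * j3 - (Q*q*q*W*E/2) * dm +
    (Q*q*q*W*E/2 * p22 ) * hr

lemma UU_fderiv_zero (l : ℕ) {x : E3} (hx : x ≠ 0) : HasFDerivAt (UU l 0)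
    (gradL (-UU (l+1) 1 x) (-(starRingEnd ℂ) (UU (l+1) 1 x)) (-((l + 1) * UU (l+1) 0 x))) x := by
  apply UU_of_line hx
  intro e
  refine hd_congr (UU_line hx e) (fun y => rfl) ?_
  rw [gradL_zet]
  have hd := dot_rel x e
  have hr := zet_rel x hx
  have j2 := J2c 0 l (x 2 * ‖x‖⁻¹)
  have j3 := J3c 0 l (x 2 * ‖x‖⁻¹)
  unfold UU
  simp only [map_mul, map_pow, Complex.conj_ofReal]
  push_cast at j2 j3 hd hr ⊢
  try simp only [zero_add] at *
  generalize (((DP 1 (l+1)).eval (x 2 * ‖x‖⁻¹) : ℝ) : ℂ) = p12 at *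
  generalize (((DP 0 (l+1)).eval (x 2 * ‖x‖⁻¹) : ℝ) : ℂ) = p02 at *
  generalize (((DP 0 l).eval (x 2 * ‖x‖⁻¹) : ℝ) : ℂ) = p01 at *
  generalize (((DP 1 l).eval (x 2 * ‖x‖⁻¹) : ℝ) : ℂ) = p11 at *
  rw [hd]
  generalize (starRingEnd ℂ) (zet x) = w' at *
  generalize (starRingEnd ℂ) (zet e) = E' at *
  generalize zet x = w at *
  generalize zet e = E at *
  generalize (x 2 : ℂ) = z at *
  generalize ((‖x‖ : ℂ))⁻¹ = q at *
  generalize (e 2 : ℂ) = e2 at *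
  simp only [pow_succ, pow_zero, add_zero] at *
  generalize q ^ l = Q
  linear_combination (-Q*q*q*q*w*E'/2 - Q*q*q*q*w'*E/2) * j2 - (Q*q*q*e2) * j3

end Part7

section Part8

open MeasureTheory Real Filter
set_option linter.all false

def VV (l : ℕ) (m : ℤ) (x : E3) : ℂ :=
  ((sg m * NN l m.natAbs : ℝ) : ℂ) * (if 0 ≤ m then UU l m.natAbs x else (starRingEnd ℂ) (UU l m.natAbs x))

def cp (l : ℕ) (m : ℤ) : ℝ := Real.sqrt ((2*l+1)/(2*l+3) * ((l+m+1)*(l+m+2)))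
def cz (l : ℕ) (m : ℤ) : ℝ := Real.sqrt ((2*l+1)/(2*l+3) * ((l+1)^2-m^2))

lemma UU_zero_real (l : ℕ) (x : E3) : (starRingEnd ℂ) (UU l 0 x) = UU l 0 x := by
  unfold UU; simp only [map_mul, map_pow, Complex.conj_ofReal]; simp

lemma NN_sq' (l m : ℕ) : NN l m ^ 2 =
    (2 * l + 1) * (l - m).factorial / (4 * Real.pi * (l + m).factorial) := by
  rw [sq, NN_sq]

lemma NN_cp (l M : ℕ) (h : M ≤ l) : NN l M = cp l M * NN (l+1) (M+1) := by
  have h1 := NN_pos l M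
  have h2 := NN_pos (l+1) (M+1)
  have h3 : 0 ≤ cp l M := Real.sqrt_nonneg _
  rw [← sq_eq_sq₀ h1.le (by positivity), mul_pow, NN_sq', NN_sq', cp, Real.sq_sqrt (by push_cast; positivity)]
  rw [show l + 1 - (M+1) = l - M by omega, show l + 1 + (M+1) = (l + M + 1) + 1 by ring,
    Nat.factorial_succ, Nat.factorial_succ]
  have : ((l+M).factorial : ℝ) ≠ 0 := by positivity
  have := pi_pos.ne'
  push_cast
  field_simp
  ring

lemma NN_cz (l M : ℕ) (h : M ≤ l) : (l + 1 - M) * NN l M = cz l M * NN (l+1) M := by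
  have h1 := NN_pos l M
  have h2 := NN_pos (l+1) M
  have h3 : 0 ≤ cz l M := Real.sqrt_nonneg _
  obtain ⟨k, rfl⟩ := Nat.exists_eq_add_of_le h
  have hk : ((M + k : ℕ) : ℝ) + 1 - M = k + 1 := by push_cast; ring
  rw [hk]
  rw [← sq_eq_sq₀ (by positivity) (by positivity), mul_pow, mul_pow, NN_sq', NN_sq', cz,
    Real.sq_sqrt (by apply mul_nonneg (by positivity); push_cast; nlinarith [(Nat.cast_nonneg k : (0:ℝ) ≤ k), (Nat.cast_nonneg M : (0:ℝ) ≤ M)])]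
  rw [show M + k - M = k by omega, show M + k + 1 - M = k + 1 by omega, show M + k + 1 + M = (M + k + M) + 1 by ring,
    Nat.factorial_succ, Nat.factorial_succ]
  have : ((M+k+M).factorial : ℝ) ≠ 0 := by positivity
  have := pi_pos.ne'
  push_cast
  field_simp
  ring

lemma NN_cm (l M : ℕ) (h : M + 1 ≤ l) : ((l - M) * (l - M + 1)) * NN l (M+1) = cp l (-((M:ℤ)+1)) * NN (l+1) M := by
  have h1 := NN_pos l (M+1)
  have h2 := NN_pos (l+1) M
  have h3 : 0 ≤ cp l (-((M:ℤ)+1)) := Real.sqrt_nonneg _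
  obtain ⟨k, rfl⟩ := Nat.exists_eq_add_of_le h
  have hk : ((M + 1 + k : ℕ) : ℝ) - M = k + 1 := by push_cast; ring
  rw [hk]
  rw [← sq_eq_sq₀ (by positivity) (by positivity), mul_pow, mul_pow, mul_pow, NN_sq', NN_sq', cp,
    Real.sq_sqrt (by
      apply mul_nonneg (by positivity); push_cast; ring_nf; positivity)]
  rw [show M + 1 + k - (M + 1) = k by omega, show M + 1 + k + 1 - M = k + 1 + 1 by omega, show M + 1 + k + 1 + M = M + 1 + k + (M + 1) by ring,
    Nat.factorial_succ, Nat.factorial_succ]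
  have : ((M+1+k+(M+1)).factorial : ℝ) ≠ 0 := by positivity
  have := pi_pos.ne'
  push_cast
  field_simp
  ring

lemma VV_nat (l M : ℕ) (x : E3) : VV l (M:ℤ) x = ((NN l M : ℝ) : ℂ) * UU l M x := by
  simp [VV, sg]

lemma VV_neg (l M : ℕ) (x : E3) : VV l (-(M:ℤ)) x = (((-1)^M * NN l M : ℝ) : ℂ) * (starRingEnd ℂ) (UU l M x) := by
  rcases Nat.eq_zero_or_pos M with rfl | hM
  · simp [VV, sg, UU_zero_real]
  · have : ¬ (0 ≤ -(M:ℤ)) := by omega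
    have h2 : M ≠ 0 := by omega
    simp [VV, sg, h2]

lemma fd_congr {f g : E3 → ℂ} {L L' : E3 →L[ℝ] ℂ} {x : E3}
    (h : HasFDerivAt f L x) (h1 : ∀ y, g y = f y) (h2 : L' = L) : HasFDerivAt g L' x := by
  have : g = f := funext h1
  subst this; subst h2; exact h

lemma gradL_smul (c A B C : ℂ) : c • gradL A B C = gradL (c * A) (c * B) (c * C) := by
  ext1 e
  simp only [ContinuousLinearMap.smul_apply, smul_eq_mul, gradL_apply]; ring

lemma gradL_conj (A B C : ℂ) : (Complex.conjCLE : ℂ →L[ℝ] ℂ).comp (gradL A B C) =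
    gradL ((starRingEnd ℂ) B) ((starRingEnd ℂ) A) ((starRingEnd ℂ) C) := by
  ext1 e
  simp only [ContinuousLinearMap.comp_apply, gradL_apply]
  simp [map_ofNat]
  ring

lemma VV_fderiv (l : ℕ) (m : ℤ) (hm : m.natAbs ≤ l) {x : E3} (hx : x ≠ 0) : HasFDerivAt (VV l m)
    (gradL (-(cp l m * VV (l+1) (m+1) x)) (cp l (-m) * VV (l+1) (m-1) x) (-(cz l m * VV (l+1) m x))) x := by
  -- reduction to UU
  have hU : ∀ M : ℕ, M ≤ l → HasFDerivAt (VV l (M:ℤ))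
    (gradL (-(cp l M * VV (l+1) (M+1) x)) (cp l (-M) * VV (l+1) (M-1) x) (-(cz l M * VV (l+1) M x))) x := by
    intro M hM
    have e : VV l (M:ℤ) = fun x => ((NN l M : ℝ) : ℂ) • UU l M x := by
      ext x; rw [VV_nat, smul_eq_mul]
    rw [e]
    rcases M with _ | M
    · have h1 := (UU_fderiv_zero l hx).const_smul ((NN l 0 : ℝ) : ℂ)
      rw [gradL_smul] at h1
      refine fd_congr h1 (fun y => rfl) ?_
      have a1 : ((NN l 0 : ℝ) : ℂ) = cp l 0 * NN (l+1) 1 := by exact_mod_cast NN_cp l 0 (by omega)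
      have a2 : ((l:ℂ) + 1) * ((NN l 0 : ℝ) : ℂ) = cz l 0 * NN (l+1) 0 := by
        have := NN_cz l 0 (by omega)
        simp at this
        exact_mod_cast this
      have b1 := VV_nat (l+1) 1 x
      have b2 := VV_neg (l+1) 1 x
      have b3 := VV_nat (l+1) 0 x
      simp only [Nat.cast_zero, Nat.cast_one, zero_add, zero_sub, neg_zero] at *
      congr 1
      · rw [b1, a1]; ring
      · rw [b2, a1]; push_cast; ring
      · rw [b3]; linear_combination (UU (l+1) 0 x) * a2
    · have h1 := (UU_fderiv_succ l M hx).const_smul ((NN l (M+1) : ℝ) : ℂ)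
      rw [gradL_smul] at h1
      refine fd_congr h1 (fun y => rfl) ?_
      have a1 : ((NN l (M+1) : ℝ) : ℂ) = cp l ((M:ℤ)+1) * NN (l+1) (M+2) := by exact_mod_cast NN_cp l (M+1) (by omega)
      have a2 : ((l:ℂ) - M) * ((NN l (M+1) : ℝ) : ℂ) = cz l ((M:ℤ)+1) * NN (l+1) (M+1) := by
        have := NN_cz l (M+1) (by omega)
        push_cast at this
        rw [show (l:ℝ) + 1 - (M+1) = l - M by ring] at this
        exact_mod_cast this
      have a3 : (((l:ℂ) - M) * (l - M + 1)) * ((NN l (M+1) : ℝ) : ℂ) = cp l (-((M:ℤ)+1)) * NN (l+1) M := by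
        exact_mod_cast NN_cm l M (by omega)
      have b1 := VV_nat (l+1) (M+2) x
      have b2 := VV_nat (l+1) M x
      have b3 := VV_nat (l+1) (M+1) x
      push_cast at *
      rw [show (M:ℤ) + 1 + 1 = M + 2 by ring, show (M:ℤ) + 1 - 1 = M by ring]
      congr 1
      · rw [b1, a1]; ring
      · rw [b2]; linear_combination (-UU (l+1) M x) * a3
      · rw [b3]; linear_combination (UU (l+1) (M+1) x) * a2
  have hcj : ∀ (l' : ℕ) (M : ℤ) (x : E3), VV l' (-M) x = ((-1)^M.natAbs : ℂ) * (starRingEnd ℂ) (VV l' M x) := by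
    intro l' M x
    obtain ⟨n, rfl | rfl⟩ := M.eq_nat_or_neg
    · rw [VV_neg, VV_nat]; simp; ring
    · rw [neg_neg, VV_neg, VV_nat]; simp
      have : ((-1:ℂ)^n) * (-1)^n = 1 := by rw [← mul_pow]; simp
      linear_combination (-(NN l' n : ℂ) * UU l' n x) * this
  obtain ⟨M, rfl | rfl⟩ := m.eq_nat_or_neg
  · exact_mod_cast hU M (by simpa using hm)
  · have h1 := hU M (by simpa using hm)
    have h2 := ((Complex.conjCLE : ℂ →L[ℝ] ℂ).hasFDerivAt.comp x h1).const_smul ((-1)^M : ℂ)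
    have e : VV l (-(M:ℤ)) = ((-1)^M : ℂ) • (⇑(Complex.conjCLE : ℂ →L[ℝ] ℂ) ∘ VV l (M:ℤ)) := by
      ext x; rw [hcj]; simp
    rw [e]
    refine fd_congr h2 (fun y => rfl) ?_
    rw [gradL_conj, gradL_smul]
    have c1 := hcj (l+1) (M-1) x
    have c2 := hcj (l+1) (M+1) x
    have c3 := hcj (l+1) M x
    rw [show -(M:ℤ) + 1 = -((M:ℤ)-1) by ring, show -(M:ℤ) - 1 = -((M:ℤ)+1) by ring, neg_neg, c1, c2, c3]
    have s1 : ((-1:ℂ))^((M:ℤ)+1).natAbs = -(-1)^M := by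
      rw [show ((M:ℤ)+1).natAbs = M + 1 by omega, pow_succ]; ring
    have s2 : ((-1:ℂ))^((M:ℤ)-1).natAbs = -(-1)^M := by
      rcases M with _ | M
      · simp
      · rw [show (((M+1:ℕ):ℤ)-1).natAbs = M by omega, pow_succ]; ring
    have s3 : cz l (-(M:ℤ)) = cz l M := by unfold cz; push_cast; ring_nf
    rw [s1, s2, s3]
    simp
    congr 1 <;> ring

lemma sph0 (θ φ : ℝ) : sphCoord θ φ 0 = Real.cos θ * Real.cos φ := rfl
lemma sph1 (θ φ : ℝ) : sphCoord θ φ 1 = Real.cos θ * Real.sin φ := rfl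
lemma sph2 (θ φ : ℝ) : sphCoord θ φ 2 = Real.sin θ := rfl

lemma norm_sph (θ φ : ℝ) : ‖sphCoord θ φ‖ = 1 := by
  have h := norm_sq_E3 (sphCoord θ φ)
  rw [sph0, sph1, sph2] at h
  have h2 : ‖sphCoord θ φ‖^2 = 1 := by
    rw [h]; nlinarith [Real.sin_sq_add_cos_sq θ, Real.sin_sq_add_cos_sq φ]
  nlinarith [norm_nonneg (sphCoord θ φ)]

lemma VV_sph (l : ℕ) (m : ℤ) (r : ℝ) (hr : 0 < r) (θ φ : ℝ) :
    VV l m (r • sphCoord θ φ) = ((r⁻¹ : ℝ) : ℂ)^(l+1) * Yb l m θ φ := by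
  have hn : ‖r • sphCoord θ φ‖ = r := by rw [norm_smul, norm_sph]; simp [abs_of_pos hr]
  have hz : zet (r • sphCoord θ φ) = (r : ℂ) * (Real.cos θ : ℂ) * Complex.exp (Complex.I * φ) := by
    simp only [zet, PiLp.smul_apply, sph0, sph1, smul_eq_mul]
    rw [mul_comm Complex.I (φ:ℂ), Complex.exp_mul_I]
    push_cast; ring
  have h2 : (r • sphCoord θ φ) 2 * ‖r • sphCoord θ φ‖⁻¹ = Real.sin θ := by
    rw [hn]; simp only [PiLp.smul_apply, sph2, smul_eq_mul]; field_simp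
  have hU : ∀ M : ℕ, UU l M (r • sphCoord θ φ) = ((r⁻¹ : ℝ) : ℂ)^(l+1) * (((Real.cos θ)^M * (DP M l).eval (Real.sin θ) : ℝ) : ℂ) * Complex.exp (Complex.I * M * φ) := by
    intro M
    unfold UU
    rw [h2, hn, hz, mul_pow, mul_pow, pow_add _ (l+1) M, ← Complex.exp_nat_mul,
      show (M:ℂ) * (Complex.I * φ) = Complex.I * M * φ by ring]
    have : ((r⁻¹ : ℝ) : ℂ)^M * (r:ℂ)^M = 1 := by
      rw [← mul_pow, ← Complex.ofReal_mul, inv_mul_cancel₀ hr.ne']; simp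
    push_cast at *
    linear_combination ((r:ℂ)⁻¹^(l+1) * Complex.cos θ^M * Complex.exp (Complex.I * M * φ) * (((DP M l).eval (Real.sin θ) : ℝ) : ℂ)) * this
  unfold VV Yb yr
  by_cases h : 0 ≤ m
  · obtain ⟨M, rfl⟩ := Int.eq_ofNat_of_zero_le h
    rw [if_pos h, hU]
    push_cast; simp; ring
  · obtain ⟨M, hM⟩ := Int.eq_ofNat_of_zero_le (by omega : 0 ≤ -m)
    obtain rfl : m = -(M:ℤ) := by omega
    rw [if_neg h, hU, map_mul, map_mul, map_pow, Complex.conj_ofReal, Complex.conj_ofReal, ← Complex.exp_conj]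
    simp; ring

end Part8

section Part9

open MeasureTheory Real Filter
set_option linter.all false

lemma exists_sph (x : E3) (hx : x ≠ 0) : ∃ θ ∈ Set.Icc (-(π/2)) (π/2), ∃ φ : ℝ, x = ‖x‖ • sphCoord θ φ := by
  have h0 : 0 < ‖x‖ := norm_pos_iff.2 hx
  have hn := norm_sq_E3 x
  have habs : (x 2 / ‖x‖)^2 ≤ 1 := by
    rw [div_pow, div_le_one (by positivity)]; nlinarith [sq_nonneg (x 0), sq_nonneg (x 1)]
  have h1 : -1 ≤ x 2 / ‖x‖ := by nlinarith
  have h2 : x 2 / ‖x‖ ≤ 1 := by nlinarith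
  set w : ℂ := ⟨x 0, x 1⟩ with hw
  refine ⟨Real.arcsin (x 2 / ‖x‖), ⟨Real.neg_pi_div_two_le_arcsin _, Real.arcsin_le_pi_div_two _⟩, w.arg, ?_⟩
  have hc : ‖x‖ * Real.cos (Real.arcsin (x 2 / ‖x‖)) = ‖w‖ := by
    rw [Real.cos_arcsin]
    have : 0 ≤ 1 - (x 2 / ‖x‖)^2 := by linarith
    rw [← sq_eq_sq₀ (by positivity) (norm_nonneg _), mul_pow, Real.sq_sqrt this, ← Complex.normSq_eq_norm_sq, Complex.normSq_apply]
    field_simp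
    simp only [hw]
    rw [hn]; ring
  ext i
  fin_cases i
  · show x 0 = ‖x‖ * (Real.cos _ * Real.cos _)
    rw [← mul_assoc, hc, Complex.norm_mul_cos_arg]
  · show x 1 = ‖x‖ * (Real.cos _ * Real.sin _)
    rw [← mul_assoc, hc, Complex.norm_mul_sin_arg]
  · show x 2 = ‖x‖ * Real.sin _
    rw [Real.sin_arcsin h1 h2]; field_simp

abbrev Arr := ℕ → ℤ → ℂ

def nrm (a : Arr) (l : ℕ) : ℝ := Real.sqrt (∑ m ∈ Finset.Icc (-(l:ℤ)) l, ‖a l m‖^2)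

def lev (a : Arr) (l : ℕ) (x : E3) : ℂ := ∑ m ∈ Finset.Icc (-(l:ℤ)) l, a l m * VV l m x

def opP (a : Arr) : Arr
  | 0, _ => 0
  | l+1, m => -(cp l (m-1) * a l (m-1))

def opM (a : Arr) : Arr
  | 0, _ => 0
  | l+1, m => cp l (-(m+1)) * a l (m+1)

def opZ (a : Arr) : Arr
  | 0, _ => 0
  | l+1, m => -(cz l m * a l m)

lemma nrm_nonneg (a : Arr) (l : ℕ) : 0 ≤ nrm a l := Real.sqrt_nonneg _

lemma nrm_sq (a : Arr) (l : ℕ) : nrm a l ^ 2 = ∑ m ∈ Finset.Icc (-(l:ℤ)) l, ‖a l m‖^2 := by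
  unfold nrm; rw [Real.sq_sqrt (Finset.sum_nonneg (fun _ _ => sq_nonneg _))]

lemma sum_shift {R : Type*} [AddCommMonoid R] (F : ℤ → R) (l : ℕ) (c : ℤ) (hc : c = 0 ∨ c = 1 ∨ c = -1)
    (hF : ∀ k : ℤ, l < k.natAbs → k.natAbs ≤ l + 2 → k ≤ l + 1 - c → -((l:ℤ)+1) - c ≤ k → F k = 0) :
    ∑ m ∈ Finset.Icc (-(l:ℤ)) l, F m = ∑ m ∈ Finset.Icc (-((l+1:ℕ):ℤ)) ((l+1:ℕ):ℤ), F (m - c) := by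
  have h1 : ∑ m ∈ Finset.Icc (-(l:ℤ)) l, F m = ∑ m ∈ Finset.Icc (-(l:ℤ) + c) (l + c), F (m - c) := by
    rw [← Finset.map_add_right_Icc, Finset.sum_map]
    simp
  rw [h1]
  apply Finset.sum_subset
  · intro k; simp; omega
  · intro k h2 h3
    simp at h2 h3
    apply hF <;> omega

lemma cp_zero1 (l : ℕ) (k : ℤ) (h : k = -((l:ℤ)+1) ∨ k = -((l:ℤ)+2)) : cp l k = 0 := by
  unfold cp
  rcases h with rfl | rfl
  · push_cast; simp
  · push_cast; simp

lemma cz_zero1 (l : ℕ) (k : ℤ) (h : k = ((l:ℤ)+1) ∨ k = -((l:ℤ)+1)) : cz l k = 0 := by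
  unfold cz
  rcases h with rfl | rfl
  · push_cast; simp
  · push_cast
    rw [show ((l:ℝ)+1)^2 - (-((l:ℝ)+1))^2 = 0 by ring]; simp

lemma sumP {R : Type*} [AddCommMonoid R] (F : ℤ → R) (l : ℕ) (hF : ∀ k, cp l k = 0 → F k = 0) :
    ∑ m ∈ Finset.Icc (-(l:ℤ)) l, F m = ∑ m ∈ Finset.Icc (-((l+1:ℕ):ℤ)) ((l+1:ℕ):ℤ), F (m - 1) := by
  apply sum_shift _ _ _ (by simp)
  intro k h1 h2 h3 h4
  apply hF; apply cp_zero1; omega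

lemma sumM {R : Type*} [AddCommMonoid R] (F : ℤ → R) (l : ℕ) (hF : ∀ k, cp l (-k) = 0 → F k = 0) :
    ∑ m ∈ Finset.Icc (-(l:ℤ)) l, F m = ∑ m ∈ Finset.Icc (-((l+1:ℕ):ℤ)) ((l+1:ℕ):ℤ), F (m + 1) := by
  rw [sum_shift F l (-1) (by simp)]
  · simp
  intro k h1 h2 h3 h4
  apply hF; apply cp_zero1; omega

lemma sumZ {R : Type*} [AddCommMonoid R] (F : ℤ → R) (l : ℕ) (hF : ∀ k, cz l k = 0 → F k = 0) :
    ∑ m ∈ Finset.Icc (-(l:ℤ)) l, F m = ∑ m ∈ Finset.Icc (-((l+1:ℕ):ℤ)) ((l+1:ℕ):ℤ), F m := by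
  rw [sum_shift F l 0 (by simp)]
  · simp
  intro k h1 h2 h3 h4
  apply hF; apply cz_zero1; omega

lemma kap_le (l : ℕ) : ((2*l+1)/(2*l+3) : ℝ) ≤ 1 := by
  rw [div_le_one (by positivity)]; linarith

lemma cp_sq_le (l : ℕ) (m : ℤ) (h : m.natAbs ≤ l) : cp l m ^ 2 ≤ (2*(l+1))^2 := by
  unfold cp
  have h1 : -(l:ℝ) ≤ m := by exact_mod_cast (by omega : -(l:ℤ) ≤ m)
  have h2 : (m:ℝ) ≤ l := by exact_mod_cast (by omega : m ≤ (l:ℤ))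
  have h3 : (0:ℝ) ≤ (l+m+1)*(l+m+2) := by apply mul_nonneg <;> linarith
  rw [Real.sq_sqrt (by positivity)]
  calc _ ≤ 1 * ((l+m+1)*(l+m+2) : ℝ) := mul_le_mul_of_nonneg_right (kap_le l) h3
    _ ≤ _ := by nlinarith

lemma cz_sq_le (l : ℕ) (m : ℤ) (h : m.natAbs ≤ l) : cz l m ^ 2 ≤ (2*(l+1))^2 := by
  unfold cz
  have h1 : -(l:ℝ) ≤ m := by exact_mod_cast (by omega : -(l:ℤ) ≤ m)
  have h2 : (m:ℝ) ≤ l := by exact_mod_cast (by omega : m ≤ (l:ℤ))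
  have h3 : (0:ℝ) ≤ (l+1)^2-m^2 := by nlinarith
  rw [Real.sq_sqrt (by positivity)]
  calc _ ≤ 1 * ((l+1)^2-m^2 : ℝ) := mul_le_mul_of_nonneg_right (kap_le l) h3
    _ ≤ _ := by nlinarith

lemma nrm_op_aux (a : Arr) (l : ℕ) (c : ℤ → ℝ) (hc : ∀ m : ℤ, m.natAbs ≤ l → c m ^ 2 ≤ (2*(l+1))^2) :
    Real.sqrt (∑ m ∈ Finset.Icc (-(l:ℤ)) l, ‖(c m : ℂ) * a l m‖^2) ≤ 2 * (l+1) * nrm a l := by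
  apply Real.sqrt_le_iff.2
  refine ⟨by have := nrm_nonneg a l; positivity, ?_⟩
  rw [mul_pow, nrm_sq, Finset.mul_sum]
  apply Finset.sum_le_sum
  intro m hm
  rw [norm_mul, mul_pow]
  apply mul_le_mul_of_nonneg_right _ (sq_nonneg _)
  rw [Complex.norm_real, Real.norm_eq_abs, sq_abs]
  apply hc
  simp at hm; omega

lemma nrm_opP (a : Arr) (l : ℕ) : nrm (opP a) (l+1) ≤ 2 * (l+1) * nrm a l := by
  refine le_trans (le_of_eq ?_) (nrm_op_aux a l (cp l) (cp_sq_le l))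
  rw [sumP _ l (fun k hk => by rw [hk]; simp)]
  simp [nrm, opP]

lemma nrm_opM (a : Arr) (l : ℕ) : nrm (opM a) (l+1) ≤ 2 * (l+1) * nrm a l := by
  refine le_trans (le_of_eq ?_) (nrm_op_aux a l (fun m => cp l (-m)) (fun m hm => cp_sq_le l _ (by simpa using hm)))
  rw [sumM _ l (fun k hk => by rw [hk]; simp)]
  simp [nrm, opM]

lemma nrm_opZ (a : Arr) (l : ℕ) : nrm (opZ a) (l+1) ≤ 2 * (l+1) * nrm a l := by
  refine le_trans (le_of_eq ?_) (nrm_op_aux a l (cz l) (cz_sq_le l))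
  rw [sumZ _ l (fun k hk => by rw [hk]; simp)]
  simp [nrm, opZ]

lemma gradL_sum (s : Finset ℤ) (A B C : ℤ → ℂ) : ∑ m ∈ s, gradL (A m) (B m) (C m) =
    gradL (∑ m ∈ s, A m) (∑ m ∈ s, B m) (∑ m ∈ s, C m) := by
  ext1 e
  simp only [ContinuousLinearMap.sum_apply, gradL_zet]
  simp only [Finset.sum_add_distrib, Finset.sum_div, Finset.sum_mul]

lemma lev_fderiv (a : Arr) (l : ℕ) {x : E3} (hx : x ≠ 0) : HasFDerivAt (lev a l)
    (gradL (lev (opP a) (l+1) x) (lev (opM a) (l+1) x) (lev (opZ a) (l+1) x)) x := by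
  have h1 : ∀ m ∈ Finset.Icc (-(l:ℤ)) l, HasFDerivAt (fun x => a l m * VV l m x)
      (gradL (a l m * -(cp l m * VV (l+1) (m+1) x)) (a l m * (cp l (-m) * VV (l+1) (m-1) x))
        (a l m * -(cz l m * VV (l+1) m x))) x := by
    intro m hm
    have := (VV_fderiv l m (by simp at hm; omega) hx).const_smul (a l m)
    rw [gradL_smul] at this
    exact this
  have h2 := HasFDerivAt.fun_sum h1
  refine fd_congr h2 (fun y => rfl) ?_
  rw [gradL_sum]
  unfold lev
  rw [sumP (fun m => a l m * -(cp l m * VV (l+1) (m+1) x)) l (fun k hk => by rw [hk]; simp),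
    sumM (fun m => a l m * (cp l (-m) * VV (l+1) (m-1) x)) l (fun k hk => by rw [hk]; simp),
    sumZ (fun m => a l m * -(cz l m * VV (l+1) m x)) l (fun k hk => by rw [hk]; simp)]
  congr 1
  · apply Finset.sum_congr rfl; intro m _; simp [opP]; ring
  · apply Finset.sum_congr rfl; intro m _; simp [opM]; ring
  · apply Finset.sum_congr rfl; intro m _; simp [opZ]; ring

lemma sum_VV_sq (l : ℕ) {x : E3} (hx : x ≠ 0) :
    ∑ m ∈ Finset.Icc (-(l:ℤ)) l, ‖VV l m x‖^2 ≤ ((‖x‖⁻¹)^(l+1) * Real.sqrt (l+1))^2 := by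
  obtain ⟨θ, _, φ, h⟩ := exists_sph x hx
  have h0 : 0 < ‖x‖ := norm_pos_iff.2 hx
  have : ∀ m, ‖VV l m x‖^2 = ((‖x‖⁻¹)^(l+1))^2 * yr l m θ ^2 := by
    intro m
    rw [h, VV_sph l m ‖x‖ h0, norm_mul, norm_Yb, norm_smul, norm_sph, mul_pow, sq_abs]
    simp
  simp_rw [this]
  rw [← Finset.mul_sum, sum_yr_sq, mul_pow, Real.sq_sqrt (by positivity)]
  apply mul_le_mul_of_nonneg_left _ (by positivity)
  rw [div_le_iff₀ (by positivity)]
  nlinarith [pi_gt_three, (Nat.cast_nonneg l : (0:ℝ) ≤ l)]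

lemma norm_lev_le (a : Arr) (l : ℕ) {x : E3} (hx : x ≠ 0) :
    ‖lev a l x‖ ≤ nrm a l * Real.sqrt (l+1) * (‖x‖⁻¹)^(l+1) := by
  have h1 : ‖lev a l x‖ ≤ ∑ m ∈ Finset.Icc (-(l:ℤ)) l, ‖a l m‖ * ‖VV l m x‖ := by
    refine (norm_sum_le _ _).trans (le_of_eq ?_)
    simp
  refine h1.trans ?_
  have h3 := nrm_nonneg a l
  refine (pow_le_pow_iff_left₀ (Finset.sum_nonneg (fun _ _ => by positivity)) (by positivity) two_ne_zero).1 ?_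
  refine (Finset.sum_mul_sq_le_sq_mul_sq _ _ _).trans ?_
  rw [← nrm_sq, mul_assoc, mul_pow]
  apply mul_le_mul_of_nonneg_left _ (sq_nonneg _)
  rw [mul_comm (Real.sqrt _)]
  exact sum_VV_sq l hx

end Part9

section Part10

open MeasureTheory Real Filter
set_option linter.all false

lemma seg_bound {u : E3 → ℂ} {L : E3 → (E3 →L[ℝ] ℂ)} {ρ B : ℝ}
    (h : ∀ x, ρ ≤ ‖x‖ → HasFDerivAt u (L x) x) (hB : ∀ x, ρ ≤ ‖x‖ → ‖L x‖ ≤ B)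
    (p q : E3) (hs : ∀ t ∈ Set.Icc (0:ℝ) 1, ρ ≤ ‖(1-t) • p + t • q‖) : ‖u q - u p‖ ≤ B * ‖q - p‖ := by
  have hseg : ∀ x ∈ segment ℝ p q, ρ ≤ ‖x‖ := by
    intro x hx
    rw [segment_eq_image] at hx
    obtain ⟨t, ht, rfl⟩ := hx
    exact hs t ht
  exact (convex_segment p q).norm_image_sub_le_of_norm_hasFDerivWithin_le
    (fun x hx => (h x (hseg x hx)).hasFDerivWithinAt) (fun x hx => hB x (hseg x hx))
    (left_mem_segment ℝ p q) (right_mem_segment ℝ p q)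

lemma path_bound {u : E3 → ℂ} {L : E3 → (E3 →L[ℝ] ℂ)} {ρ B : ℝ} (hρ : 1 ≤ ρ)
    (h : ∀ x, ρ ≤ ‖x‖ → HasFDerivAt u (L x) x) (hB : ∀ x, ρ ≤ ‖x‖ → ‖L x‖ ≤ B)
    (x y : E3) (hx : ρ ≤ ‖x‖) (hy : ρ ≤ ‖y‖) (hxy : ‖y - x‖ ≤ 1) :
    ‖u y - u x‖ ≤ B * (‖x‖ + ‖y‖ + 2) * ‖y - x‖ := by
  set η := ‖y - x‖ with hη
  have hη0 : 0 ≤ η := norm_nonneg _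
  have hB0 : 0 ≤ B := (norm_nonneg _).trans (hB x hx)
  have rad : ∀ z : E3, ρ ≤ ‖z‖ → ‖u ((1+η) • z) - u z‖ ≤ B * (η * ‖z‖) := by
    intro z hz
    have := seg_bound h hB z ((1+η) • z) (by
      intro t ht
      have : (1-t) • z + t • ((1+η) • z) = (1 + t * η) • z := by module
      rw [this, norm_smul, Real.norm_of_nonneg (by have := mul_nonneg ht.1 hη0; linarith)]
      have := mul_nonneg (mul_nonneg ht.1 hη0) (norm_nonneg z); nlinarith)
    have e : (1+η) • z - z = η • z := by module
    rwa [e, norm_smul, Real.norm_of_nonneg hη0] at this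
  have mid : ‖u ((1+η) • y) - u ((1+η) • x)‖ ≤ B * ((1+η) * η) := by
    have := seg_bound h hB ((1+η) • x) ((1+η) • y) (by
      intro t ht
      have e : (1-t) • ((1+η) • x) + t • ((1+η) • y) = (1+η) • ((1-t) • x + t • y) := by module
      rw [e, norm_smul, Real.norm_of_nonneg (by linarith)]
      have key : ρ - η / 2 ≤ ‖(1-t) • x + t • y‖ := by
        rcases le_total t (1/2) with h1 | h1
        · have e1 : (1-t) • x + t • y = x + t • (y - x) := by module
          have := norm_sub_le_norm_add x (t • (y - x))
          rw [e1]
          rw [norm_smul, Real.norm_of_nonneg ht.1] at this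
          nlinarith
        · have e1 : (1-t) • x + t • y = y + (1-t) • (x - y) := by module
          have := norm_sub_le_norm_add y ((1-t) • (x - y))
          rw [e1]
          rw [norm_smul, Real.norm_of_nonneg (by linarith [ht.2]), norm_sub_rev] at this
          nlinarith
      nlinarith)
    have e : (1+η) • y - (1+η) • x = (1+η) • (y - x) := by module
    rwa [e, norm_smul, Real.norm_of_nonneg (by linarith)] at this
  have e : u y - u x = (u ((1+η) • x) - u x) + (u ((1+η) • y) - u ((1+η) • x)) - (u ((1+η) • y) - u y) := by ring
  rw [e]
  refine (norm_sub_le _ _).trans ?_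
  refine (add_le_add_left (norm_add_le _ _) _).trans ?_
  have := rad x hx
  have := rad y hy
  have h3 : B * ((1+η)*η) ≤ B * (2 * η) := by
    apply mul_le_mul_of_nonneg_left _ hB0; nlinarith
  nlinarith

lemma tsum_hasFDerivWithin {u : ℕ → E3 → ℂ} {L : ℕ → E3 → (E3 →L[ℝ] ℂ)} {ρ : ℝ} {B : ℕ → ℝ} (hρ : 1 ≤ ρ)
    (h : ∀ l x, ρ ≤ ‖x‖ → HasFDerivAt (u l) (L l x) x) (hB : ∀ l x, ρ ≤ ‖x‖ → ‖L l x‖ ≤ B l)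
    (hS : Summable B) (hs : ∀ x, ρ ≤ ‖x‖ → Summable (fun l => u l x)) (x : E3) (hx : ρ ≤ ‖x‖) :
    HasFDerivWithinAt (fun y => ∑' l, u l y) (∑' l, L l x) {y | ρ ≤ ‖y‖} x := by
  rw [hasFDerivWithinAt_iff_tendsto]
  have hB0 : ∀ l, 0 ≤ B l := fun l => (norm_nonneg _).trans (hB l x hx)
  have hL : Summable (fun l => L l x) := Summable.of_norm_bounded hS (fun l => hB l x hx)
  set g : ℕ → E3 → ℝ := fun l y => ‖y - x‖⁻¹ * ‖u l y - u l x - L l x (y - x)‖ with hg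
  have hbd : ∀ l y, ρ ≤ ‖y‖ → ‖y - x‖ ≤ 1 → g l y ≤ B l * (2 * ‖x‖ + 4) := by
    intro l y hy hyx
    have h1 := path_bound hρ (h l) (hB l) x y hx hy hyx
    have h2 : ‖L l x (y - x)‖ ≤ B l * ‖y - x‖ := (L l x).le_of_opNorm_le (hB l x hx) _
    have h3 : ‖y‖ ≤ ‖x‖ + 1 := by
      have := norm_add_le x (y - x); rw [add_sub_cancel] at this; linarith
    have h4 : ‖u l y - u l x - L l x (y - x)‖ ≤ B l * (2 * ‖x‖ + 4) * ‖y - x‖ := by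
      refine (norm_sub_le _ _).trans ?_
      have : B l * (‖x‖ + ‖y‖ + 2) * ‖y - x‖ ≤ B l * (‖x‖ + (‖x‖ + 1) + 2) * ‖y - x‖ := by
        gcongr; exact hB0 l
      linarith
    rw [hg]; dsimp only
    rcases eq_or_lt_of_le (norm_nonneg (y - x)) with h0 | h0
    · rw [← h0]; simp; have := hB0 l; positivity
    · rw [inv_mul_le_iff₀ h0]; linarith
  have hev : ∀ᶠ y in nhdsWithin x {y | ρ ≤ ‖y‖}, ρ ≤ ‖y‖ ∧ ‖y - x‖ ≤ 1 := by
    refine Filter.Eventually.and self_mem_nhdsWithin ?_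
    apply mem_nhdsWithin_of_mem_nhds
    have := Metric.closedBall_mem_nhds x (one_pos)
    filter_upwards [this] with y hy
    rwa [mem_closedBall_iff_norm] at hy
  have hT : Tendsto (fun y => ∑' l, g l y) (nhdsWithin x {y | ρ ≤ ‖y‖}) (nhds (∑' l : ℕ, (0:ℝ))) := by
    apply tendsto_tsum_of_dominated_convergence (bound := fun l => B l * (2 * ‖x‖ + 4)) (hS.mul_right _)
    · intro l
      exact hasFDerivWithinAt_iff_tendsto.1 (h l x hx).hasFDerivWithinAt
    · filter_upwards [hev] with y hy l
      rw [Real.norm_of_nonneg (by rw [hg]; positivity)]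
      exact hbd l y hy.1 hy.2
  rw [tsum_zero] at hT
  refine squeeze_zero' (Eventually.of_forall (fun y => by positivity)) ?_ hT
  filter_upwards [hev] with y hy
  have hsum : Summable (fun l => g l y) :=
    Summable.of_nonneg_of_le (fun l => by rw [hg]; positivity) (fun l => hbd l y hy.1 hy.2) (hS.mul_right _)
  have e : (∑' l, u l y) - (∑' l, u l x) - (∑' l, L l x) (y - x) = ∑' l, (u l y - u l x - L l x (y-x)) := by
    rw [Summable.tsum_sub ((hs y hy.1).sub (hs x hx)), Summable.tsum_sub (hs y hy.1) (hs x hx)]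
    · congr 1
      exact (ContinuousLinearMap.apply ℝ ℂ (y - x)).map_tsum hL
    · exact ((ContinuousLinearMap.apply ℝ ℂ (y - x)).hasSum hL.hasSum).summable
  rw [e]
  rcases eq_or_lt_of_le (norm_nonneg (y - x)) with h0 | h0
  · rw [← h0]; simp; exact tsum_nonneg (fun l => by rw [hg]; positivity)
  · have hsn : Summable (fun l => ‖u l y - u l x - L l x (y - x)‖) := by
      have := hsum.mul_left ‖y - x‖
      refine this.congr (fun l => ?_)
      rw [hg]; field_simp
    rw [hg, tsum_mul_left]
    exact mul_le_mul_of_nonneg_left (norm_tsum_le_tsum_norm hsn) (by positivity)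

def Sol (a : Arr) (x : E3) : ℂ := ∑' l, lev a l x

def Adm (p : ℕ) (ρ : ℝ) (a : Arr) : Prop :=
  Summable (fun l : ℕ => nrm a l * (((l:ℝ)+1)^p * Real.sqrt (l+1)) * (ρ⁻¹)^l)

lemma norm_zet_le (e : E3) : ‖zet e‖ ≤ ‖e‖ := by
  have h := norm_sq_E3 e
  have h2 : ‖zet e‖^2 = e 0 ^2 + e 1 ^2 := by
    rw [← Complex.normSq_eq_norm_sq, Complex.normSq_apply]; simp [zet]; ring
  apply (pow_le_pow_iff_left₀ (norm_nonneg _) (norm_nonneg _) two_ne_zero).1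
  rw [h, h2]; nlinarith [sq_nonneg (e 2)]

lemma norm_gradL_le (A B C : ℂ) : ‖gradL A B C‖ ≤ ‖A‖ + ‖B‖ + ‖C‖ := by
  apply ContinuousLinearMap.opNorm_le_bound _ (by positivity)
  intro e
  rw [gradL_zet]
  have h1 := norm_zet_le e
  have h2 : |e 2| ≤ ‖e‖ := by simpa using EuclideanSpace.norm_eq e ▸ PiLp.norm_apply_le e 2
  refine (norm_add₃_le).trans ?_
  simp only [norm_div, norm_mul, RCLike.norm_conj, Complex.norm_real, Real.norm_eq_abs]
  simp only [Complex.norm_ofNat]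
  have := norm_nonneg A
  have := norm_nonneg B
  have := norm_nonneg C
  nlinarith [mul_le_mul_of_nonneg_left h1 (norm_nonneg A), mul_le_mul_of_nonneg_left h1 (norm_nonneg B), mul_le_mul_of_nonneg_left h2 (norm_nonneg C), norm_nonneg e, mul_nonneg (norm_nonneg A) (norm_nonneg e), mul_nonneg (norm_nonneg B) (norm_nonneg e)]

end Part10

section Part11

open MeasureTheory Real Filter
set_option linter.all false

lemma ne_zero_of_le {ρ : ℝ} (hρ : 1 ≤ ρ) {x : E3} (hx : ρ ≤ ‖x‖) : x ≠ 0 := by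
  rintro rfl; simp at hx; linarith

lemma lev_bd (a : Arr) (l : ℕ) {ρ : ℝ} (hρ : 1 ≤ ρ) {x : E3} (hx : ρ ≤ ‖x‖) :
    ‖lev a l x‖ ≤ nrm a l * Real.sqrt (l+1) * (ρ⁻¹)^l := by
  refine (norm_lev_le a l (ne_zero_of_le hρ hx)).trans ?_
  have h1 : ‖x‖⁻¹ ≤ ρ⁻¹ := inv_anti₀ (by linarith) hx
  have h2 : ‖x‖⁻¹ ≤ 1 := inv_le_one_of_one_le₀ (by linarith)
  have h0 : 0 ≤ ‖x‖⁻¹ := by positivity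
  have := nrm_nonneg a l
  gcongr
  rw [pow_succ]
  calc _ ≤ (‖x‖⁻¹)^l * 1 := by gcongr
    _ ≤ _ := by rw [mul_one]; gcongr

lemma Adm.mono {p q : ℕ} {ρ : ℝ} (hρ : 1 ≤ ρ) {a : Arr} (h : Adm q ρ a) (hpq : p ≤ q) : Adm p ρ a := by
  refine Summable.of_nonneg_of_le (fun l => ?_) (fun l => ?_) h
  · have := nrm_nonneg a l; positivity
  · have := nrm_nonneg a l
    have : (1:ℝ) ≤ l + 1 := by have : (0:ℝ) ≤ l := Nat.cast_nonneg l
                               linarith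
    gcongr

lemma Adm.op {p : ℕ} {ρ : ℝ} (hρ : 1 ≤ ρ) {a b : Arr} (h : Adm (p+1) ρ a)
    (hb : ∀ l : ℕ, nrm b (l+1) ≤ 2 * (l+1) * nrm a l) : Adm p ρ b := by
  unfold Adm
  rw [← summable_nat_add_iff 1]
  refine Summable.of_nonneg_of_le (fun l => ?_) (fun l => ?_) (h.mul_left (4 * 2^p))
  · have := nrm_nonneg b (l+1); positivity
  · have ha := nrm_nonneg a l
    have hl : (0:ℝ) ≤ l := Nat.cast_nonneg l
    have h1 : Real.sqrt (((l+1:ℕ):ℝ)+1) ≤ 2 * Real.sqrt (l+1) := by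
      rw [Real.sqrt_le_left (by positivity), mul_pow, Real.sq_sqrt (by positivity)]
      push_cast; linarith
    have h2 : (((l+1:ℕ):ℝ)+1)^p ≤ (2 * (l+1))^p := by
      gcongr; push_cast; linarith
    have h3 : (ρ⁻¹)^(l+1) ≤ (ρ⁻¹)^l := by
      apply pow_le_pow_of_le_one (by positivity) (inv_le_one_of_one_le₀ hρ); omega
    calc _ ≤ (2 * (l+1) * nrm a l) * ((2 * (l+1))^p * (2 * Real.sqrt (l+1))) * (ρ⁻¹)^l := by
          gcongr; exact hb l
      _ = _ := by rw [mul_pow, pow_succ]; ring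

lemma Adm.summable {ρ : ℝ} (hρ : 1 ≤ ρ) {a : Arr} (h : Adm 0 ρ a) {x : E3} (hx : ρ ≤ ‖x‖) :
    Summable (fun l => lev a l x) := by
  apply Summable.of_norm_bounded h
  intro l
  simpa using lev_bd a l hρ hx

lemma lev_continuousAt (a : Arr) (l : ℕ) {x : E3} (hx : x ≠ 0) : ContinuousAt (lev a l) x :=
  (lev_fderiv a l hx).continuousAt

lemma Adm.contOn {ρ : ℝ} (hρ : 1 ≤ ρ) {a : Arr} (h : Adm 0 ρ a) : ContinuousOn (Sol a) {x | ρ ≤ ‖x‖} := by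
  apply continuousOn_tsum (u := fun l : ℕ => nrm a l * Real.sqrt (l+1) * (ρ⁻¹)^l)
  · intro l x hx
    exact (lev_continuousAt a l (ne_zero_of_le hρ hx)).continuousWithinAt
  · simpa [Adm] using h
  · intro l x hx
    exact lev_bd a l hρ hx

lemma lev_zero_of {b : Arr} (hb : ∀ m, b 0 m = 0) (x : E3) : lev b 0 x = 0 := by simp [lev, hb]

lemma gradL_add' (p q : ℂ × ℂ × ℂ) : gradL (p+q).1 (p+q).2.1 (p+q).2.2 = gradL p.1 p.2.1 p.2.2 + gradL q.1 q.2.1 q.2.2 := by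
  ext1 e; simp only [ContinuousLinearMap.add_apply, gradL_zet, Prod.fst_add, Prod.snd_add]; ring

lemma gradL_smul' (c : ℝ) (p : ℂ × ℂ × ℂ) : gradL (c • p).1 (c • p).2.1 (c • p).2.2 = c • gradL p.1 p.2.1 p.2.2 := by
  ext1 e; simp only [ContinuousLinearMap.smul_apply, gradL_zet, Prod.smul_fst, Prod.smul_snd, Complex.real_smul]; ring

def gradLin : (ℂ × ℂ × ℂ) →ₗ[ℝ] (E3 →L[ℝ] ℂ) where
  toFun p := gradL p.1 p.2.1 p.2.2
  map_add' := gradL_add'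
  map_smul' := gradL_smul'

lemma gradLin_bound (p : ℂ × ℂ × ℂ) : ‖gradLin p‖ ≤ 3 * ‖p‖ := by
  refine (norm_gradL_le _ _ _).trans ?_
  have h1 := norm_fst_le p
  have h2 := norm_snd_le p
  have h3 := norm_fst_le p.2
  have h4 := norm_snd_le p.2
  linarith

def gradC : (ℂ × ℂ × ℂ) →L[ℝ] (E3 →L[ℝ] ℂ) := gradLin.mkContinuous 3 gradLin_bound

lemma gradC_apply (a b c : ℂ) : gradC (a, b, c) = gradL a b c := rfl

attribute [irreducible] gradC

lemma hasSum_trip {A B C : ℕ → ℂ} {a b c : ℂ} (hA : HasSum A a) (hB : HasSum B b) (hC : HasSum C c) :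
    HasSum (fun l => (A l, B l, C l)) (a, b, c) := hA.prodMk (hB.prodMk hC)

lemma gradL_hasSum {A B C : ℕ → ℂ} {a b c : ℂ} (hA : HasSum A a) (hB : HasSum B b) (hC : HasSum C c) :
    HasSum (fun l => gradL (A l) (B l) (C l)) (gradL a b c) := by
  simp_rw [← gradC_apply]
  exact gradC.hasSum (hasSum_trip hA hB hC)

def gradS (a : Arr) (x : E3) : E3 →L[ℝ] ℂ := gradL (Sol (opP a) x) (Sol (opM a) x) (Sol (opZ a) x)

lemma Sol_shift {b : Arr} (hb : ∀ m, b 0 m = 0) {ρ : ℝ} (hρ : 1 ≤ ρ) (h : Adm 0 ρ b) {x : E3} (hx : ρ ≤ ‖x‖) :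
    HasSum (fun l => lev b (l+1) x) (Sol b x) := by
  have := (h.summable hρ hx).hasSum
  rw [← hasSum_nat_add_iff' 1] at this
  simp only [Finset.sum_range_one, lev_zero_of hb, sub_zero] at this
  exact this

lemma Sol_hasFDeriv {ρ : ℝ} (hρ : 1 ≤ ρ) {a : Arr} (h : Adm 1 ρ a) {x : E3} (hx : ρ ≤ ‖x‖) :
    HasFDerivWithinAt (Sol a) (gradS a x) {y | ρ ≤ ‖y‖} x := by
  have hP := h.op hρ (nrm_opP a)
  have hM := h.op hρ (nrm_opM a)
  have hZ := h.op hρ (nrm_opZ a)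
  have h1 := tsum_hasFDerivWithin (u := lev a)
    (L := fun l x => gradL (lev (opP a) (l+1) x) (lev (opM a) (l+1) x) (lev (opZ a) (l+1) x))
    (B := fun l : ℕ => nrm (opP a) (l+1) * Real.sqrt ((l+1:ℕ)+1) * (ρ⁻¹)^(l+1) +
      nrm (opM a) (l+1) * Real.sqrt ((l+1:ℕ)+1) * (ρ⁻¹)^(l+1) +
      nrm (opZ a) (l+1) * Real.sqrt ((l+1:ℕ)+1) * (ρ⁻¹)^(l+1)) hρ
    (fun l y hy => lev_fderiv a l (ne_zero_of_le hρ hy))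
    (fun l y hy => (norm_gradL_le _ _ _).trans (add_le_add (add_le_add (lev_bd _ _ hρ hy) (lev_bd _ _ hρ hy)) (lev_bd _ _ hρ hy)))
    (by
      unfold Adm at hP hM hZ
      rw [← summable_nat_add_iff 1] at hP hM hZ
      refine Summable.add (Summable.add ?_ ?_) ?_
      · simpa using hP
      · simpa using hM
      · simpa using hZ)
    (fun y hy => (h.mono hρ (by omega)).summable hρ hy) x hx
  have e : ∑' l, gradL (lev (opP a) (l+1) x) (lev (opM a) (l+1) x) (lev (opZ a) (l+1) x) = gradS a x :=
    (gradL_hasSum (Sol_shift (fun m => rfl) hρ hP hx) (Sol_shift (fun m => rfl) hρ hM hx) (Sol_shift (fun m => rfl) hρ hZ hx)).tsum_eq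
  rw [e] at h1
  exact h1

lemma gradL_contOn {A B C : E3 → ℂ} {s : Set E3} (hA : ContinuousOn A s) (hB : ContinuousOn B s) (hC : ContinuousOn C s) :
    ContinuousOn (fun x => gradL (A x) (B x) (C x)) s := by
  simp_rw [← gradC_apply]
  exact gradC.continuous.comp_continuousOn (hA.prodMk (hB.prodMk hC))

lemma gradL_contDiffOn {A B C : E3 → ℂ} {s : Set E3} {n : ℕ} (hA : ContDiffOn ℝ n A s) (hB : ContDiffOn ℝ n B s) (hC : ContDiffOn ℝ n C s) :
    ContDiffOn ℝ n (fun x => gradL (A x) (B x) (C x)) s := by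
  simp_rw [← gradC_apply]
  exact gradC.contDiff.comp_contDiffOn (hA.prodMk (hB.prodMk hC))

lemma uniqueDiffOn_closedExt : UniqueDiffOn ℝ closedExt := by
  intro x hx
  have hx' : 1 ≤ ‖x‖ := hx
  have hpos : 0 < ‖x‖ := by linarith
  have h1 : UniqueDiffWithinAt ℝ (Metric.closedBall ((2:ℝ) • x) ‖x‖) x := by
    apply uniqueDiffWithinAt_convex (convex_closedBall _ _)
    · rw [interior_closedBall _ hpos.ne']; exact ⟨_, Metric.mem_ball_self hpos⟩
    · apply subset_closure
      rw [mem_closedBall_iff_norm]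
      have : x - (2:ℝ) • x = -x := by module
      rw [this, norm_neg]
  refine h1.mono ?_
  intro y hy
  rw [mem_closedBall_iff_norm] at hy
  show 1 ≤ ‖y‖
  have h2 := norm_sub_norm_le ((2:ℝ) • x) y
  rw [norm_smul, norm_sub_rev] at h2
  norm_num at h2
  linarith

lemma Sol_contDiffOn_one {a : Arr} (h : Adm 1 1 a) : ContDiffOn ℝ 1 (Sol a) closedExt := by
  have h01 : (1 : WithTop ℕ∞) = 0 + 1 := by simp
  rw [h01, contDiffOn_succ_iff_hasFDerivWithinAt (by simp)]
  intro x hx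
  refine ⟨closedExt, ?_, by simp, gradS a, ?_, ?_⟩
  · rw [Set.insert_eq_of_mem hx]; exact self_mem_nhdsWithin
  · intro y hy
    exact Sol_hasFDeriv le_rfl h hy
  · rw [contDiffOn_zero]
    exact gradL_contOn ((h.op le_rfl (nrm_opP a)).contOn le_rfl) ((h.op le_rfl (nrm_opM a)).contOn le_rfl)
      ((h.op le_rfl (nrm_opZ a)).contOn le_rfl)

def Good (a : Arr) : Prop := ∀ ρ > 1, ∀ p, Adm p ρ a

lemma extDomain_isOpen : IsOpen extDomain := isOpen_lt continuous_const continuous_norm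

lemma Good.hasFDeriv {a : Arr} (h : Good a) {x : E3} (hx : x ∈ extDomain) : HasFDerivAt (Sol a) (gradS a x) x := by
  have hx' : 1 < ‖x‖ := hx
  obtain ⟨ρ, h1, h2⟩ := exists_between hx'
  have := Sol_hasFDeriv h1.le (h ρ h1 1) h2.le
  apply this.hasFDerivAt
  filter_upwards [(isOpen_lt continuous_const continuous_norm).mem_nhds h2] with y hy
  exact le_of_lt hy

lemma Good.opP {a : Arr} (h : Good a) : Good (opP a) := fun ρ hρ p => (h ρ hρ (p+1)).op hρ.le (nrm_opP a)
lemma Good.opM {a : Arr} (h : Good a) : Good (opM a) := fun ρ hρ p => (h ρ hρ (p+1)).op hρ.le (nrm_opM a)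
lemma Good.opZ {a : Arr} (h : Good a) : Good (opZ a) := fun ρ hρ p => (h ρ hρ (p+1)).op hρ.le (nrm_opZ a)

lemma Good.contDiffOn (n : ℕ) : ∀ {a : Arr}, Good a → ContDiffOn ℝ n (Sol a) extDomain := by
  induction n with
  | zero =>
    intro a h
    rw [Nat.cast_zero, contDiffOn_zero]
    intro x hx
    exact (h.hasFDeriv hx).continuousAt.continuousWithinAt
  | succ n ih =>
    intro a h
    rw [Nat.cast_succ, contDiffOn_succ_iff_fderiv_of_isOpen extDomain_isOpen]
    refine ⟨fun x hx => (h.hasFDeriv hx).differentiableAt.differentiableWithinAt, by simp, ?_⟩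
    refine (gradL_contDiffOn (ih h.opP) (ih h.opM) (ih h.opZ)).congr ?_
    intro x hx
    exact (h.hasFDeriv hx).fderiv

lemma good_of_adm {a : Arr} (h : Adm 0 1 a) : Good a := by
  intro ρ hρ p
  have ht : Tendsto (fun l : ℕ => ((l:ℝ)+1)^p * (ρ⁻¹)^l) atTop (nhds 0) := by
    have h1 := (tendsto_pow_const_mul_const_pow_of_abs_lt_one p (r := ρ⁻¹) (by rw [abs_of_pos (by positivity)]; exact inv_lt_one_of_one_lt₀ hρ))
    have h2 := (h1.comp (tendsto_add_atTop_nat 1)).mul_const ρ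
    rw [zero_mul] at h2
    refine h2.congr (fun l => ?_)
    simp only [Function.comp]
    push_cast
    rw [pow_succ]
    have : ρ ≠ 0 := by linarith
    field_simp
  have hbd := ht.bddAbove_range
  obtain ⟨K, hK⟩ := hbd
  refine Summable.of_nonneg_of_le (fun l => ?_) (fun l => ?_) (h.mul_left K)
  · have := nrm_nonneg a l
    have : 0 ≤ ρ⁻¹ := by positivity
    positivity
  · have := nrm_nonneg a l
    have hk : ((l:ℝ)+1)^p * (ρ⁻¹)^l ≤ K := hK ⟨l, rfl⟩
    simp only [pow_zero, one_mul, inv_one, one_pow, mul_one]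
    calc _ = (((l:ℝ)+1)^p * (ρ⁻¹)^l) * (nrm a l * Real.sqrt (l+1)) := by ring
      _ ≤ _ := by gcongr

lemma int_prod_nonneg (k : ℤ) : (0:ℝ) ≤ ((k:ℝ)+1)*((k:ℝ)+2) := by
  have : 0 ≤ (k+1)*(k+2) := by
    rcases le_or_gt (-1) k with h | h
    · apply mul_nonneg <;> omega
    · apply mul_nonneg_of_nonpos_of_nonpos <;> omega
  exact_mod_cast this

def pmc (l : ℕ) (m : ℤ) : ℝ := Real.sqrt ((2*l+1)/(2*l+5) * (((l+m+1)*(l+m+2))*((l-m+1)*(l-m+2))))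

lemma pm_coef (l : ℕ) (m : ℤ) : cp (l+1) (m-1) * cp l (-(m-1+1)) = pmc l m := by
  unfold cp pmc
  have h1 := int_prod_nonneg (l+m)
  push_cast at h1 ⊢
  rw [← Real.sqrt_mul (by
    have : ((l:ℝ)+1+(m-1)+1)*(l+1+(m-1)+2) = (l+m+1)*(l+m+2) := by ring
    rw [this]; positivity)]
  congr 1; field_simp; ring

lemma mp_coef (l : ℕ) (m : ℤ) : cp (l+1) (-(m+1)) * cp l (m+1-1) = pmc l m := by
  unfold cp pmc
  have h1 := int_prod_nonneg (l-m)
  push_cast at h1 ⊢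
  rw [← Real.sqrt_mul (by
    have : ((l:ℝ)+1+ -(m+1)+1)*(l+1+ -(m+1)+2) = (l-m+1)*(l-m+2) := by ring
    rw [this]; positivity)]
  congr 1; field_simp; ring

lemma zz_coef (l : ℕ) (m : ℤ) (hm : m.natAbs ≤ l + 2) : cz (l+1) m * cz l m = pmc l m := by
  unfold cz pmc
  have h1 : (0:ℝ) ≤ ((l:ℝ)+1+1)^2 - m^2 := by
    have h1 : -(l:ℝ)-2 ≤ m := by exact_mod_cast (by omega : -(l:ℤ)-2 ≤ m)
    have h2 : (m:ℝ) ≤ l+2 := by exact_mod_cast (by omega : m ≤ (l:ℤ)+2)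
    nlinarith
  push_cast
  rw [← Real.sqrt_mul (by positivity)]
  congr 1; field_simp; ring

lemma pm_eq (a : Arr) (l : ℕ) (m : ℤ) : opP (opM a) (l+2) m = -(pmc l m * a l m) := by
  simp only [opP, opM]
  rw [← pm_coef]; push_cast
  rw [show m - 1 + 1 = m by ring]; ring

lemma mp_eq (a : Arr) (l : ℕ) (m : ℤ) : opM (opP a) (l+2) m = -(pmc l m * a l m) := by
  simp only [opP, opM]
  rw [← mp_coef]; push_cast
  rw [show m + 1 - 1 = m by ring]; ring

lemma zz_eq (a : Arr) (l : ℕ) (m : ℤ) (hm : m.natAbs ≤ l + 2) : opZ (opZ a) (l+2) m = pmc l m * a l m := by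
  simp only [opZ]
  rw [← zz_coef l m hm]; push_cast
  ring

lemma lev_mp (a : Arr) (l : ℕ) (x : E3) : lev (opM (opP a)) l x = lev (opP (opM a)) l x := by
  match l with
  | 0 => simp [lev, opM, opP]
  | 1 => simp [lev, opM, opP]
  | l+2 => simp only [lev, mp_eq, pm_eq]

lemma lev_zz (a : Arr) (l : ℕ) (x : E3) : lev (opZ (opZ a)) l x = -lev (opP (opM a)) l x := by
  match l with
  | 0 => simp [lev, opM, opP, opZ]
  | 1 => simp [lev, opM, opP, opZ]
  | l+2 =>
    simp only [lev, ← Finset.sum_neg_distrib]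
    apply Finset.sum_congr rfl
    intro m hm
    rw [zz_eq a l m (by simp at hm; omega), pm_eq]; ring

lemma Sol_mp (a : Arr) (x : E3) : Sol (opM (opP a)) x = Sol (opP (opM a)) x := by simp only [Sol, lev_mp]
lemma Sol_zz (a : Arr) (x : E3) : Sol (opZ (opZ a)) x = -Sol (opP (opM a)) x := by
  simp only [Sol, lev_zz, tsum_neg]

lemma zet_single : zet (EuclideanSpace.single 0 1) = 1 ∧ zet (EuclideanSpace.single 1 1) = Complex.I ∧
    zet (EuclideanSpace.single 2 1) = 0 := by
  refine ⟨?_, ?_, ?_⟩ <;> simp [zet]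

lemma gradL_e0 (A B C : ℂ) : gradL A B C (EuclideanSpace.single 0 1) = (A + B) / 2 := by
  rw [gradL_zet, zet_single.1]; simp; ring
lemma gradL_e1 (A B C : ℂ) : gradL A B C (EuclideanSpace.single 1 1) = Complex.I * (B - A) / 2 := by
  rw [gradL_zet, zet_single.2.1]; simp; ring
lemma gradL_e2 (A B C : ℂ) : gradL A B C (EuclideanSpace.single 2 1) = C := by
  rw [gradL_zet, zet_single.2.2]; simp

lemma Good.lap_zero {a : Arr} (h : Good a) {x : E3} (hx : x ∈ extDomain) : lap (Sol a) x = 0 := by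
  have hev : ∀ᶠ y in nhds x, fderiv ℝ (Sol a) y = gradS a y := by
    filter_upwards [extDomain_isOpen.mem_nhds hx] with y hy
    exact (h.hasFDeriv hy).fderiv
  have hP := h.opP.hasFDeriv hx
  have hM := h.opM.hasFDeriv hx
  have hZ := h.opZ.hasFDeriv hx
  have d0 : HasFDerivAt (fun y => fderiv ℝ (Sol a) y (EuclideanSpace.single 0 1))
      ((2:ℂ)⁻¹ • (gradS (_root_.opP a) x + gradS (_root_.opM a) x)) x := by
    refine ((hP.add hM).const_smul ((2:ℂ)⁻¹)).congr_of_eventuallyEq ?_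
    filter_upwards [hev] with y hy
    rw [hy, gradS, gradL_e0]; simp; ring
  have d1 : HasFDerivAt (fun y => fderiv ℝ (Sol a) y (EuclideanSpace.single 1 1))
      ((Complex.I * (2:ℂ)⁻¹) • (gradS (_root_.opM a) x - gradS (_root_.opP a) x)) x := by
    refine ((hM.sub hP).const_smul (Complex.I * (2:ℂ)⁻¹)).congr_of_eventuallyEq ?_
    filter_upwards [hev] with y hy
    rw [hy, gradS, gradL_e1]; simp; ring
  have d2 : HasFDerivAt (fun y => fderiv ℝ (Sol a) y (EuclideanSpace.single 2 1))
      (gradS (_root_.opZ a) x) x := by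
    refine hZ.congr_of_eventuallyEq ?_
    filter_upwards [hev] with y hy
    rw [hy, gradS, gradL_e2]
  unfold lap
  rw [Fin.sum_univ_three, d0.fderiv, d1.fderiv, d2.fderiv]
  simp only [ContinuousLinearMap.smul_apply, ContinuousLinearMap.add_apply, ContinuousLinearMap.sub_apply, smul_eq_mul, gradS]
  rw [gradL_e0, gradL_e0, gradL_e1, gradL_e1, gradL_e2]
  rw [Sol_zz, Sol_mp]
  linear_combination ((Sol (_root_.opM (_root_.opM a)) x + Sol (_root_.opP (_root_.opP a)) x)/4 - Sol (_root_.opP (_root_.opM a)) x / 2) * Complex.I_sq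

end Part11

section Part12

open MeasureTheory Real Filter
set_option linter.all false

lemma sph_continuous : Continuous (fun q : ℝ × ℝ => sphCoord q.1 q.2) := by
  have h : Continuous (fun q : ℝ × ℝ => ![Real.cos q.1 * Real.cos q.2, Real.cos q.1 * Real.sin q.2, Real.sin q.1]) := by
    apply continuous_pi
    intro i
    fin_cases i <;> simp <;> fun_prop
  exact (PiLp.continuous_toLp 2 (fun _ : Fin 3 => ℝ)).comp h

lemma Sol_decay {a : Arr} (h : Adm 0 1 a) : Tendsto (Sol a) (Bornology.cobounded E3) (nhds 0) := by
  have hS : Summable (fun l : ℕ => nrm a l * Real.sqrt (l+1)) := by simpa [Adm] using h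
  have h1 : Tendsto (fun x : E3 => (∑' l : ℕ, nrm a l * Real.sqrt (l+1)) * ‖x‖⁻¹) (Bornology.cobounded E3) (nhds 0) := by
    have := (tendsto_inv_atTop_zero.comp (tendsto_norm_cobounded_atTop (E := E3))).const_mul (∑' l : ℕ, nrm a l * Real.sqrt (l+1))
    rw [mul_zero] at this
    exact this
  apply squeeze_zero_norm' _ h1
  have : ∀ᶠ x : E3 in Bornology.cobounded E3, 1 ≤ ‖x‖ := (tendsto_norm_cobounded_atTop (E := E3)).eventually_ge_atTop 1
  filter_upwards [this] with x hx
  rw [← tsum_mul_right]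
  refine tsum_of_norm_bounded (hS.mul_right _).hasSum ?_
  intro l
  refine (norm_lev_le a l (ne_zero_of_le le_rfl hx)).trans ?_
  have := nrm_nonneg a l
  have h2 : ‖x‖⁻¹ ≤ 1 := inv_le_one_of_one_le₀ hx
  gcongr
  rw [pow_succ]
  exact mul_le_of_le_one_left (by positivity) (pow_le_one₀ (by positivity) h2)

lemma lev_sph (a : Arr) (l : ℕ) {r : ℝ} (hr : 0 < r) (θ φ : ℝ) : lev a l (r • sphCoord θ φ) =
    ∑ m ∈ Finset.Icc (-(l:ℤ)) l, (((r⁻¹ : ℝ) : ℂ)^(l+1) * a l m) * Yb l m θ φ := by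
  unfold lev
  apply Finset.sum_congr rfl
  intro m _
  rw [VV_sph l m r hr]; ring

lemma flCoeff_finsum {ι : Type*} (s : Finset ι) {g : ι → ℝ → ℝ → ℂ}
    (hg : ∀ i, Continuous (fun q : ℝ × ℝ => g i q.1 q.2)) (l : ℕ) (m : ℤ) :
    flCoeff (fun θ φ => ∑ i ∈ s, g i θ φ) l m = ∑ i ∈ s, flCoeff (g i) l m := by
  classical
  induction s using Finset.induction_on with
  | empty => simp [flCoeff]
  | insert i s hi ih =>
    simp only [Finset.sum_insert hi]
    rw [← ih, flCoeff_add (hg i) (by apply continuous_finsetSum; intro i _; exact hg i)]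

lemma flCoeff_lev (a : Arr) (k : ℕ) {r : ℝ} (hr : 0 < r) (l : ℕ) (m : ℤ) (hm : m.natAbs ≤ l) :
    flCoeff (fun θ φ => lev a k (r • sphCoord θ φ)) l m = if k = l then ((r⁻¹ : ℝ) : ℂ)^(l+1) * a l m else 0 := by
  simp_rw [lev_sph a k hr]
  rw [flCoeff_finsum _ (g := fun m' θ φ => (((r⁻¹ : ℝ) : ℂ)^(k+1) * a k m') * Yb k m' θ φ)
    (fun i => (Yb_continuous k i).const_mul _)]
  simp_rw [flCoeff_const_mul]
  have : ∀ i ∈ Finset.Icc (-(k:ℤ)) k, ((r⁻¹ : ℝ) : ℂ)^(k+1) * a k i * flCoeff (Yb k i) l m =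
      if k = l ∧ i = m then ((r⁻¹ : ℝ) : ℂ)^(l+1) * a l m else 0 := by
    intro i hi
    rw [Yb_orth k l i m (by simp at hi; omega)]
    split_ifs with h
    · obtain ⟨rfl, rfl⟩ := h; ring
    · ring
  rw [Finset.sum_congr rfl this]
  split_ifs with h
  · subst h
    simp only [true_and]
    rw [Finset.sum_ite_eq' , if_pos]
    simp; omega
  · simp [h]

lemma lev_sph_continuous (a : Arr) (l : ℕ) {r : ℝ} (hr : 0 < r) :
    Continuous (fun q : ℝ × ℝ => lev a l (r • sphCoord q.1 q.2)) := by
  simp_rw [lev_sph a l hr]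
  apply continuous_finsetSum
  intro i _
  exact (Yb_continuous l i).const_mul _

lemma flCoeff_Sol {a : Arr} (h : Adm 0 1 a) {r : ℝ} (hr : 1 ≤ r) (l : ℕ) (m : ℤ) (hm : m.natAbs ≤ l) :
    flCoeff (fun θ φ => Sol a (r • sphCoord θ φ)) l m = ((r⁻¹ : ℝ) : ℂ)^(l+1) * a l m := by
  have hr0 : 0 < r := by linarith
  have h1 := flCoeff_tsum (g := fun k θ φ => lev a k (r • sphCoord θ φ))
    (B := fun k : ℕ => nrm a k * Real.sqrt (k+1)) (fun k => lev_sph_continuous a k hr0)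
    (fun k θ φ => by
      have := lev_bd a k (le_refl 1) (x := r • sphCoord θ φ) (by rw [norm_smul, norm_sph]; simp; exact hr.trans (le_abs_self r))
      simpa using this) (by simpa [Adm] using h) l m
  simp_rw [flCoeff_lev a _ hr0 l m hm] at h1
  have h2 := hasSum_ite_eq l (((r⁻¹ : ℝ) : ℂ)^(l+1) * a l m)
  exact h1.unique h2

/- second derivative test -/
lemma second_deriv_test {f f' : ℝ → ℝ} {f'' : ℝ} (h1 : ∀ᶠ t in nhds (0:ℝ), HasDerivAt f (f' t) t)
    (h2 : HasDerivAt f' f'' 0) (hm : IsLocalMax f 0) : f'' ≤ 0 := by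
  by_contra hpos
  push Not at hpos
  have e : deriv f =ᶠ[nhds 0] f' := by
    filter_upwards [h1] with t ht using ht.deriv
  have hdd : deriv (deriv f) 0 = f'' := by rw [e.deriv_eq]; exact h2.deriv
  have h0 : deriv f 0 = 0 := hm.deriv_eq_zero
  have hmin := isLocalMin_of_deriv_deriv_pos (by rw [hdd]; exact hpos) h0 (h1.self_of_nhds.continuousAt)
  have hc : f =ᶠ[nhds 0] fun _ => f 0 := by
    filter_upwards [hm, hmin] with t h3 h4
    exact le_antisymm h3 h4
  have : deriv f =ᶠ[nhds 0] fun _ => 0 := by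
    have := hc.deriv
    simpa using this
  have h5 := this.deriv_eq
  rw [hdd] at h5; simp at h5; linarith

lemma lap_localMax {w : E3 → ℂ} {x : E3} (hw : ContDiffAt ℝ 2 w x) (T : ℂ →L[ℝ] ℝ) (κ : ℝ)
    (hm : IsLocalMax (fun y => T (w y) + κ * ‖y‖^2) x) : T (lap w x) + 6 * κ ≤ 0 := by
  have hd : ∀ᶠ y in nhds x, DifferentiableAt ℝ w y := by
    have := hw.eventually (by simp)
    filter_upwards [this] with y hy
    exact hy.differentiableAt (by simp)
  have hfd : DifferentiableAt ℝ (fderiv ℝ w) x :=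
    (hw.fderiv_right (m := 1) (by norm_num)).differentiableAt (by simp)
  have key : ∀ i : Fin 3, T (fderiv ℝ (fun y => fderiv ℝ w y (EuclideanSpace.single i 1)) x
    (EuclideanSpace.single i 1)) + 2 * κ ≤ 0 := by
    intro i
    set e : E3 := EuclideanSpace.single i 1 with he
    have hen : ‖e‖ = 1 := by simp [he]
    have hline : ∀ t : ℝ, HasDerivAt (fun t : ℝ => x + t • e) e t := by
      intro t
      have := ((hasDerivAt_id t).smul_const e).const_add x
      simpa using this
    have hlc : ContinuousAt (fun t : ℝ => x + t • e) 0 := (hline 0).continuousAt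
    have ht : Tendsto (fun t : ℝ => x + t • e) (nhds 0) (nhds x) := by
      have := hlc.tendsto; simpa using this
    have hsq : ∀ t : ℝ, ‖x + t • e‖^2 = ‖x‖^2 + 2 * t * inner ℝ x e + t^2 := by
      intro t
      rw [norm_add_sq_real, norm_smul, inner_smul_right, hen]; simp; ring
    apply second_deriv_test (f := fun t => T (w (x + t • e)) + κ * (‖x‖^2 + 2 * t * inner ℝ x e + t^2))
      (f' := fun t => T (fderiv ℝ w (x + t • e) e) + κ * (2 * inner ℝ x e + 2 * t))
    · filter_upwards [ht.eventually hd] with t hy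
      have h1 := T.hasFDerivAt.comp_hasDerivAt t (hy.hasFDerivAt.comp_hasDerivAt t (hline t))
      have h2 : HasDerivAt (fun t : ℝ => κ * (‖x‖^2 + 2 * t * inner ℝ x e + t^2)) (κ * (2 * inner ℝ x e + 2 * t)) t := by
        have := (((((hasDerivAt_id t).const_mul 2).mul_const (inner ℝ x e)).const_add (‖x‖^2)).add ((hasDerivAt_id t).pow 2)).const_mul κ
        refine hd_congr this (fun y => by simp) ?_
        simp
      exact hd_congr (h1.add h2) (fun y => rfl) rfl
    · have hg : HasFDerivAt (fun y => fderiv ℝ w y e) (fderiv ℝ (fun y => fderiv ℝ w y e) x) (x + (0:ℝ) • e) := by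
        have : DifferentiableAt ℝ (fun y => fderiv ℝ w y e) x := hfd.clm_apply (differentiableAt_const _)
        simpa using this.hasFDerivAt
      have h1 := T.hasFDerivAt.comp_hasDerivAt (0:ℝ) (hg.comp_hasDerivAt (0:ℝ) (hline 0))
      have h2 : HasDerivAt (fun t : ℝ => κ * (2 * inner ℝ x e + 2 * t)) (2 * κ) 0 := by
        have := (((hasDerivAt_id (0:ℝ)).const_mul 2).const_add (2 * inner ℝ x e)).const_mul κ
        refine hd_congr this (fun y => by simp) ?_
        simp; ring
      exact hd_congr (h1.add h2) (fun y => rfl) rfl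
    · filter_upwards [ht.eventually hm] with t ht2
      rw [← hsq, ← hsq]
      simpa using ht2
  have := key 0
  have := key 1
  have := key 2
  unfold lap
  rw [Fin.sum_univ_three, map_add, map_add]
  linarith

lemma max_principle {w : E3 → ℂ} (hc : ContinuousOn w closedExt) (h2 : ContDiffOn ℝ 2 w extDomain)
    (hl : ∀ x ∈ extDomain, lap w x = 0) (hd : Tendsto w (Bornology.cobounded E3) (nhds 0))
    {ε : ℝ} (hε : 0 ≤ ε) (hb : ∀ x, ‖x‖ = 1 → ‖w x‖ ≤ ε) : ∀ x ∈ closedExt, ‖w x‖ ≤ ε := by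
  have main : ∀ T : ℂ →L[ℝ] ℝ, ‖T‖ ≤ 1 → ∀ x ∈ closedExt, T (w x) ≤ ε := by
    intro T hT x0 hx0
    by_contra hlt
    push Not at hlt
    have hTb : ∀ z : ℂ, T z ≤ ‖z‖ := fun z => (le_abs_self _).trans (by
      have := T.le_of_opNorm_le hT z; simpa using this)
    set δ := T (w x0) - ε with hδ
    have hδ0 : 0 < δ := by linarith
    have hev : ∀ᶠ x in Bornology.cobounded E3, ‖w x‖ < ε + δ / 2 := by
      have := (tendsto_zero_iff_norm_tendsto_zero.1 hd)
      exact this.eventually_lt_const (by linarith)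
    obtain ⟨R0, hR0⟩ := (Metric.isBounded_iff_subset_closedBall (0:E3)).1 (Bornology.isBounded_def.2 (by
      rw [compl_compl]; exact hev : {x : E3 | ‖w x‖ < ε + δ / 2}ᶜᶜ ∈ Bornology.cobounded E3))
    have hR : ∀ x : E3, R0 < ‖x‖ → ‖w x‖ < ε + δ / 2 := by
      intro x hx
      by_contra hn
      have := hR0 (show x ∈ {x : E3 | ‖w x‖ < ε + δ / 2}ᶜ from hn)
      rw [mem_closedBall_zero_iff] at this; linarith
    set R := max (max R0 ‖x0‖) 1 + 1 with hRdef
    have hR1 : R0 < R := by have := le_max_left (max R0 ‖x0‖) 1; have := le_max_left R0 ‖x0‖; linarith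
    have hR2 : ‖x0‖ < R := by have := le_max_left (max R0 ‖x0‖) 1; have := le_max_right R0 ‖x0‖; linarith
    have hR3 : 1 < R := by have := le_max_right (max R0 ‖x0‖) 1; linarith
    set κ := δ / (4 * R^2) with hκ
    have hκ0 : 0 < κ := by positivity
    have hκR : κ * R^2 = δ / 4 := by rw [hκ]; field_simp
    set K : Set E3 := closedExt ∩ Metric.closedBall 0 R with hK
    have hKc : IsCompact K := by
      have : IsClosed closedExt := isClosed_le continuous_const continuous_norm
      exact (isCompact_closedBall _ _).inter_left this
    have hx0K : x0 ∈ K := ⟨hx0, by rw [mem_closedBall_zero_iff]; exact hR2.le⟩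
    obtain ⟨x1, hx1, hmax⟩ := hKc.exists_isMaxOn ⟨x0, hx0K⟩
      (f := fun y => T (w y) + κ * ‖y‖^2) (by
        have : ContinuousOn w K := hc.mono Set.inter_subset_left
        fun_prop)
    have hg1 : T (w x0) ≤ T (w x1) + κ * ‖x1‖^2 := by
      have : T (w x0) + κ * ‖x0‖^2 ≤ T (w x1) + κ * ‖x1‖^2 := hmax hx0K
      have : 0 ≤ κ * ‖x0‖^2 := by positivity
      linarith
    have hx1n : 1 ≤ ‖x1‖ := hx1.1
    have hx1R : ‖x1‖ ≤ R := by have := hx1.2; rwa [mem_closedBall_zero_iff] at this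
    have hk2 : κ * ‖x1‖^2 ≤ δ / 4 := by
      rw [← hκR]; gcongr
    have ha : 1 < ‖x1‖ := by
      rcases eq_or_lt_of_le hx1n with h | h
      · have := hb x1 h.symm
        have := hTb (w x1)
        linarith
      · exact h
    have hbR : ‖x1‖ < R := by
      rcases eq_or_lt_of_le hx1R with h | h
      · have := hR x1 (by rw [h]; exact hR1)
        have := hTb (w x1)
        linarith
      · exact h
    have hloc : IsLocalMax (fun y => T (w y) + κ * ‖y‖^2) x1 := by
      apply hmax.isLocalMax
      have o1 : IsOpen {y : E3 | 1 < ‖y‖ ∧ ‖y‖ < R} :=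
        (isOpen_lt continuous_const continuous_norm).inter (isOpen_lt continuous_norm continuous_const)
      filter_upwards [o1.mem_nhds ⟨ha, hbR⟩] with y hy
      exact ⟨hy.1.le, by rw [mem_closedBall_zero_iff]; exact hy.2.le⟩
    have := lap_localMax (h2.contDiffAt (extDomain_isOpen.mem_nhds ha)) T κ hloc
    rw [hl x1 ha] at this
    simp at this
    linarith
  intro x hx
  by_cases h0 : w x = 0
  · rw [h0]; simpa using hε
  set c : ℂ := (starRingEnd ℂ) (w x) / ‖w x‖ with hcdef
  have hn : (‖w x‖ : ℂ) ≠ 0 := by exact_mod_cast norm_ne_zero_iff.2 h0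
  have hc1 : ‖c‖ = 1 := by
    rw [hcdef, norm_div, RCLike.norm_conj, Complex.norm_real, norm_norm, div_self (norm_ne_zero_iff.2 h0)]
  let T : ℂ →L[ℝ] ℝ := Complex.reCLM.comp (ContinuousLinearMap.mul ℝ ℂ c)
  have hT : ‖T‖ ≤ 1 := by
    apply ContinuousLinearMap.opNorm_le_bound _ zero_le_one
    intro z
    show ‖(c * z).re‖ ≤ 1 * ‖z‖
    have := Complex.abs_re_le_norm (c * z)
    rw [norm_mul, hc1] at this
    exact this
  have := main T hT x hx
  have e : T (w x) = ‖w x‖ := by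
    show (c * w x).re = _
    have : c * w x = ((‖w x‖ : ℝ) : ℂ) := by
      rw [hcdef, div_mul_eq_mul_div, mul_comm, Complex.mul_conj, Complex.normSq_eq_norm_sq]
      push_cast; field_simp
    rw [this, Complex.ofReal_re]
  rwa [e] at this

end Part12

section Part13

open MeasureTheory Real Filter
set_option linter.all false

def FinArr (a : Arr) : Prop := ∃ N, ∀ l ≥ N, ∀ m, a l m = 0

lemma FinArr.lev_zero {a : Arr} {N : ℕ} (h : ∀ l ≥ N, ∀ m, a l m = 0) (x : E3) (l : ℕ) (hl : l ∉ Finset.range N) : lev a l x = 0 := by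
  simp at hl
  simp [lev, h l hl]

lemma FinArr.adm {a : Arr} (h : FinArr a) (p : ℕ) (ρ : ℝ) : Adm p ρ a := by
  obtain ⟨N, hN⟩ := h
  apply summable_of_ne_finset_zero (s := Finset.range N)
  intro l hl
  simp at hl
  simp [nrm, hN l hl]

lemma FinArr.summable {a : Arr} (h : FinArr a) (x : E3) : Summable (fun l => lev a l x) := by
  obtain ⟨N, hN⟩ := h
  exact summable_of_ne_finset_zero (s := Finset.range N) (FinArr.lev_zero hN x)

lemma FinArr.add {a b : Arr} (ha : FinArr a) (hb : FinArr b) : FinArr (fun l m => a l m + b l m) := by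
  obtain ⟨N, hN⟩ := ha
  obtain ⟨M, hM⟩ := hb
  refine ⟨max N M, fun l hl m => ?_⟩
  dsimp only
  rw [hN l (le_trans (le_max_left _ _) hl), hM l (le_trans (le_max_right _ _) hl), add_zero]

def SRep (g : E3 → ℂ) : Prop := ∃ a, FinArr a ∧ ∀ x, ‖x‖ = 1 → g x = Sol a x

lemma SRep.add {g k : E3 → ℂ} (hg : SRep g) (hk : SRep k) : SRep (fun x => g x + k x) := by
  obtain ⟨a, ha, ha'⟩ := hg
  obtain ⟨b, hb, hb'⟩ := hk
  refine ⟨fun l m => a l m + b l m, ha.add hb, fun x hx => ?_⟩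
  dsimp only
  rw [ha' x hx, hb' x hx, Sol, Sol, ← Summable.tsum_add (ha.summable x) (hb.summable x)]
  simp only [Sol, lev, ← Finset.sum_add_distrib, add_mul]

lemma SRep.smul {g : E3 → ℂ} (hg : SRep g) (c : ℂ) : SRep (fun x => c * g x) := by
  obtain ⟨a, ⟨N, hN⟩, ha'⟩ := hg
  refine ⟨fun l m => c * a l m, ⟨N, fun l hl m => by dsimp only; rw [hN l hl, mul_zero]⟩, fun x hx => ?_⟩
  dsimp only
  rw [ha' x hx, Sol, ← tsum_mul_left]
  simp only [Sol, lev, Finset.mul_sum, mul_assoc]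

lemma SRep.congr {g k : E3 → ℂ} (hg : SRep g) (h : ∀ x, ‖x‖ = 1 → k x = g x) : SRep k := by
  obtain ⟨a, ha, ha'⟩ := hg
  exact ⟨a, ha, fun x hx => (h x hx).trans (ha' x hx)⟩

lemma SRep_zero : SRep (fun _ => 0) := ⟨fun _ _ => 0, ⟨0, by simp⟩, fun x hx => by simp [Sol, lev]⟩

lemma SRep_VV (l : ℕ) (m : ℤ) (hm : m.natAbs ≤ l) : SRep (VV l m) := by
  refine ⟨fun l' m' => if l' = l ∧ m' = m then 1 else 0, ⟨l+1, fun l' hl m' => ?_⟩, fun x _ => ?_⟩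
  · dsimp only; rw [if_neg]; omega
  · rw [Sol, tsum_eq_single l]
    · simp only [lev, true_and, ite_mul, one_mul, zero_mul]
      rw [Finset.sum_ite_eq', if_pos]
      simp; omega
    · intro l' hl
      simp [lev, hl]

lemma UU_one (l M : ℕ) {x : E3} (hx : ‖x‖ = 1) : UU l M x = zet x ^ M * (((DP M l).eval (x 2) : ℝ) : ℂ) := by
  simp [UU, hx]

lemma SRep_poly (M : ℕ) (p : Polynomial ℝ) : SRep (fun x => zet x ^ M * ((p.eval (x 2) : ℝ) : ℂ)) := by
  refine Submodule.span_induction (p := fun p _ => SRep (fun x => zet x ^ M * ((p.eval (x 2) : ℝ) : ℂ)))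
    ?_ ?_ ?_ ?_ (DP_span M p)
  · rintro _ ⟨l, rfl⟩
    have hN : ((NN (M+l) M : ℝ) : ℂ) ≠ 0 := by exact_mod_cast (NN_pos (M+l) M).ne'
    refine ((SRep_VV (M+l) M (by simp)).smul ((NN (M+l) M : ℝ) : ℂ)⁻¹).congr (fun x hx => ?_)
    rw [VV_nat, UU_one _ _ hx]; field_simp
  · refine SRep_zero.congr (fun x hx => by simp)
  · intro p q _ _ hp hq
    refine (hp.add hq).congr (fun x hx => by simp; ring)
  · intro c p _ hp
    refine (hp.smul c).congr (fun x hx => by simp; ring)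

lemma SRep_poly' (M : ℕ) (p : Polynomial ℝ) : SRep (fun x => (starRingEnd ℂ) (zet x) ^ M * ((p.eval (x 2) : ℝ) : ℂ)) := by
  refine Submodule.span_induction (p := fun p _ => SRep (fun x => (starRingEnd ℂ) (zet x) ^ M * ((p.eval (x 2) : ℝ) : ℂ)))
    ?_ ?_ ?_ ?_ (DP_span M p)
  · rintro _ ⟨l, rfl⟩
    have hN : (((-1)^M * NN (M+l) M : ℝ) : ℂ) ≠ 0 := by
      rw [Ne, Complex.ofReal_eq_zero]
      exact mul_ne_zero (pow_ne_zero _ (by norm_num)) (NN_pos (M+l) M).ne'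
    refine ((SRep_VV (M+l) (-(M:ℤ)) (by simp)).smul (((-1)^M * NN (M+l) M : ℝ) : ℂ)⁻¹).congr (fun x hx => ?_)
    rw [VV_neg, UU_one _ _ hx, inv_mul_cancel_left₀ hN]; simp
  · refine SRep_zero.congr (fun x hx => by simp)
  · intro p q _ _ hp hq
    refine (hp.add hq).congr (fun x hx => by simp; ring)
  · intro c p _ hp
    refine (hp.smul c).congr (fun x hx => by simp; ring)

lemma zet_conj_one {x : E3} (hx : ‖x‖ = 1) : zet x * (starRingEnd ℂ) (zet x) = 1 - (x 2 : ℂ)^2 := by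
  have h := norm_sq_E3 x
  rw [hx] at h
  rw [Complex.mul_conj, Complex.normSq_apply]
  have : (zet x).re * (zet x).re + (zet x).im * (zet x).im = 1 - x 2 ^ 2 := by simp [zet]; linarith
  rw [this]; push_cast; ring

lemma SRep_mono (i j k : ℕ) : SRep (fun x => zet x ^ i * (starRingEnd ℂ) (zet x) ^ j * (x 2 : ℂ)^k) := by
  rcases le_total j i with h | h
  · obtain ⟨d, rfl⟩ := Nat.exists_eq_add_of_le h
    refine (SRep_poly d ((1 - Polynomial.X^2)^j * Polynomial.X^k)).congr (fun x hx => ?_)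
    have := zet_conj_one hx
    simp only [Polynomial.eval_mul, Polynomial.eval_pow, Polynomial.eval_sub, Polynomial.eval_one, Polynomial.eval_X]
    push_cast
    rw [← this]; ring
  · obtain ⟨d, rfl⟩ := Nat.exists_eq_add_of_le h
    refine (SRep_poly' d ((1 - Polynomial.X^2)^i * Polynomial.X^k)).congr (fun x hx => ?_)
    have := zet_conj_one hx
    simp only [Polynomial.eval_mul, Polynomial.eval_pow, Polynomial.eval_sub, Polynomial.eval_one, Polynomial.eval_X]
    push_cast
    rw [← this]; ring

abbrev S2 := Metric.sphere (0:E3) 1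

lemma zet_continuous : Continuous zet := by unfold zet; fun_prop

def zK : C(S2, ℂ) := ⟨fun x => ((x.1 2 : ℝ) : ℂ), by fun_prop⟩
def zeK : C(S2, ℂ) := ⟨fun x => zet x.1, by have := zet_continuous; fun_prop⟩

lemma sphere_dense {w : E3 → ℂ} (hw : ContinuousOn w closedExt) {ε : ℝ} (hε : 0 < ε) :
    ∃ a, FinArr a ∧ ∀ x, ‖x‖ = 1 → ‖w x - Sol a x‖ ≤ ε := by
  set A : StarSubalgebra ℂ C(S2, ℂ) := StarAlgebra.adjoin ℂ {zK, zeK} with hA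
  have hz : zK ∈ A := StarAlgebra.subset_adjoin ℂ _ (by simp)
  have hze : zeK ∈ A := StarAlgebra.subset_adjoin ℂ _ (by simp)
  have hsep : A.SeparatesPoints := by
    intro x y hxy
    by_contra hno
    push Not at hno
    apply hxy
    have h1 : zK x = zK y := hno _ ⟨zK, hz, rfl⟩
    have h2 : zeK x = zeK y := hno _ ⟨zeK, hze, rfl⟩
    have h1' : x.1 2 = y.1 2 := by exact_mod_cast (show ((x.1 2 : ℝ) : ℂ) = ((y.1 2 : ℝ) : ℂ) from h1)
    have h2' : zet x.1 = zet y.1 := h2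
    have h3 := congrArg Complex.re h2'
    have h4 := congrArg Complex.im h2'
    simp [zet] at h3 h4
    apply Subtype.ext
    ext i
    fin_cases i
    · exact h3
    · exact h4
    · exact h1'
  have htop := ContinuousMap.starSubalgebra_topologicalClosure_eq_top_of_separatesPoints A hsep
  let W : C(S2, ℂ) := ⟨fun x => w x.1, by
    refine hw.comp_continuous continuous_subtype_val (fun x => ?_)
    have : ‖x.1‖ = 1 := by simpa using x.2
    exact this.ge⟩
  have hW : W ∈ closure (A : Set C(S2, ℂ)) := by
    have : W ∈ A.topologicalClosure := by rw [htop]; trivial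
    exact this
  obtain ⟨g, hg, hdist⟩ := Metric.mem_closure_iff.1 hW ε hε
  have hrep : ∃ a, FinArr a ∧ ∀ x : S2, g x = Sol a x.1 := by
    have hg2 : g ∈ Submodule.span ℂ ((Submonoid.closure ({zK, zeK} ∪ star {zK, zeK}) : Submonoid C(S2, ℂ)) : Set C(S2, ℂ)) := by
      rw [← Algebra.adjoin_eq_span, ← StarAlgebra.adjoin_toSubalgebra]
      exact hg
    have hmono : ∀ f ∈ Submonoid.closure ({zK, zeK} ∪ star {zK, zeK} : Set C(S2, ℂ)),
        ∃ i j k : ℕ, ∀ x : S2, f x = zet x.1 ^ i * (starRingEnd ℂ) (zet x.1) ^ j * (x.1 2 : ℂ)^k := by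
      intro f hf
      induction hf using Submonoid.closure_induction with
      | mem f hf =>
        rcases hf with hf | hf
        · rcases hf with rfl | hf
          · exact ⟨0, 0, 1, fun x => by simp [zK]⟩
          · rw [Set.mem_singleton_iff] at hf; subst hf
            exact ⟨1, 0, 0, fun x => by simp [zeK]⟩
        · rw [Set.mem_star] at hf
          rcases hf with hf | hf
          · rw [← star_eq_iff_star_eq] at hf
            subst hf
            exact ⟨0, 0, 1, fun x => by simp [zK]⟩
          · rw [Set.mem_singleton_iff, ← star_eq_iff_star_eq] at hf; subst hf
            exact ⟨0, 1, 0, fun x => by simp [zeK]⟩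
      | one => exact ⟨0, 0, 0, fun x => by simp⟩
      | mul f g _ _ hf hg =>
        obtain ⟨i, j, k, h⟩ := hf
        obtain ⟨i', j', k', h'⟩ := hg
        refine ⟨i+i', j+j', k+k', fun x => ?_⟩
        rw [ContinuousMap.mul_apply, h, h']; ring
    have : ∃ G : E3 → ℂ, SRep G ∧ ∀ x : S2, g x = G x.1 := by
      refine Submodule.span_induction (p := fun g _ => ∃ G : E3 → ℂ, SRep G ∧ ∀ x : S2, g x = G x.1) ?_ ?_ ?_ ?_ hg2
      · intro f hf
        obtain ⟨i, j, k, h⟩ := hmono f hf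
        exact ⟨_, SRep_mono i j k, h⟩
      · exact ⟨_, SRep_zero, fun x => rfl⟩
      · rintro f g _ _ ⟨F, hF, hF'⟩ ⟨G, hG, hG'⟩
        exact ⟨_, hF.add hG, fun x => by rw [ContinuousMap.add_apply, hF', hG']⟩
      · rintro c f _ ⟨F, hF, hF'⟩
        exact ⟨_, hF.smul c, fun x => by rw [ContinuousMap.smul_apply, hF', smul_eq_mul]⟩
    obtain ⟨G, ⟨a, ha, ha'⟩, hG⟩ := this
    refine ⟨a, ha, fun x => ?_⟩
    rw [hG, ha' x.1 (by simpa using x.2)]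
  obtain ⟨a, ha, hga⟩ := hrep
  refine ⟨a, ha, fun x hx => ?_⟩
  have h1 := (ContinuousMap.dist_lt_iff hε).1 hdist ⟨x, by simpa using hx⟩
  rw [hga, dist_eq_norm] at h1
  exact h1.le

structure HarmExt (w : E3 → ℂ) : Prop where
  c : ContinuousOn w closedExt
  c2 : ContDiffOn ℝ 2 w extDomain
  l : ∀ x ∈ extDomain, lap w x = 0
  d : Tendsto w (Bornology.cobounded E3) (nhds 0)

lemma lap_sub {u w : E3 → ℂ} (hu : ContDiffOn ℝ 2 u extDomain) (hw : ContDiffOn ℝ 2 w extDomain) {x : E3} (hx : x ∈ extDomain) :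
    lap (fun y => u y - w y) x = lap u x - lap w x := by
  have hu2 := hu.contDiffAt (extDomain_isOpen.mem_nhds hx)
  have hw2 := hw.contDiffAt (extDomain_isOpen.mem_nhds hx)
  have du : DifferentiableAt ℝ (fderiv ℝ u) x :=
    (hu2.fderiv_right (m := 1) (by norm_num)).differentiableAt (by simp)
  have dw : DifferentiableAt ℝ (fderiv ℝ w) x :=
    (hw2.fderiv_right (m := 1) (by norm_num)).differentiableAt (by simp)
  unfold lap
  rw [← Finset.sum_sub_distrib]
  apply Finset.sum_congr rfl
  intro i _
  set e : E3 := EuclideanSpace.single i 1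
  have he : (fun y => fderiv ℝ (fun y => u y - w y) y e) =ᶠ[nhds x] fun y => fderiv ℝ u y e - fderiv ℝ w y e := by
    filter_upwards [extDomain_isOpen.mem_nhds hx] with y hy
    have h1 := (hu.contDiffAt (extDomain_isOpen.mem_nhds hy)).differentiableAt (by simp)
    have h2 := (hw.contDiffAt (extDomain_isOpen.mem_nhds hy)).differentiableAt (by simp)
    have h3 : HasFDerivAt (fun y => u y - w y) (fderiv ℝ u y - fderiv ℝ w y) y := h1.hasFDerivAt.sub h2.hasFDerivAt
    rw [h3.fderiv]; rfl
  rw [he.fderiv_eq]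
  have h1 := (du.clm_apply (differentiableAt_const e)).hasFDerivAt
  have h2 := (dw.clm_apply (differentiableAt_const e)).hasFDerivAt
  have h3 : HasFDerivAt (fun y => fderiv ℝ u y e - fderiv ℝ w y e) _ x := h1.sub h2
  rw [h3.fderiv]; rfl

lemma HarmExt.sub {u w : E3 → ℂ} (hu : HarmExt u) (hw : HarmExt w) : HarmExt (fun x => u x - w x) :=
  ⟨hu.c.sub hw.c, hu.c2.sub hw.c2, fun x hx => by rw [lap_sub hu.c2 hw.c2 hx, hu.l x hx, hw.l x hx, sub_zero],
    by simpa using hu.d.sub hw.d⟩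

lemma HarmExt_Sol {a : Arr} (h : Adm 0 1 a) : HarmExt (Sol a) :=
  ⟨h.contOn le_rfl, (good_of_adm h).contDiffOn 2, fun x hx => (good_of_adm h).lap_zero hx, Sol_decay h⟩

lemma ext_sph_continuous {w : E3 → ℂ} (hw : ContinuousOn w closedExt) {r : ℝ} (hr : 1 ≤ r) :
    Continuous (fun q : ℝ × ℝ => w (r • sphCoord q.1 q.2)) := by
  refine hw.comp_continuous (sph_continuous.const_smul r) (fun q => ?_)
  show 1 ≤ ‖_‖
  rw [norm_smul, norm_sph]; simp; exact hr.trans (le_abs_self r)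

/-- Coefficients of an exterior harmonic function at radius `r`. -/
lemma HarmExt.coeff {w : E3 → ℂ} (hw : HarmExt w) {r : ℝ} (hr : 1 ≤ r) (l : ℕ) (m : ℤ) :
    flCoeff (fun θ φ => w (r • sphCoord θ φ)) l m =
      ((r⁻¹ : ℝ) : ℂ)^(l+1) * flCoeff (fun θ φ => w (sphCoord θ φ)) l m := by
  by_cases hm : l < m.natAbs
  · rw [flCoeff_of_lt _ hm, flCoeff_of_lt _ hm, mul_zero]
  push Not at hm
  have hr0 : 0 < r := by linarith
  have hri : ‖((r⁻¹ : ℝ) : ℂ)^(l+1)‖ ≤ 1 := by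
    rw [norm_pow, Complex.norm_real, Real.norm_of_nonneg (by positivity)]
    exact pow_le_one₀ (by positivity) (inv_le_one_of_one_le₀ hr)
  have h1 : ∀ (x : E3), w x = w ((1:ℝ) • x) := fun x => by rw [one_smul]
  have key : ∀ ε > 0, ‖flCoeff (fun θ φ => w (r • sphCoord θ φ)) l m -
      ((r⁻¹ : ℝ) : ℂ)^(l+1) * flCoeff (fun θ φ => w (sphCoord θ φ)) l m‖ ≤ ε * (2 * (Real.sqrt (l+1) * KY)) := by
    intro ε hε
    obtain ⟨a, ha, hab⟩ := sphere_dense hw.c hε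
    have hA := ha.adm 0 1
    have hd := hw.sub (HarmExt_Sol hA)
    have hmax := max_principle hd.c hd.c2 hd.l hd.d hε.le hab
    have hb : ∀ r' : ℝ, 1 ≤ r' → ‖flCoeff (fun θ φ => w (r' • sphCoord θ φ)) l m - ((r'⁻¹ : ℝ) : ℂ)^(l+1) * a l m‖
        ≤ ε * Real.sqrt (l+1) * KY := by
      intro r' hr'
      rw [← flCoeff_Sol hA hr' l m hm, ← flCoeff_sub (ext_sph_continuous hw.c hr') (ext_sph_continuous (hA.contOn le_rfl) hr')]
      apply norm_flCoeff_le
      intro θ φ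
      apply hmax
      show 1 ≤ ‖_‖
      rw [norm_smul, norm_sph]; simp; exact hr'.trans (le_abs_self r')
    have hb1 := hb r hr
    have hb2 := hb 1 le_rfl
    simp only [one_smul, inv_one, Complex.ofReal_one, one_pow, one_mul] at hb2
    have e : flCoeff (fun θ φ => w (r • sphCoord θ φ)) l m - ((r⁻¹ : ℝ) : ℂ)^(l+1) * flCoeff (fun θ φ => w (sphCoord θ φ)) l m
      = (flCoeff (fun θ φ => w (r • sphCoord θ φ)) l m - ((r⁻¹ : ℝ) : ℂ)^(l+1) * a l m) -
        ((r⁻¹ : ℝ) : ℂ)^(l+1) * (flCoeff (fun θ φ => w (sphCoord θ φ)) l m - a l m) := by ring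
    rw [e]
    refine (norm_sub_le _ _).trans ?_
    rw [norm_mul]
    have := mul_le_of_le_one_left (norm_nonneg (flCoeff (fun θ φ => w (sphCoord θ φ)) l m - a l m)) hri
    linarith
  rw [← sub_eq_zero, ← norm_le_zero_iff]
  apply le_of_forall_pos_le_add
  intro δ hδ
  set K := 2 * (Real.sqrt (l+1) * KY) with hK
  have hK0 : 0 ≤ K := by
    have := (norm_nonneg _).trans (key 1 one_pos)
    linarith
  have := key (δ / (K + 1)) (by positivity)
  refine this.trans ?_
  rw [zero_add, div_mul_eq_mul_div, div_le_iff₀ (by positivity)]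
  nlinarith

end Part13

section Part14

open MeasureTheory Real Filter
set_option linter.all false

lemma betaLM_sq (l : ℕ) (m : ℤ) (h : m.natAbs ≤ l + 1) : betaLM (l+1) m ^ 2 =
    ((l:ℝ) + 1 - m.natAbs) * ((l:ℝ) + 1 + m.natAbs) / ((2 * l + 1) * (2 * l + 3)) := by
  have h' : (m.natAbs : ℝ) ≤ l + 1 := by exact_mod_cast h
  rw [betaLM, Real.sq_sqrt]
  · push_cast; ring
  · push_cast
    apply div_nonneg
    · apply mul_nonneg <;> [linarith; positivity]
    · apply mul_nonneg
      · have : (0:ℝ) ≤ l := by positivity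
        linarith
      · positivity

lemma betaLM_nonneg (l : ℕ) (m : ℤ) : 0 ≤ betaLM l m := Real.sqrt_nonneg _

lemma betaLM_self (m : ℤ) : betaLM m.natAbs m = 0 := by simp [betaLM]

lemma betaLM_pos (l : ℕ) (m : ℤ) (h : m.natAbs ≤ l) : 0 < betaLM (l+1) m := by
  have h' : (m.natAbs : ℝ) ≤ l := by exact_mod_cast h
  have h1 := betaLM_sq l m (by omega)
  have h2 : 0 < betaLM (l+1) m ^ 2 := by
    rw [h1]
    apply div_pos
    · apply mul_pos
      · linarith
      · positivity
    · positivity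
  exact lt_of_le_of_ne (betaLM_nonneg _ _) (fun h => by rw [← h] at h2; simp at h2)

lemma beta_NN1 (l : ℕ) (m : ℤ) (h : m.natAbs ≤ l) :
    betaLM (l+1) m * NN (l+1) m.natAbs * (2*l+1) = ((l:ℝ) + 1 - m.natAbs) * NN l m.natAbs := by
  have h' : (m.natAbs : ℝ) ≤ l := by exact_mod_cast h
  have hb := betaLM_sq l m (by omega)
  set M := m.natAbs with hM
  obtain ⟨k, rfl⟩ := Nat.exists_eq_add_of_le h
  have n1 := NN_sq (M+k+1) M
  have n2 := NN_sq (M+k) M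
  have e1 : M + k + 1 - M = k + 1 := by omega
  have e2 : M + k - M = k := by omega
  have e3 : M + k + 1 + M = (M + k + M) + 1 := by omega
  rw [e1, e3, Nat.factorial_succ, Nat.factorial_succ] at n1
  rw [e2] at n2
  refine (pow_left_inj₀ (n := 2) ?_ ?_ (by norm_num)).1 ?_
  · have := betaLM_nonneg (M+k+1) m; have := NN_pos (M+k+1) M; positivity
  · have := NN_pos (M+k) M; push_cast; apply mul_nonneg _ this.le; push_cast at h'; linarith
  · rw [mul_pow, mul_pow, mul_pow, hb, sq (NN _ _), sq (NN _ _), n1, n2]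
    push_cast
    field_simp
    ring

lemma beta_NN2 (l : ℕ) (m : ℤ) (h : m.natAbs ≤ l) :
    betaLM (l+1) m * NN l m.natAbs * (2*l+3) = ((l:ℝ) + 1 + m.natAbs) * NN (l+1) m.natAbs := by
  have h1 := beta_NN1 l m h
  have hb := betaLM_sq l m (by omega)
  have hbp := betaLM_pos l m h
  have h' : (m.natAbs : ℝ) ≤ l := by exact_mod_cast h
  have hd : (l:ℝ) + 1 - m.natAbs ≠ 0 := by linarith
  have hx : NN l m.natAbs = betaLM (l+1) m * NN (l+1) m.natAbs * (2*l+1) / ((l:ℝ) + 1 - m.natAbs) := by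
    field_simp; linarith
  rw [hx]
  have : betaLM (l+1) m * (betaLM (l+1) m * NN (l+1) m.natAbs * (2*l+1) / ((l:ℝ) + 1 - m.natAbs)) * (2*l+3)
    = betaLM (l+1) m ^2 * (NN (l+1) m.natAbs * (2*l+1) / ((l:ℝ) + 1 - m.natAbs) * (2*l+3)) := by ring
  rw [this, hb]; field_simp

/-- three-term relation -/
lemma sin_yr (l : ℕ) (m : ℤ) (h : m.natAbs ≤ l) (θ : ℝ) : Real.sin θ * yr l m θ =
    betaLM (l+1) m * yr (l+1) m θ + betaLM l m * yr (l-1) m θ := by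
  have h3 := congrArg (Polynomial.eval (Real.sin θ)) (leg_three' m.natAbs l)
  simp only [Polynomial.eval_mul, Polynomial.eval_add, Polynomial.eval_sub, Polynomial.eval_one, Polynomial.eval_X,
    Polynomial.eval_natCast, Polynomial.eval_ofNat] at h3
  have b1 := beta_NN1 l m h
  have b2 : betaLM l m * NN (l-1) m.natAbs * (2*l+1) * (DP m.natAbs (l-1)).eval (Real.sin θ)
     = ((l:ℝ) + m.natAbs) * NN l m.natAbs * (DP m.natAbs (l-1)).eval (Real.sin θ) := by
    rcases Nat.eq_or_lt_of_le h with h | h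
    · rw [← h, betaLM_self]
      by_cases h0 : m.natAbs = 0
      · rw [h0]; simp
      · rw [DP_eq_zero (show m.natAbs - 1 < m.natAbs by omega)]; simp
    · obtain ⟨k, rfl⟩ : ∃ k, l = k + 1 := ⟨l - 1, by omega⟩
      have := beta_NN2 k m (by omega)
      simp only [Nat.add_sub_cancel]
      push_cast
      rw [← this]; ring
  have hl : (2 * (l:ℝ) + 1) ≠ 0 := by positivity
  apply mul_left_cancel₀ hl
  unfold yr
  linear_combination (sg m * Real.cos θ ^ m.natAbs * NN l m.natAbs) * h3 -
    sg m * Real.cos θ ^ m.natAbs * (DP m.natAbs (l+1)).eval (Real.sin θ) * b1 - sg m * Real.cos θ ^ m.natAbs * b2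

def yr' (l : ℕ) (m : ℤ) (θ : ℝ) : ℝ :=
  sg m * NN l m.natAbs * (m.natAbs * Real.cos θ ^ (m.natAbs - 1) * (-Real.sin θ) * (DP m.natAbs l).eval (Real.sin θ)
    + Real.cos θ ^ m.natAbs * ((DP (m.natAbs+1) l).eval (Real.sin θ) * Real.cos θ))

lemma yr_deriv (l : ℕ) (m : ℤ) (θ : ℝ) : HasDerivAt (yr l m) (yr' l m θ) θ := by
  have h1 := (Real.hasDerivAt_cos θ).pow m.natAbs
  have h2 := ((DP m.natAbs l).hasDerivAt (Real.sin θ)).comp θ (Real.hasDerivAt_sin θ)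
  have h3 := (h1.mul h2).const_mul (sg m * NN l m.natAbs)
  refine HasDerivAt.congr_deriv (f := yr l m) (h3.congr_of_eventuallyEq (Eventually.of_forall fun y => ?_)) ?_
  · simp [yr]; ring
  · simp only [yr', DP_succ, Pi.pow_apply, Function.comp]

lemma yr'_continuous (l : ℕ) (m : ℤ) : Continuous (yr' l m) := by
  unfold yr'; fun_prop

lemma cos_yr' (l : ℕ) (m : ℤ) (h : m.natAbs ≤ l) (θ : ℝ) : Real.cos θ * yr' l m θ =
    (l+1) * betaLM l m * yr (l-1) m θ - l * betaLM (l+1) m * yr (l+1) m θ := by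
  have h3 := congrArg (Polynomial.eval (Real.sin θ)) (leg_J3'' m.natAbs l)
  simp only [Polynomial.eval_mul, Polynomial.eval_add, Polynomial.eval_sub, Polynomial.eval_one, Polynomial.eval_X,
    Polynomial.eval_natCast, Polynomial.eval_ofNat, Polynomial.eval_pow] at h3
  have b1 := beta_NN1 l m h
  have hs := sin_yr l m h θ
  have hc : 1 - Real.sin θ ^ 2 = Real.cos θ ^ 2 := by rw [← Real.cos_sq']
  rw [hc] at h3
  have h4 : Real.cos θ * yr' l m θ = (l+1) * (Real.sin θ * yr l m θ) -
      ((l:ℝ) + 1 - m.natAbs) * NN l m.natAbs * sg m * Real.cos θ ^ m.natAbs * (DP m.natAbs (l+1)).eval (Real.sin θ) := by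
    have hp : (m.natAbs : ℝ) * (Real.cos θ * Real.cos θ ^ (m.natAbs - 1)) = m.natAbs * Real.cos θ ^ m.natAbs := by
      rcases Nat.eq_zero_or_pos m.natAbs with h | h
      · rw [h]; simp
      · rw [← pow_succ']; congr 2; omega
    unfold yr yr'
    linear_combination (sg m * NN l m.natAbs * Real.cos θ ^ m.natAbs) * h3 -
      sg m * NN l m.natAbs * Real.sin θ * (DP m.natAbs l).eval (Real.sin θ) * hp
  rw [h4, hs, ← b1]
  unfold yr
  ring

end Part14

section Part15

open MeasureTheory Real Filter
set_option linter.all false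

structure HarmC1 (w : E3 → ℂ) : Prop where
  h : HarmExt w
  c1 : ContDiffOn ℝ 1 w closedExt

def gradW (w : E3 → ℂ) (x : E3) : E3 →L[ℝ] ℂ := fderivWithin ℝ w closedExt x

lemma gradW_contOn {w : E3 → ℂ} (hw : ContDiffOn ℝ 1 w closedExt) : ContinuousOn (gradW w) closedExt :=
  hw.continuousOn_fderivWithin uniqueDiffOn_closedExt (by norm_num)

lemma gradW_has {w : E3 → ℂ} (hw : ContDiffOn ℝ 1 w closedExt) {x : E3} (hx : x ∈ closedExt) :
    HasFDerivWithinAt w (gradW w x) closedExt x :=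
  (hw.differentiableOn (by norm_num) x hx).hasFDerivWithinAt

lemma sph_mem (θ φ : ℝ) : sphCoord θ φ ∈ closedExt := (norm_sph θ φ).ge

lemma smul_sph_mem {r : ℝ} (hr : 1 ≤ r) (θ φ : ℝ) : r • sphCoord θ φ ∈ closedExt := by
  show 1 ≤ ‖_‖
  rw [norm_smul, norm_sph]; simp; exact hr.trans (le_abs_self r)

lemma radial_has {w : E3 → ℂ} (hw : ContDiffOn ℝ 1 w closedExt) {r : ℝ} (hr : 1 ≤ r) (θ φ : ℝ) :
    HasDerivWithinAt (fun t : ℝ => w (t • sphCoord θ φ)) (gradW w (r • sphCoord θ φ) (sphCoord θ φ)) (Set.Ici 1) r := by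
  have h1 : HasDerivWithinAt (fun t : ℝ => t • sphCoord θ φ) (sphCoord θ φ) (Set.Ici 1) r := by
    have := ((hasDerivAt_id r).smul_const (sphCoord θ φ)).hasDerivWithinAt (s := Set.Ici 1)
    simpa using this
  exact (gradW_has hw (smul_sph_mem hr θ φ)).comp_hasDerivWithinAt r h1 (fun t ht => smul_sph_mem ht θ φ)

lemma radialDeriv_eq {w : E3 → ℂ} (hw : ContDiffOn ℝ 1 w closedExt) (θ φ : ℝ) :
    radialDeriv w θ φ = gradW w (sphCoord θ φ) (sphCoord θ φ) := by
  have := (radial_has hw le_rfl θ φ).derivWithin (uniqueDiffWithinAt_Ici 1)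
  rw [one_smul] at this
  exact this

def sphT (θ φ : ℝ) : E3 :=
  (WithLp.equiv 2 (Fin 3 → ℝ)).symm ![-Real.sin θ * Real.cos φ, -Real.sin θ * Real.sin φ, Real.cos θ]

lemma sph_hasDeriv (θ φ : ℝ) : HasDerivAt (fun t => sphCoord t φ) (sphT θ φ) θ := by
  have h : HasDerivAt (fun t => ![Real.cos t * Real.cos φ, Real.cos t * Real.sin φ, Real.sin t])
      ![-Real.sin θ * Real.cos φ, -Real.sin θ * Real.sin φ, Real.cos θ] θ := by
    rw [hasDerivAt_pi]
    intro i
    fin_cases i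
    · exact (Real.hasDerivAt_cos θ).mul_const _
    · exact (Real.hasDerivAt_cos θ).mul_const _
    · exact Real.hasDerivAt_sin θ
  have := ((EuclideanSpace.equiv (Fin 3) ℝ).symm.toContinuousLinearMap).hasFDerivAt.comp_hasDerivAt θ h
  exact this

lemma sphT_continuous : Continuous (fun q : ℝ × ℝ => sphT q.1 q.2) := by
  have h : Continuous (fun q : ℝ × ℝ => ![-Real.sin q.1 * Real.cos q.2, -Real.sin q.1 * Real.sin q.2, Real.cos q.1]) := by
    apply continuous_pi
    intro i
    fin_cases i <;> simp <;> fun_prop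
  exact (EuclideanSpace.equiv (Fin 3) ℝ).symm.toContinuousLinearMap.continuous.comp h

lemma theta_has {w : E3 → ℂ} (hw : ContDiffOn ℝ 1 w closedExt) (θ φ : ℝ) :
    HasDerivAt (fun t : ℝ => w (sphCoord t φ)) (gradW w (sphCoord θ φ) (sphT θ φ)) θ := by
  rw [← hasDerivWithinAt_univ]
  exact (gradW_has hw (sph_mem θ φ)).comp_hasDerivWithinAt θ (sph_hasDeriv θ φ).hasDerivWithinAt (fun t ht => sph_mem t φ)

lemma thetaDeriv_eq {w : E3 → ℂ} (hw : ContDiffOn ℝ 1 w closedExt) (θ φ : ℝ) :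
    thetaDeriv w θ φ = gradW w (sphCoord θ φ) (sphT θ φ) := (theta_has hw θ φ).deriv

lemma gradW_sph_cont {w : E3 → ℂ} (hw : ContDiffOn ℝ 1 w closedExt) :
    Continuous (fun q : ℝ × ℝ => gradW w (sphCoord q.1 q.2)) :=
  (gradW_contOn hw).comp_continuous sph_continuous (fun q => sph_mem _ _)

lemma radial_cont {w : E3 → ℂ} (hw : ContDiffOn ℝ 1 w closedExt) :
    Continuous (fun q : ℝ × ℝ => radialDeriv w q.1 q.2) := by
  simp only [radialDeriv_eq hw]
  exact (gradW_sph_cont hw).clm_apply sph_continuous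

lemma theta_cont {w : E3 → ℂ} (hw : ContDiffOn ℝ 1 w closedExt) :
    Continuous (fun q : ℝ × ℝ => thetaDeriv w q.1 q.2) := by
  simp only [thetaDeriv_eq hw]
  exact (gradW_sph_cont hw).clm_apply sphT_continuous

/-- uniform first-order expansion in the radial direction -/
lemma radial_unif {w : E3 → ℂ} (hw : ContDiffOn ℝ 1 w closedExt) {ε : ℝ} (hε : 0 < ε) :
    ∃ δ > 0, ∀ r, 1 ≤ r → r < 1 + δ → ∀ θ φ,
      ‖w (r • sphCoord θ φ) - w (sphCoord θ φ) - ((r - 1 : ℝ) : ℂ) * radialDeriv w θ φ‖ ≤ ε * (r - 1) := by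
  have hK : IsCompact (closedExt ∩ Metric.closedBall (0:E3) 2) := by
    refine IsCompact.inter_left (isCompact_closedBall _ _) ?_
    exact isClosed_le continuous_const continuous_norm
  have hu := hK.uniformContinuousOn_of_continuous ((gradW_contOn hw).mono Set.inter_subset_left)
  rw [Metric.uniformContinuousOn_iff] at hu
  obtain ⟨δ, hδ, hu⟩ := hu ε hε
  refine ⟨min δ 1, lt_min hδ one_pos, fun r hr hr2 θ φ => ?_⟩
  have hr3 : r < 1 + δ := lt_of_lt_of_le hr2 (by linarith [min_le_left δ 1])
  have hr4 : r < 2 := lt_of_lt_of_le hr2 (by linarith [min_le_right δ 1])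
  set e := sphCoord θ φ with he
  have hen : ‖e‖ = 1 := norm_sph θ φ
  have hmem : ∀ t : ℝ, 1 ≤ t → t ≤ 2 → t • e ∈ closedExt ∩ Metric.closedBall (0:E3) 2 := by
    intro t h1 h2
    have hm := smul_sph_mem h1 θ φ
    rw [← he] at hm
    refine Set.mem_inter hm ?_
    rw [mem_closedBall_zero_iff, norm_smul, hen, mul_one, Real.norm_of_nonneg (by linarith)]
    exact h2
  have hmem1 : e ∈ closedExt ∩ Metric.closedBall (0:E3) 2 := by
    have := hmem 1 le_rfl (by norm_num)
    rwa [one_smul] at this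
  have hd : ∀ t ∈ Set.Icc 1 r, HasDerivWithinAt (fun t : ℝ => w (t • e) - ((t - 1 : ℝ) : ℂ) * radialDeriv w θ φ)
      (gradW w (t • e) e - radialDeriv w θ φ) (Set.Icc 1 r) t := by
    intro t ht
    have h1 := (radial_has hw ht.1 θ φ).mono (s := Set.Icc 1 r) Set.Icc_subset_Ici_self
    have h2 : HasDerivAt (fun t : ℝ => ((t - 1 : ℝ) : ℂ) * radialDeriv w θ φ) (radialDeriv w θ φ) t := by
      have := ((hasDerivAt_id t).sub_const 1).ofReal_comp.mul_const (radialDeriv w θ φ)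
      simpa using this
    exact h1.sub h2.hasDerivWithinAt
  have hb : ∀ t ∈ Set.Icc 1 r, ‖gradW w (t • e) e - radialDeriv w θ φ‖ ≤ ε := by
    intro t ht
    rw [radialDeriv_eq hw, ← he, ← ContinuousLinearMap.sub_apply]
    refine (ContinuousLinearMap.le_opNorm _ _).trans ?_
    rw [hen, mul_one, ← dist_eq_norm]
    refine (hu _ (hmem t ht.1 (by linarith [ht.2])) e hmem1 ?_).le
    rw [dist_eq_norm]
    have : t • e - e = (t - 1) • e := by rw [sub_smul, one_smul]
    rw [this, norm_smul, hen, mul_one, Real.norm_of_nonneg (by linarith [ht.1])]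
    linarith [ht.2]
  have := (convex_Icc 1 r).norm_image_sub_le_of_norm_hasDerivWithin_le hd hb (Set.left_mem_Icc.2 hr) (Set.right_mem_Icc.2 hr)
  rw [Real.norm_of_nonneg (by linarith : 0 ≤ r - 1)] at this
  refine le_trans (le_of_eq ?_) this
  congr 1
  simp
  ring

lemma flCoeff_radial {w : E3 → ℂ} (hw : HarmC1 w) (l : ℕ) (m : ℤ) :
    flCoeff (fun θ φ => radialDeriv w θ φ) l m = -((l:ℂ)+1) * flCoeff (fun θ φ => w (sphCoord θ φ)) l m := by
  set A := flCoeff (fun θ φ => radialDeriv w θ φ) l m with hA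
  set B := flCoeff (fun θ φ => w (sphCoord θ φ)) l m with hB
  -- derivative of `r⁻¹^(l+1) * B`
  have h1 : HasDerivWithinAt (fun r : ℝ => ((r⁻¹ : ℝ) : ℂ)^(l+1) * B) (-((l:ℂ)+1) * B) (Set.Ici 1) 1 := by
    have h := (((hasDerivAt_inv (one_ne_zero (α := ℝ))).ofReal_comp).pow (l+1)).mul_const B
    have h2 : HasDerivAt (fun r : ℝ => ((r⁻¹ : ℝ) : ℂ)^(l+1) * B) (-((l:ℂ)+1) * B) 1 := by
      refine HasDerivAt.congr_deriv (h.congr_of_eventuallyEq (Eventually.of_forall fun y => ?_)) ?_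
      · simp
      · simp
    exact h2.hasDerivWithinAt
  have h2 : HasDerivWithinAt (fun r : ℝ => ((r⁻¹ : ℝ) : ℂ)^(l+1) * B) A (Set.Ici 1) 1 := by
    rw [hasDerivWithinAt_iff_isLittleO, Asymptotics.isLittleO_iff]
    intro c hc
    have hK : 0 ≤ Real.sqrt (l+1) * KY := mul_nonneg (Real.sqrt_nonneg _) measureReal_nonneg
    set K := Real.sqrt (l+1) * KY with hKd
    obtain ⟨δ, hδ, hu⟩ := radial_unif hw.c1 (ε := c / (K+1)) (by positivity)
    have : ∀ᶠ r in nhdsWithin (1:ℝ) (Set.Ici 1), r < 1 + δ :=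
      nhdsWithin_le_nhds (Iio_mem_nhds (by linarith))
    filter_upwards [this, self_mem_nhdsWithin] with r hr hr1
    have hr1 : 1 ≤ r := hr1
    have hcr := ext_sph_continuous hw.h.c hr1
    have hc1 : Continuous (fun q : ℝ × ℝ => w (sphCoord q.1 q.2)) := by
      simpa using ext_sph_continuous hw.h.c le_rfl
    have hcd := radial_cont hw.c1
    have key := norm_flCoeff_le (ψ := fun θ φ => w (r • sphCoord θ φ) - w (sphCoord θ φ) - ((r - 1 : ℝ) : ℂ) * radialDeriv w θ φ)
      (hu r hr1 hr) l m
    rw [flCoeff_sub (hcr.sub hc1) (by fun_prop), flCoeff_sub hcr hc1, flCoeff_const_mul, hw.h.coeff hr1 l m, ← hA, ← hB] at key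
    rw [Real.norm_of_nonneg (by linarith : 0 ≤ r - 1)]
    have e : ((r⁻¹ : ℝ) : ℂ)^(l+1) * B - (((1:ℝ)⁻¹ : ℝ) : ℂ)^(l+1) * B - (r - 1) • A =
      ((r⁻¹ : ℝ) : ℂ)^(l+1) * B - B - ((r - 1 : ℝ) : ℂ) * A := by
      simp [Complex.real_smul]
    rw [e]
    refine key.trans ?_
    have : c / (K+1) * (r-1) * Real.sqrt (l+1) * KY = c * (r-1) * (K/(K+1)) := by rw [hKd]; ring
    rw [this]
    apply mul_le_of_le_one_right (mul_nonneg hc.le (by linarith))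
    rw [div_le_one (by positivity)]; linarith
  exact (uniqueDiffWithinAt_Ici 1).eq_deriv _ h2 h1

end Part15

section Part16

open MeasureTheory Real Filter
set_option linter.all false

lemma mode_hasDeriv {g g' : ℝ → ℝ → ℂ} (hg : Continuous (fun q : ℝ × ℝ => g q.1 q.2))
    (hg' : Continuous (fun q : ℝ × ℝ => g' q.1 q.2))
    (hd : ∀ θ φ, HasDerivAt (fun t => g t φ) (g' θ φ) θ) (m : ℤ) (θ : ℝ) :
    HasDerivAt (mode g m) (mode g' m θ) θ := by
  obtain ⟨B, hB⟩ := ((isCompact_Icc (a := θ - 1) (b := θ + 1)).prod (isCompact_Icc (a := -π) (b := π))).exists_bound_of_continuousOn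
    (hg'.continuousOn)
  have hc : ∀ (k : ℝ → ℝ → ℂ), Continuous (fun q : ℝ × ℝ => k q.1 q.2) → ∀ x, Continuous (fun φ : ℝ => k x φ * Complex.exp (-(Complex.I * m * φ))) := by
    intro k hk x
    have : Continuous (k x) := hk.comp (Continuous.prodMk_right x)
    fun_prop
  have := intervalIntegral.hasDerivAt_integral_of_dominated_loc_of_deriv_le (μ := volume) (a := -π) (b := π) (x₀ := θ)
    (F := fun x φ => g x φ * Complex.exp (-(Complex.I * m * φ)))
    (F' := fun x φ => g' x φ * Complex.exp (-(Complex.I * m * φ))) (bound := fun _ => B)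
    (s := Set.Icc (θ-1) (θ+1)) (Icc_mem_nhds (by linarith) (by linarith))
    (Eventually.of_forall fun x => (hc g hg x).aestronglyMeasurable)
    ((hc g hg θ).intervalIntegrable _ _)
    ((hc g' hg' θ).aestronglyMeasurable)
    (Eventually.of_forall fun t ht x hx => ?_) (by simp)
    (Eventually.of_forall fun t ht x hx => (hd x t).mul_const _)
  · exact this.2
  · rw [Set.uIoc_of_le (by linarith [Real.pi_pos])] at ht
    have h1 := hB (x, t) ⟨hx, ht.1.le, ht.2⟩
    have h2 : ‖Complex.exp (-(Complex.I * m * t))‖ = 1 := by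
      rw [show -(Complex.I * m * t) = ((-(m * t) : ℝ) : ℂ) * Complex.I by push_cast; ring]
      exact Complex.norm_exp_ofReal_mul_I _
    rw [norm_mul, h2, mul_one]; exact h1

lemma flCoeff_mode {g : ℝ → ℝ → ℂ} (hg : Continuous (fun q : ℝ × ℝ => g q.1 q.2)) (l : ℕ) (m : ℤ) :
    flCoeff g l m = ∫ θ in (-(π/2))..(π/2), mode g m θ * ((yr l m θ * Real.cos θ : ℝ) : ℂ) := flCoeff_cont hg l m

lemma mode_fun_mul (c : ℝ → ℝ) (g : ℝ → ℝ → ℂ) (m : ℤ) (θ : ℝ) :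
    mode (fun θ φ => (c θ : ℂ) * g θ φ) m θ = (c θ : ℂ) * mode g m θ := by
  unfold mode
  rw [← intervalIntegral.integral_const_mul]
  congr 1; ext φ; ring

lemma flCoeff_sin {g : ℝ → ℝ → ℂ} (hg : Continuous (fun q : ℝ × ℝ => g q.1 q.2)) (l : ℕ) (m : ℤ) (h : m.natAbs ≤ l) :
    flCoeff (fun θ φ => (Real.sin θ : ℂ) * g θ φ) l m =
      (betaLM (l+1) m : ℂ) * flCoeff g (l+1) m + (betaLM l m : ℂ) * flCoeff g (l-1) m := by
  have hm := mode_continuous hg m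
  have y1 := yr_continuous (l+1) m
  have y2 := yr_continuous (l-1) m
  rw [flCoeff_mode (by fun_prop), flCoeff_mode hg, flCoeff_mode hg, ← intervalIntegral.integral_const_mul, ← intervalIntegral.integral_const_mul,
    ← intervalIntegral.integral_add (Continuous.intervalIntegrable (by fun_prop) _ _) (Continuous.intervalIntegrable (by fun_prop) _ _)]
  apply intervalIntegral.integral_congr
  intro θ _
  dsimp only
  rw [mode_fun_mul]
  have e := congrArg (fun x : ℝ => (x:ℂ)) (sin_yr l m h θ)
  try dsimp only at e
  push_cast [-Complex.ofReal_sin, -Complex.ofReal_cos] at e ⊢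
  linear_combination mode g m θ * (Real.cos θ : ℂ) * e

lemma flCoeff_theta {g g' : ℝ → ℝ → ℂ} (hg : Continuous (fun q : ℝ × ℝ => g q.1 q.2))
    (hg' : Continuous (fun q : ℝ × ℝ => g' q.1 q.2))
    (hd : ∀ θ φ, HasDerivAt (fun t => g t φ) (g' θ φ) θ) (l : ℕ) (m : ℤ) (h : m.natAbs ≤ l) :
    flCoeff (fun θ φ => (Real.cos θ : ℂ) * g' θ φ) l m =
      ((l:ℂ)+2) * (betaLM (l+1) m : ℂ) * flCoeff g (l+1) m - ((l:ℂ) - 1) * (betaLM l m : ℂ) * flCoeff g (l-1) m := by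
  have hm := mode_continuous hg m
  have hm' := mode_continuous hg' m
  have y0 := yr_continuous l m
  have y0' := yr'_continuous l m
  have y1 := yr_continuous (l+1) m
  have y2 := yr_continuous (l-1) m
  have hV : ∀ θ, HasDerivAt (fun θ => ((Real.cos θ ^ 2 * yr l m θ : ℝ) : ℂ))
      (((Real.cos θ * (-2 * Real.sin θ * yr l m θ + Real.cos θ * yr' l m θ) : ℝ)) : ℂ) θ := by
    intro θ
    have h1 := ((Real.hasDerivAt_cos θ).pow 2).mul (yr_deriv l m θ)
    have h2 := h1.congr_deriv (g' := Real.cos θ * (-2 * Real.sin θ * yr l m θ + Real.cos θ * yr' l m θ)) (by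
      simp; ring)
    exact h2.ofReal_comp
  have hV' : Continuous (fun θ => (((Real.cos θ * (-2 * Real.sin θ * yr l m θ + Real.cos θ * yr' l m θ) : ℝ)) : ℂ)) := by fun_prop
  have ibp := intervalIntegral.integral_deriv_mul_eq_sub (a := -(π/2)) (b := π/2) (fun θ _ => mode_hasDeriv hg hg' hd m θ) (fun θ _ => hV θ)
    (hm'.intervalIntegrable _ _) (hV'.intervalIntegrable _ _)
  simp only [Real.cos_neg, Real.cos_pi_div_two] at ibp
  norm_num at ibp
  rw [flCoeff_mode (by fun_prop), flCoeff_mode hg, flCoeff_mode hg, ← intervalIntegral.integral_const_mul, ← intervalIntegral.integral_const_mul,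
    ← intervalIntegral.integral_sub (Continuous.intervalIntegrable (by fun_prop) _ _) (Continuous.intervalIntegrable (by fun_prop) _ _),
    ← sub_eq_zero,
    ← intervalIntegral.integral_sub (Continuous.intervalIntegrable (by simp only [mode_fun_mul]; fun_prop) _ _) (Continuous.intervalIntegrable (by fun_prop) _ _)]
  rw [← ibp]
  apply intervalIntegral.integral_congr
  intro θ _
  dsimp only
  rw [mode_fun_mul]
  have e := congrArg (fun x : ℝ => (x:ℂ)) (sin_yr l m h θ)
  have e2 := congrArg (fun x : ℝ => (x:ℂ)) (cos_yr' l m h θ)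
  try dsimp only at e e2
  push_cast at e e2 ⊢
  linear_combination 2 * mode g m θ * (Complex.cos θ : ℂ) * e - mode g m θ * (Complex.cos θ : ℂ) * e2

def obl (w : E3 → ℂ) (θ φ : ℝ) : ℂ :=
  -2 * (Real.sin θ : ℂ) * radialDeriv w θ φ + (Real.cos θ : ℂ) * thetaDeriv w θ φ

lemma obl_continuous {w : E3 → ℂ} (hw : HarmC1 w) : Continuous (fun q : ℝ × ℝ => obl w q.1 q.2) := by
  have := radial_cont hw.c1
  have := theta_cont hw.c1
  unfold obl; fun_prop

lemma HarmC1.trace_cont {w : E3 → ℂ} (hw : HarmC1 w) : Continuous (fun q : ℝ × ℝ => traceC w q.1 q.2) := by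
  unfold traceC
  simpa using ext_sph_continuous hw.h.c le_rfl

lemma flCoeff_obl {w : E3 → ℂ} (hw : HarmC1 w) (l : ℕ) (m : ℤ) (h : m.natAbs ≤ l) :
    flCoeff (obl w) l m = ((l:ℂ)+1) * (betaLM l m : ℂ) * flCoeff (traceC w) (l-1) m +
      3 * ((l:ℂ)+2) * (betaLM (l+1) m : ℂ) * flCoeff (traceC w) (l+1) m := by
  have hr := radial_cont hw.c1
  have ht := theta_cont hw.c1
  have e : obl w = fun θ φ => (-2 : ℂ) * ((Real.sin θ : ℂ) * radialDeriv w θ φ) + (Real.cos θ : ℂ) * thetaDeriv w θ φ := by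
    ext θ φ; unfold obl; ring
  rw [e, flCoeff_add (by fun_prop) (by fun_prop), flCoeff_const_mul, flCoeff_sin hr l m h,
    flCoeff_theta hw.trace_cont ht (fun θ φ => ?_) l m h]
  · have r1 := flCoeff_radial hw (l+1) m
    have r2 := flCoeff_radial hw (l-1) m
    rw [r1, r2]
    change -2 * (_ * (_ * flCoeff (traceC w) _ _) + _ * (_ * flCoeff (traceC w) _ _)) + _ = _
    rcases Nat.eq_zero_or_pos l with h0 | h0
    · subst h0
      have : betaLM 0 m = 0 := by
        have : m.natAbs = 0 := by omega
        have h2 := betaLM_self m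
        rwa [this] at h2
      rw [this]; push_cast; ring
    · obtain ⟨k, rfl⟩ : ∃ k, l = k + 1 := ⟨l-1, by omega⟩
      push_cast
      try simp only [Nat.add_sub_cancel]
      ring
  · have := theta_has hw.c1 θ φ
    rw [← thetaDeriv_eq hw.c1] at this
    exact this

end Part16

section Part17

open MeasureTheory Real Filter
set_option linter.all false

lemma beta_ratio (l : ℕ) (m : ℤ) (h : m.natAbs ≤ l) : betaLM l m ^ 2 ≤ 5 / 4 * betaLM (l+1) m ^ 2 := by
  rcases Nat.eq_or_lt_of_le h with h | h
  · rw [← h, betaLM_self, zero_pow two_ne_zero]; positivity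
  · obtain ⟨n, rfl⟩ : ∃ n, l = n + 1 := ⟨l-1, by omega⟩
    rw [betaLM_sq n m (by omega), betaLM_sq (n+1) m (by omega)]
    have hM : (m.natAbs : ℝ) ≤ n := by exact_mod_cast (by omega : m.natAbs ≤ n)
    have hM0 : (0:ℝ) ≤ m.natAbs := by positivity
    have hn : (0:ℝ) ≤ n := by positivity
    set M : ℝ := (m.natAbs : ℝ) with hMd
    push_cast
    rw [← mul_div_assoc, div_le_div_iff₀ (by positivity) (by positivity)]
    have hx : 0 ≤ ((n:ℝ)+1)^2 - M^2 := by nlinarith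
    have key : 0 ≤ 5 * (((n:ℝ)+2)^2 - M^2) * (2*n+1) - 4 * (((n:ℝ)+1)^2 - M^2) * (2*n+5) := by
      have h1 : 0 ≤ ((n:ℝ)+1)^2 * (5 * (((n:ℝ)+2)^2 - M^2) * (2*n+1) - 4 * (((n:ℝ)+1)^2 - M^2) * (2*n+5)) := by
        have : ((n:ℝ)+1)^2 * (5 * (((n:ℝ)+2)^2 - M^2) * (2*n+1) - 4 * (((n:ℝ)+1)^2 - M^2) * (2*n+5)) =
          (((n:ℝ)+1)^2 - M^2) * (n * (2 * n^2 + 9 * n + 12)) + M^2 * (5 * (2*n+3)*(2*n+1)) := by ring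
        rw [this]; positivity
      exact nonneg_of_mul_nonneg_right h1 (by positivity)
    have h2 := mul_nonneg key (by positivity : (0:ℝ) ≤ (2 * n + 3)/4)
    nlinarith [h2]

lemma gamma_sq_le (l : ℕ) (m : ℤ) (h : m.natAbs ≤ l) : gammaLM l m ^ 2 ≤ 5 / 36 := by
  have hb := betaLM_pos l m h
  have hr := beta_ratio l m h
  unfold gammaLM
  rw [div_pow, div_le_iff₀ (by positivity)]
  have h1 : ((l:ℝ)+1)^2 ≤ ((l:ℝ)+2)^2 := by nlinarith [(Nat.cast_nonneg l : (0:ℝ) ≤ l)]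
  calc (-(((l:ℝ) + 1) * betaLM l m))^2 = ((l:ℝ)+1)^2 * betaLM l m ^ 2 := by ring
    _ ≤ ((l:ℝ)+2)^2 * (5/4 * betaLM (l+1) m ^ 2) := by gcongr
    _ = _ := by ring

lemma gamma_rel (l : ℕ) (m : ℤ) (h : m.natAbs ≤ l) :
    3 * ((l:ℝ)+2) * betaLM (l+1) m * gammaLM l m = - (((l:ℝ)+1) * betaLM l m) := by
  have hb := betaLM_pos l m h
  unfold gammaLM; field_simp

/-- equatorial values -/
def Eq0 (m : ℤ) (k : ℕ) : ℝ := yr (m.natAbs + 2 * k) m 0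

lemma eq_step (l : ℕ) (m : ℤ) (h : m.natAbs ≤ l) :
    betaLM (l+1) m * yr (l+1) m 0 = - (betaLM l m * yr (l-1) m 0) := by
  have := sin_yr l m h 0
  simp at this
  linarith

lemma Eq0_succ (m : ℤ) (k : ℕ) : betaLM (m.natAbs + 2*k+1+1) m * Eq0 m (k+1) =
    - (betaLM (m.natAbs + 2*k+1) m * Eq0 m k) := by
  have := eq_step (m.natAbs + 2*k+1) m (by omega)
  exact this

lemma yr_odd (m : ℤ) (k : ℕ) : yr (m.natAbs + 2 * k + 1) m 0 = 0 := by
  induction k with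
  | zero =>
    have := eq_step m.natAbs m le_rfl
    rw [betaLM_self, zero_mul, neg_zero] at this
    exact (mul_eq_zero.1 this).resolve_left (betaLM_pos _ m le_rfl).ne'
  | succ k ih =>
    have := eq_step (m.natAbs + 2*k+2) m (by omega)
    rw [show m.natAbs + 2*k+2-1 = m.natAbs + 2*k+1 by omega, ih, mul_zero, neg_zero] at this
    exact (mul_eq_zero.1 this).resolve_left (betaLM_pos _ m (by omega)).ne'

lemma diag_sq (M : ℕ) : ((M:ℝ)+1) / (16 * π^2) ≤ ((NN M M * (DP M M).eval 0)^2)^2 := by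
  induction M with
  | zero =>
    have h := NN_sq 0 0
    have : DP 0 0 = 1 := by rw [DP_zero]; simp [legendreP]
    rw [this]
    simp at h ⊢
    rw [sq (NN 0 0), h]
    apply le_of_eq
    have := Real.pi_pos.ne'
    field_simp
    norm_num
  | succ M ih =>
    have h1 := congrArg (Polynomial.eval 0) (leg_J2 M M)
    rw [DP_eq_zero (show M < M + 1 by omega)] at h1
    simp at h1
    rw [h1]
    have n1 := NN_sq (M+1) (M+1)
    have n0 := NN_sq M M
    have e : M + 1 + (M + 1) = (M + M) + 1 + 1 := by omega
    rw [e, Nat.factorial_succ, Nat.factorial_succ] at n1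
    simp only [Nat.sub_self] at n0 n1
    have hs : (NN (M+1) (M+1) * (((M:ℝ)+1+M) * (DP M M).eval 0))^2 = (NN M M * (DP M M).eval 0)^2 * ((2*M+3)/(2*M+2)) := by
      rw [mul_pow, mul_pow, mul_pow, sq (NN _ _), sq (NN _ _), n1, n0]
      push_cast
      field_simp
      ring
    rw [hs, mul_pow]
    have h3 : ((M:ℝ)+2)/(M+1) ≤ ((2*M+3)/(2*M+2))^2 := by
      rw [div_pow, div_le_div_iff₀ (by positivity) (by positivity)]
      nlinarith [(Nat.cast_nonneg M : (0:ℝ) ≤ M)]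
    calc (((M+1:ℕ):ℝ)+1)/(16 * π^2) = ((M:ℝ)+1)/(16*π^2) * (((M:ℝ)+2)/(M+1)) := by
          push_cast
          have := Real.pi_pos.ne'
          field_simp; ring
      _ ≤ _ := by gcongr

lemma Eq0_zero_sq (m : ℤ) : Eq0 m 0 ^ 2 = (NN m.natAbs m.natAbs * (DP m.natAbs m.natAbs).eval 0)^2 := by
  have := sg_sq m
  unfold Eq0 yr
  simp
  linear_combination (NN m.natAbs m.natAbs * (DP m.natAbs m.natAbs).eval 0)^2 * this

lemma Eq0_zero_lower (m : ℤ) : Real.sqrt (m.natAbs + 1) / (4 * π) ≤ Eq0 m 0 ^ 2 := by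
  refine (pow_le_pow_iff_left₀ (by have := Real.pi_pos; positivity) (sq_nonneg _) two_ne_zero).1 ?_
  rw [Eq0_zero_sq, div_pow, Real.sq_sqrt (by positivity)]
  have := diag_sq m.natAbs
  calc _ = _ := by ring
    _ ≤ _ := this

lemma Eq0_zero_ne (m : ℤ) : Eq0 m 0 ≠ 0 := by
  have := Eq0_zero_lower m
  intro h
  rw [h, zero_pow two_ne_zero] at this
  have h2 : 0 < Real.sqrt (m.natAbs + 1) / (4 * π) := by
    have := Real.pi_pos; positivity
  linarith

lemma Eq0_four (m : ℤ) (k : ℕ) : Eq0 m k ^ 4 ≤ Eq0 m 0 ^ 4 * (((2 * m.natAbs + 4 * k + 1 : ℝ) / (2 * m.natAbs + 1))^2 *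
    ((m.natAbs + 1) / ((k+1) * (m.natAbs + k + 1)))) := by
  induction k with
  | zero =>
    apply le_of_eq
    have : (2 * (m.natAbs : ℝ) + 1) ≠ 0 := by positivity
    have : ((m.natAbs : ℝ) + 1) ≠ 0 := by positivity
    simp
    field_simp
  | succ k ih =>
    have hs := Eq0_succ m k
    have b1 := betaLM_sq (m.natAbs + 2*k) m (by omega)
    have b2 := betaLM_sq (m.natAbs + 2*k+1) m (by omega)
    have hb2 := betaLM_pos (m.natAbs + 2*k+1) m (by omega)
    have h4 : Eq0 m (k+1) ^ 4 * (betaLM (m.natAbs + 2*k+1+1) m ^2)^2 = Eq0 m k ^ 4 * (betaLM (m.natAbs + 2*k+1) m^2)^2 := by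
      linear_combination ((betaLM (m.natAbs + 2*k+1+1) m * Eq0 m (k+1))^2 + (betaLM (m.natAbs + 2*k+1) m * Eq0 m k)^2) *
        ((betaLM (m.natAbs + 2*k+1+1) m * Eq0 m (k+1)) - (betaLM (m.natAbs + 2*k+1) m * Eq0 m k)) * hs
    rw [b1, b2] at h4
    set M : ℝ := (m.natAbs : ℝ) with hM
    have hM0 : 0 ≤ M := by positivity
    push_cast at h4 ⊢
    rw [← hM] at h4
    have hk : (0:ℝ) ≤ k := by positivity
    have e1 : (M + 2*k+1 - M) * (M+2*k+1+M) / ((2*(M+2*k)+1) * (2*(M+2*k)+3)) = (2*k+1)*(2*M+2*k+1)/ ((2*M+4*k+1)*(2*M+4*k+3)) := by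
      congr 1 <;> ring
    have e2 : (M + 2*k+1+1 - M) * (M+2*k+1+1+M) / ((2*(M+2*k+1)+1) * (2*(M+2*k+1)+3)) = (2*k+2)*(2*M+2*k+2)/ ((2*M+4*k+3)*(2*M+4*k+5)) := by
      congr 1 <;> ring
    rw [e1, e2] at h4
    have h5 : Eq0 m (k+1) ^ 4 = Eq0 m k ^ 4 * (((2*k+1)/(2*k+2))^2 * ((2*M+2*k+1)/(2*M+2*k+2))^2 * ((2*M+4*k+5)/(2*M+4*k+1))^2) := by
      have hpos : ((2*k+2)*(2*M+2*k+2)/ ((2*M+4*k+3)*(2*M+4*k+5)))^2 ≠ 0 := by positivity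
      rw [eq_div_of_mul_eq hpos h4]
      field_simp
    rw [h5]
    have w1 : ∀ x : ℝ, 0 ≤ x → ((2*x+1)/(2*x+2))^2 ≤ (x+1)/(x+2) := by
      intro x hx
      rw [div_pow, div_le_div_iff₀ (by positivity) (by positivity)]
      nlinarith
    have w2 := w1 k hk
    have w3 := w1 (M+k) (by positivity)
    have w3' : ((2*M+2*k+1)/(2*M+2*k+2))^2 ≤ (M+k+1)/(M+k+2) := by
      rw [show 2*M+2*k+1 = 2*(M+k)+1 by ring, show 2*M+2*k+2 = 2*(M+k)+2 by ring]; exact w3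
    calc _ ≤ (Eq0 m 0 ^ 4 * (((2 * M + 4 * k + 1 : ℝ) / (2 * M + 1))^2 *
    ((M + 1) / ((k+1) * (M + k + 1))))) * (((k:ℝ)+1)/(k+2) * ((M+k+1)/(M+k+2)) * ((2*M+4*k+5)/(2*M+4*k+1))^2) := by
            gcongr
      _ = _ := by
        field_simp
        ring

lemma Eq0_sq_bd (m : ℤ) (k : ℕ) : Eq0 m (k+1) ^ 2 ≤ Eq0 m 0 ^ 2 *
    (6 * Real.sqrt ((m.natAbs + k + 1) / ((k+1) * (m.natAbs + 1)))) := by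
  refine (pow_le_pow_iff_left₀ (sq_nonneg _) (by positivity) two_ne_zero).1 ?_
  have h := Eq0_four m (k+1)
  rw [mul_pow, mul_pow, Real.sq_sqrt (by positivity), ← pow_mul, ← pow_mul]
  refine h.trans ?_
  apply mul_le_mul_of_nonneg_left _ (by positivity)
  set M : ℝ := (m.natAbs : ℝ) with hM
  have hM0 : 0 ≤ M := by positivity
  have hk : (0:ℝ) ≤ k := by positivity
  push_cast
  have h1 : ((2 * M + 4 * (k+1) + 1) / (2 * M + 1))^2 ≤ (4 * (M+k+2)/(M+1))^2 := by
    gcongr <;> linarith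
  have h2 : (M+k+2)/(k+2) ≤ 2 * ((M+k+1)/(k+1)) := by
    rw [← mul_div_assoc, div_le_div_iff₀ (by positivity) (by positivity)]
    nlinarith [mul_nonneg hM0 hk]
  calc _ ≤ (4 * (M+k+2)/(M+1))^2 * ((M + 1) / ((k+1+1) * (M + (k + 1)+1))) := by gcongr
    _ = 16 / (M+1) * ((M+k+2)/(k+2)) := by
      rw [show (k:ℝ)+1+1 = k+2 by ring, show M + (k + 1)+1 = M+k+2 by ring]
      field_simp; ring
    _ ≤ 16 / (M+1) * (2 * ((M+k+1)/(k+1))) := by gcongr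
    _ = 32 * ((M+k+1)/((k+1)*(M+1))) := by field_simp; ring
    _ ≤ _ := by
      norm_num
      gcongr
      norm_num

end Part17

section Part18

open MeasureTheory Real Filter
set_option linter.all false

def aC (F : ℕ → ℂ) (m : ℤ) (l : ℕ) : ℂ := F l / ((6 * ((l:ℝ)+2) * betaLM (l+1) m : ℝ) : ℂ)

def uS (F : ℕ → ℂ) (m : ℤ) (t : ℂ) : ℕ → ℂ
  | 0 => t
  | 1 => aC F m m.natAbs
  | n+2 => ((gammaLM (m.natAbs + n + 1) m : ℝ) : ℂ) * uS F m t n + aC F m (m.natAbs + n + 1)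

lemma aC_mul (F : ℕ → ℂ) (m : ℤ) (l : ℕ) (h : m.natAbs ≤ l) :
    3 * ((l:ℂ)+2) * (betaLM (l+1) m : ℂ) * aC F m l = F l / 2 := by
  have hb : (betaLM (l+1) m : ℂ) ≠ 0 := by exact_mod_cast (betaLM_pos l m h).ne'
  have hl : ((l:ℂ)+2) ≠ 0 := by exact_mod_cast (by positivity : ((l:ℝ)+2) ≠ 0)
  unfold aC
  push_cast
  field_simp
  ring

lemma uS_rec_zero (F : ℕ → ℂ) (m : ℤ) (t : ℂ) :
    3 * ((m.natAbs:ℂ)+2) * (betaLM (m.natAbs+1) m : ℂ) * uS F m t 1 = F m.natAbs / 2 := aC_mul F m _ le_rfl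

lemma uS_rec (F : ℕ → ℂ) (m : ℤ) (t : ℂ) (n : ℕ) (l : ℕ) (hl : l = m.natAbs + n + 1) :
    ((l:ℂ)+1) * (betaLM l m : ℂ) * uS F m t n +
    3 * ((l:ℂ)+2) * (betaLM (l+1) m : ℂ) * uS F m t (n+2) = F l / 2 := by
  subst hl
  have h1 := aC_mul F m (m.natAbs + n + 1) (by omega)
  have h2 := congrArg (fun x : ℝ => (x:ℂ)) (gamma_rel (m.natAbs + n + 1) m (by omega))
  try dsimp only at h2
  rw [uS, ← h1]
  push_cast at h2 ⊢
  linear_combination uS F m t n * h2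

def cK (m : ℤ) (k : ℕ) : ℝ :=
  ((m.natAbs + 2*k+1 : ℕ) + 1 : ℝ) / (3 * ((m.natAbs + 2*k+1 : ℕ) + 2 : ℝ)) *
    (betaLM (m.natAbs + 2*k+1) m / betaLM (m.natAbs + 2*k+1+1) m)^2

lemma cK_nonneg (m : ℤ) (k : ℕ) : 0 ≤ cK m k := by unfold cK; positivity

lemma cK_le (m : ℤ) (k : ℕ) : cK m k ≤ 1/2 := by
  unfold cK
  have hb := betaLM_pos (m.natAbs + 2*k+1) m (by omega)
  have hr := beta_ratio (m.natAbs + 2*k+1) m (by omega)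
  set l := m.natAbs + 2*k+1
  have h1 : (betaLM l m / betaLM (l+1) m)^2 ≤ 5/4 := by
    rw [div_pow, div_le_iff₀ (by positivity)]; exact hr
  have h2 : ((l:ℝ)+1)/(3 * ((l:ℝ)+2)) ≤ 1/3 := by
    rw [div_le_div_iff₀ (by positivity) (by positivity)]; linarith
  calc _ ≤ (1/3 : ℝ) * (5/4) := by gcongr
    _ ≤ _ := by norm_num

lemma gamma_Eq0 (m : ℤ) (k : ℕ) : gammaLM (m.natAbs + 2*k+1) m * Eq0 m (k+1) = cK m k * Eq0 m k := by
  have hb := betaLM_pos (m.natAbs + 2*k+1) m (by omega)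
  have hs := Eq0_succ m k
  have : Eq0 m (k+1) = - (betaLM (m.natAbs + 2*k+1) m * Eq0 m k) / betaLM (m.natAbs + 2*k+1+1) m := by
    field_simp; linarith
  rw [this]
  unfold gammaLM cK
  field_simp

def PiK (m : ℤ) (k : ℕ) : ℝ := ∏ j ∈ Finset.range k, cK m j

lemma PiK_nonneg (m : ℤ) (k : ℕ) : 0 ≤ PiK m k := Finset.prod_nonneg fun _ _ => cK_nonneg _ _

lemma PiK_le (m : ℤ) (k : ℕ) : PiK m k ≤ (1/2)^k := by
  unfold PiK
  calc _ ≤ ∏ j ∈ Finset.range k, (1/2 : ℝ) := Finset.prod_le_prod (fun _ _ => cK_nonneg _ _) (fun _ _ => cK_le _ _)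
    _ = _ := by simp

lemma PiK_summable (m : ℤ) : Summable (PiK m) :=
  Summable.of_nonneg_of_le (PiK_nonneg m) (PiK_le m) (summable_geometric_of_lt_one (by norm_num) (by norm_num))

def SS (m : ℤ) : ℝ := ∑' k, PiK m k

lemma SS_ge (m : ℤ) : 1 ≤ SS m := by
  have := (PiK_summable m).le_tsum 0 (fun j _ => PiK_nonneg m j)
  have e: PiK m 0 = 1 := by simp [PiK]
  rw [e] at this; exact this

lemma geom_bd {T d : ℕ → ℂ} {c : ℕ → ℝ} (hT : ∀ k, T (k+1) = (c k : ℂ) * T k + d k) (hc0 : ∀ k, 0 ≤ c k) (hc : ∀ k, c k ≤ 1/2)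
    {D : ℝ} (hd : ∀ N, ∑ k ∈ Finset.range N, ‖d k‖ ≤ D) (N : ℕ) :
    ∑ k ∈ Finset.range N, ‖T k‖ ≤ 2 * (‖T 0‖ + D) := by
  have h1 : ∑ k ∈ Finset.range N, ‖T (k+1)‖ ≤ ∑ k ∈ Finset.range N, (1/2 * ‖T k‖ + ‖d k‖) := by
    apply Finset.sum_le_sum
    intro k _
    rw [hT]
    refine (norm_add_le _ _).trans ?_
    rw [norm_mul, Complex.norm_real, Real.norm_of_nonneg (hc0 k)]
    gcongr
    exact hc k
  rw [Finset.sum_add_distrib, ← Finset.mul_sum] at h1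
  have h2 := Finset.sum_range_succ' (fun k => ‖T k‖) N
  have h3 := Finset.sum_range_succ (fun k => ‖T k‖) N
  have := norm_nonneg (T N)
  have := hd N
  linarith

def TT (F : ℕ → ℂ) (m : ℤ) (t : ℂ) (k : ℕ) : ℂ := uS F m t (2*k) * (Eq0 m k : ℂ)
def dd (F : ℕ → ℂ) (m : ℤ) (k : ℕ) : ℂ := aC F m (m.natAbs + 2*k+1) * (Eq0 m (k+1) : ℂ)

lemma TT_succ (F : ℕ → ℂ) (m : ℤ) (t : ℂ) (k : ℕ) : TT F m t (k+1) = (cK m k : ℂ) * TT F m t k + dd F m k := by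
  have h := congrArg (fun x : ℝ => (x:ℂ)) (gamma_Eq0 m k)
  try dsimp only at h
  push_cast at h
  unfold TT dd
  rw [show 2 * (k+1) = 2*k+2 by ring, uS]
  linear_combination uS F m t (2*k) * h

lemma TT_zero (F : ℕ → ℂ) (m : ℤ) (t : ℂ) : TT F m t 0 = t * (Eq0 m 0 : ℂ) := by simp [TT, uS]

lemma TT_split (F : ℕ → ℂ) (m : ℤ) (t : ℂ) (k : ℕ) : TT F m t k = TT F m 0 k + t * (Eq0 m 0 : ℂ) * (PiK m k : ℂ) := by
  induction k with
  | zero => simp [TT_zero, PiK]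
  | succ k ih =>
    have hP : PiK m (k+1) = PiK m k * cK m k := Finset.prod_range_succ _ _
    rw [TT_succ, TT_succ, ih, hP]; push_cast; ring

def Yc : ℝ := ∑' k : ℕ, 1 / (((k:ℝ)+1) * Real.sqrt (k+1))

lemma Yc_summable : Summable fun k : ℕ => 1 / (((k:ℝ)+1) * Real.sqrt (k+1)) := by
  have h : Summable fun k : ℕ => 1 / (k:ℝ)^(3/2 : ℝ) := Real.summable_one_div_nat_rpow.2 (by norm_num)
  have h2 := (summable_nat_add_iff 1).2 h
  refine h2.congr (fun k => ?_)
  have hk : (0:ℝ) < (k:ℝ) + 1 := by positivity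
  push_cast
  rw [show (3/2 : ℝ) = 1 + 1/2 by norm_num, Real.rpow_add hk, Real.rpow_one, ← Real.sqrt_eq_rpow]

lemma Yc_nonneg : 0 ≤ Yc := tsum_nonneg fun k => by positivity

lemma norm_aC_sq (F : ℕ → ℂ) (m : ℤ) (l : ℕ) : ‖aC F m l‖^2 = ‖F l‖^2 / (36 * ((l:ℝ)+2)^2 * betaLM (l+1) m^2) := by
  unfold aC
  rw [norm_div, Complex.norm_real, div_pow, Real.norm_eq_abs, sq_abs]; ring_nf

lemma norm_aC_odd (F : ℕ → ℂ) (m : ℤ) (k : ℕ) : ‖aC F m (m.natAbs + 2*k+1)‖^2 ≤ ‖F (m.natAbs + 2*k+1)‖^2 /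
    (36 * ((k:ℝ)+1) * (m.natAbs + k + 1)) := by
  rw [norm_aC_sq]
  have hb := betaLM_sq (m.natAbs + 2*k+1) m (by omega)
  apply div_le_div_of_nonneg_left (by positivity) (by positivity) ?_
  rw [hb]
  set M : ℝ := (m.natAbs : ℝ) with hM
  have hM0 : 0 ≤ M := by positivity
  push_cast
  rw [← hM]
  rw [← mul_div_assoc, le_div_iff₀ (by positivity)]
  have h4 : (2 * (M + 2*k+1)+1) * (2 * (M+2*k+1)+3) ≤ 4 * (M+2*k+1+2)^2 := by nlinarith [(Nat.cast_nonneg k : (0:ℝ) ≤ k)]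
  have h5 : (0:ℝ) ≤ 36 * (k+1) * (M+k+1) := by positivity
  nlinarith [mul_le_mul_of_nonneg_left h4 h5]

lemma norm_dd_sq (F : ℕ → ℂ) (m : ℤ) (k : ℕ) : ‖dd F m k‖^2 ≤ Eq0 m 0 ^ 2 * ‖F (m.natAbs + 2*k+1)‖^2 /
    (6 * ((m.natAbs:ℝ)+1)) * (1 / (((k:ℝ)+1) * Real.sqrt (k+1))) := by
  unfold dd
  rw [norm_mul, mul_pow, Complex.norm_real, Real.norm_eq_abs, sq_abs]
  have h1 := norm_aC_odd F m k
  have h2 := Eq0_sq_bd m k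
  set M : ℝ := (m.natAbs : ℝ) with hM
  have hM0 : 0 ≤ M := by positivity
  refine (mul_le_mul h1 h2 (sq_nonneg _) (by positivity)).trans ?_
  rw [Real.sqrt_div (by positivity), Real.sqrt_mul (by positivity)]
  have hs1 : 0 < Real.sqrt (M+1) := Real.sqrt_pos.2 (by positivity)
  have hs2 : 0 < Real.sqrt ((k:ℝ)+1) := Real.sqrt_pos.2 (by positivity)
  have hs3 : 0 < Real.sqrt (M+k+1) := Real.sqrt_pos.2 (by positivity)
  have h13 : Real.sqrt (M+1) ≤ Real.sqrt (M+k+1) := Real.sqrt_le_sqrt (by linarith [(Nat.cast_nonneg k : (0:ℝ) ≤ k)])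
  have q1 : Real.sqrt (M+1) * Real.sqrt (M+1) = M+1 := Real.mul_self_sqrt (by positivity)
  have q3 : Real.sqrt (M+k+1) * Real.sqrt (M+k+1) = M+k+1 := Real.mul_self_sqrt (by positivity)
  set x := Real.sqrt (M+1)
  set y := Real.sqrt (M+k+1)
  set z := Real.sqrt ((k:ℝ)+1)
  rw [← q1, ← q3]
  have hk : (0:ℝ) < (k:ℝ)+1 := by positivity
  have e1 : ‖F (m.natAbs + 2*k+1)‖^2 / (36 * ((k:ℝ)+1) * (y*y)) * (Eq0 m 0 ^ 2 * (6 * (y / (z * x)))) =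
     Eq0 m 0 ^ 2 * ‖F (m.natAbs + 2*k+1)‖^2 / (6 * ((k:ℝ)+1) * z) * (1 / (x * y)) := by
    field_simp; ring
  have e2 : Eq0 m 0 ^ 2 * ‖F (m.natAbs + 2*k+1)‖^2 / (6 * (x * x)) * (1 / (((k:ℝ)+1) * z)) =
     Eq0 m 0 ^ 2 * ‖F (m.natAbs + 2*k+1)‖^2 / (6 * ((k:ℝ)+1) * z) * (1 / (x * x)) := by
    field_simp
  rw [e1, e2]
  gcongr

lemma dd_bd (F : ℕ → ℂ) (m : ℤ) {Q : ℝ} (hQ : ∀ N, ∑ k ∈ Finset.range N, ‖F (m.natAbs + 2*k+1)‖^2 ≤ Q) (N : ℕ) :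
    ∑ k ∈ Finset.range N, ‖dd F m k‖ ≤ Real.sqrt (Yc * (Eq0 m 0 ^ 2 / (6 * ((m.natAbs:ℝ)+1)) * Q)) := by
  apply Real.le_sqrt_of_sq_le
  have hy : ∀ k : ℕ, 0 < 1 / (((k:ℝ)+1) * Real.sqrt (k+1)) := fun k => by
    have : 0 < Real.sqrt ((k:ℝ)+1) := Real.sqrt_pos.2 (by positivity)
    positivity
  have h1 := Finset.sum_sq_le_sum_mul_sum_of_sq_eq_mul (Finset.range N) (r := fun k => ‖dd F m k‖)
    (f := fun k : ℕ => 1 / (((k:ℝ)+1) * Real.sqrt (k+1)))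
    (g := fun k : ℕ => ‖dd F m k‖^2 / (1 / (((k:ℝ)+1) * Real.sqrt (k+1))))
    (fun i _ => (hy i).le) (fun i _ => by have := hy i; positivity) (fun i _ => by have := (hy i).ne'; field_simp)
  refine h1.trans ?_
  have h2 : ∑ k ∈ Finset.range N, 1 / (((k:ℝ)+1) * Real.sqrt (k+1)) ≤ Yc := Yc_summable.sum_le_tsum _ (fun k _ => (hy k).le)
  have h3 : ∑ k ∈ Finset.range N, ‖dd F m k‖^2 / (1 / (((k:ℝ)+1) * Real.sqrt (k+1))) ≤ Eq0 m 0 ^ 2 / (6 * ((m.natAbs:ℝ)+1)) * Q := by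
    refine le_trans ?_ (mul_le_mul_of_nonneg_left (hQ N) (by positivity))
    rw [Finset.mul_sum]
    apply Finset.sum_le_sum
    intro k _
    rw [div_le_iff₀ (hy k)]
    have := norm_dd_sq F m k
    refine this.trans (le_of_eq ?_)
    ring
  exact mul_le_mul h2 h3 (Finset.sum_nonneg fun k _ => by have := hy k; positivity) Yc_nonneg

def tS (F : ℕ → ℂ) (m : ℤ) (h0 : ℂ) : ℂ := (h0 - ∑' k, TT F m 0 k) / ((Eq0 m 0 : ℂ) * (SS m : ℂ))

lemma TT0_summable (F : ℕ → ℂ) (m : ℤ) {Q : ℝ} (hQ : ∀ N, ∑ k ∈ Finset.range N, ‖F (m.natAbs + 2*k+1)‖^2 ≤ Q) :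
    Summable (fun k => ‖TT F m 0 k‖) ∧ ∑' k, ‖TT F m 0 k‖ ≤
      2 * Real.sqrt (Yc * (Eq0 m 0 ^ 2 / (6 * ((m.natAbs:ℝ)+1)) * Q)) := by
  have h := geom_bd (TT_succ F m 0) (cK_nonneg m) (cK_le m) (dd_bd F m hQ)
  rw [TT_zero] at h
  simp only [zero_mul, norm_zero, zero_add] at h
  exact ⟨summable_of_sum_range_le (fun _ => norm_nonneg _) h, Real.tsum_le_of_sum_range_le (fun _ => norm_nonneg _) h⟩

lemma tS_hasSum (F : ℕ → ℂ) (m : ℤ) (h0 : ℂ) {Q : ℝ} (hQ : ∀ N, ∑ k ∈ Finset.range N, ‖F (m.natAbs + 2*k+1)‖^2 ≤ Q) :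
    HasSum (TT F m (tS F m h0)) h0 := by
  have h1 := (TT0_summable F m hQ).1.of_norm.hasSum
  have h2 : HasSum (fun k => (PiK m k : ℂ)) (SS m : ℂ) := by exact_mod_cast (PiK_summable m).hasSum
  have h3 := h1.add (h2.mul_left (tS F m h0 * (Eq0 m 0 : ℂ)))
  have e : ∑' k, TT F m 0 k + tS F m h0 * (Eq0 m 0 : ℂ) * (SS m : ℂ) = h0 := by
    have hE : (Eq0 m 0 : ℂ) ≠ 0 := by exact_mod_cast Eq0_zero_ne m
    have hS : (SS m : ℂ) ≠ 0 := by exact_mod_cast (by linarith [SS_ge m] : SS m ≠ 0)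
    unfold tS; field_simp; ring
  rw [e] at h3
  rw [show TT F m (tS F m h0) = fun k => TT F m 0 k + tS F m h0 * (Eq0 m 0 : ℂ) * (PiK m k : ℂ) from funext (TT_split F m _)]
  exact h3

lemma tS_bd (F : ℕ → ℂ) (m : ℤ) (h0 : ℂ) {Q : ℝ} (hQ : ∀ N, ∑ k ∈ Finset.range N, ‖F (m.natAbs + 2*k+1)‖^2 ≤ Q) :
    ‖tS F m h0‖^2 ≤ 8 * π * (‖h0‖^2 / Real.sqrt (m.natAbs+1)) + 2 * Yc * (Q / ((m.natAbs:ℝ)+1)) := by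
  have hQ0 : 0 ≤ Q := by simpa using hQ 0
  obtain ⟨h1, h2⟩ := TT0_summable F m hQ
  have h3 := norm_tsum_le_tsum_norm h1
  have hE := Eq0_zero_lower m
  have hE2 : 0 < Eq0 m 0 ^ 2 := by have := Eq0_zero_ne m; positivity
  set R := Real.sqrt (Yc * (Eq0 m 0 ^ 2 / (6 * ((m.natAbs:ℝ)+1)) * Q)) with hR
  have hR2 : R^2 = Yc * (Eq0 m 0 ^ 2 / (6 * ((m.natAbs:ℝ)+1)) * Q) := Real.sq_sqrt (by have := Yc_nonneg; positivity)
  have h4 : ‖h0 - ∑' k, TT F m 0 k‖ ≤ ‖h0‖ + 2 * R := (norm_sub_le _ _).trans (by linarith)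
  have h5 : ‖h0 - ∑' k, TT F m 0 k‖^2 ≤ 2 * ‖h0‖^2 + 8 * R^2 := by
    have := norm_nonneg (h0 - ∑' k, TT F m 0 k)
    nlinarith [sq_nonneg (‖h0‖ - 2 * R), norm_nonneg h0]
  have h6 : ‖tS F m h0‖^2 ≤ ‖h0 - ∑' k, TT F m 0 k‖^2 / Eq0 m 0 ^ 2 := by
    unfold tS
    rw [norm_div, div_pow, norm_mul, Complex.norm_real, Complex.norm_real, mul_pow, Real.norm_eq_abs, sq_abs, Real.norm_eq_abs, sq_abs]
    have := SS_ge m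
    gcongr
    exact le_mul_of_one_le_right hE2.le (one_le_pow₀ this)
  refine h6.trans ?_
  rw [div_le_iff₀ hE2]
  refine h5.trans ?_
  rw [hR2]
  have hs : 0 < Real.sqrt ((m.natAbs:ℝ)+1) := Real.sqrt_pos.2 (by positivity)
  have hp := Real.pi_pos
  have a1 : 2 * ‖h0‖^2 ≤ 8 * π * (‖h0‖^2 / Real.sqrt (m.natAbs+1)) * Eq0 m 0 ^ 2 := by
    calc 2 * ‖h0‖^2 = 8 * π * (‖h0‖^2 / Real.sqrt (m.natAbs+1)) * (Real.sqrt (m.natAbs + 1) / (4 * π)) := by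
          field_simp; ring
      _ ≤ _ := by gcongr
  have a2 : 8 * (Yc * (Eq0 m 0 ^ 2 / (6 * ((m.natAbs:ℝ)+1)) * Q)) ≤ 2 * Yc * (Q / ((m.natAbs:ℝ)+1)) * Eq0 m 0 ^ 2 := by
    have : 8 * (Yc * (Eq0 m 0 ^ 2 / (6 * ((m.natAbs:ℝ)+1)) * Q)) = (8/6) * (Yc * (Q / ((m.natAbs:ℝ)+1)) * Eq0 m 0 ^ 2) := by
      field_simp
    rw [this]
    have : 0 ≤ Yc * (Q / ((m.natAbs:ℝ)+1)) * Eq0 m 0 ^ 2 := by have := Yc_nonneg; positivity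
    nlinarith
  linarith

end Part18

section Part19

open MeasureTheory Real Filter
set_option linter.all false

lemma exists_K (p : ℝ) : ∃ K : ℕ, 1 ≤ K ∧ ∀ x : ℝ, (K:ℝ) ≤ x → (x+2)^p ≤ (3/2) * x^p := by
  have h1 : Tendsto (fun x : ℝ => (1 + 2 / x)^p) atTop (nhds 1) := by
    have h0 : Tendsto (fun x : ℝ => 1 + 2 / x) atTop (nhds (1 + 0)) :=
      tendsto_const_nhds.add (tendsto_const_nhds.div_atTop tendsto_id)
    have := h0.rpow_const (p := p) (Or.inl (by norm_num))
    simpa using this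
  have h2 := (h1.eventually (gt_mem_nhds (by norm_num : (1:ℝ) < 3/2))).exists_forall_of_atTop
  obtain ⟨a, ha⟩ := h2
  refine ⟨max 1 ⌈a⌉₊, le_max_left _ _, fun x hx => ?_⟩
  have hx1 : (1:ℝ) ≤ x := le_trans (by exact_mod_cast le_max_left 1 ⌈a⌉₊) hx
  have hxa : a ≤ x := (Nat.le_ceil a).trans (le_trans (by exact_mod_cast le_max_right 1 ⌈a⌉₊) hx)
  have hx0 : 0 < x := by linarith
  have e : x + 2 = x * (1 + 2 / x) := by field_simp
  rw [e, Real.mul_rpow hx0.le (by positivity), mul_comm]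
  exact mul_le_mul_of_nonneg_right (ha x hxa).le (by positivity)

lemma wl2 {u a : ℕ → ℂ} {g w : ℕ → ℝ} (hw0 : ∀ n, 0 ≤ w n) (hw : ∀ n, w (n+2) ≤ (3/2) * w n)
    (hg : ∀ n, g n ^ 2 ≤ 5/36) (h1 : u 1 = a 0) (hu : ∀ n, u (n+2) = (g n : ℂ) * u n + a (n+1))
    {D : ℝ} (hD : ∀ N, ∑ n ∈ Finset.range N, w (n+1) * ‖a n‖^2 ≤ D) (N : ℕ) :
    ∑ n ∈ Finset.range N, w n * ‖u n‖^2 ≤ 2 * (w 0 * ‖u 0‖^2) + 4 * D := by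
  have key : ∀ n, w (n+2) * ‖u (n+2)‖^2 ≤ 1/2 * (w n * ‖u n‖^2) + 2 * (w (n+1+1) * ‖a (n+1)‖^2) := by
    intro n
    have e1 : ‖u (n+2)‖^2 ≤ 2 * (g n ^ 2 * ‖u n‖^2) + 2 * ‖a (n+1)‖^2 := by
      rw [hu]
      have h := norm_add_le ((g n : ℂ) * u n) (a (n+1))
      rw [norm_mul, Complex.norm_real, Real.norm_eq_abs] at h
      have h2 := sq_abs (g n)
      have := norm_nonneg ((g n : ℂ) * u n + a (n+1))
      rw [← h2]
      nlinarith [sq_nonneg (|g n| * ‖u n‖ - ‖a (n+1)‖)]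
    have e2 : w (n+2) * ‖u (n+2)‖^2 ≤ w (n+2) * (2 * (g n ^ 2 * ‖u n‖^2) + 2 * ‖a (n+1)‖^2) :=
      mul_le_mul_of_nonneg_left e1 (hw0 _)
    have e3 : w (n+2) * (g n ^ 2 * ‖u n‖^2) ≤ (3/2 * w n) * (5/36 * ‖u n‖^2) := by
      have := hw n; have := hg n; have := hw0 n
      gcongr
    have e4 : 0 ≤ w n * ‖u n‖^2 := mul_nonneg (hw0 n) (by positivity)
    have e5 : w (n+1+1) = w (n+2) := rfl
    rw [e5]
    nlinarith
  have hs := Finset.sum_le_sum (fun n (_ : n ∈ Finset.range N) => key n)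
  rw [Finset.sum_add_distrib, ← Finset.mul_sum, ← Finset.mul_sum] at hs
  have t1 := Finset.sum_range_succ' (fun n => w n * ‖u n‖^2) (N+1)
  have t2 := Finset.sum_range_succ' (fun n => w (n+1) * ‖u (n+1)‖^2) N
  have t3 := Finset.sum_range_succ (fun n => w n * ‖u n‖^2) (N+1)
  have t4 := Finset.sum_range_succ (fun n => w n * ‖u n‖^2) N
  have t5 := Finset.sum_range_succ' (fun n => w (n+1) * ‖a n‖^2) N
  have t6 := hD (N+1)
  have p1 : 0 ≤ w N * ‖u N‖^2 := mul_nonneg (hw0 _) (by positivity)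
  have p2 : 0 ≤ w (N+1) * ‖u (N+1)‖^2 := mul_nonneg (hw0 _) (by positivity)
  have p3 : 0 ≤ w 1 * ‖a 0‖^2 := mul_nonneg (hw0 _) (by positivity)
  rw [← h1] at p3 t5
  simp only [zero_add] at t1 t2 t5
  simp only [show ∀ n, n+1+1 = n+2 from fun _ => rfl] at *
  rw [← h1] at *
  linarith

lemma norm_aC_gen (F : ℕ → ℂ) (m : ℤ) (l : ℕ) (h : m.natAbs ≤ l) :
    ((l:ℝ)+1)^2 * ‖aC F m l‖^2 ≤ (1 + (m.natAbs:ℝ)^2 / ((l:ℝ)+1)) * ‖F l‖^2 := by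
  rw [norm_aC_sq]
  have hb := betaLM_sq l m (by omega)
  rw [hb]
  have hM : (m.natAbs : ℝ) ≤ l := by exact_mod_cast h
  set M : ℝ := (m.natAbs : ℝ) with hMd
  have hM0 : 0 ≤ M := by positivity
  set L : ℝ := (l:ℝ)+1 with hL
  have hL1 : 1 ≤ L := by simp [hL]
  have hLM : 1 ≤ L - M := by linarith
  have e1 : L^2 ≤ 4 * ((L + M^2) * (L - M)) := by
    rcases le_total (2*M) L with h2 | h2
    · nlinarith [mul_nonneg (sq_nonneg M) (by linarith : 0 ≤ L - M)]
    · nlinarith [mul_nonneg (by positivity : 0 ≤ L + M^2) (by linarith : 0 ≤ L - M - 1)]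
  have e2 : (2*(l:ℝ)+1)*(2*l+3) ≤ 4 * L^2 := by rw [hL]; nlinarith
  have hl2 : (l:ℝ) + 2 = L + 1 := by rw [hL]; ring
  rw [hl2]
  have hD : 0 < (2*(l:ℝ)+1)*(2*l+3) := by positivity
  set D : ℝ := (2*(l:ℝ)+1)*(2*l+3) with hDd
  have hP : 0 < (L - M) * (L + M) := by nlinarith
  have e3 : L^2 * (‖F l‖^2 / (36 * (L+1)^2 * ((L - M) * (L + M) / D))) =
     (L^2 * D / (36 * (L+1)^2 * ((L - M) * (L + M)))) * ‖F l‖^2 := by field_simp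
  rw [e3]
  apply mul_le_mul_of_nonneg_right _ (by positivity)
  rw [div_le_iff₀ (by positivity)]
  have e4 : (1 + M^2/L) * (36 * (L+1)^2 * ((L-M)*(L+M))) = 36 * (L+1)^2 * ((L+M)/L) * ((L+M^2)*(L-M)) := by
    field_simp
  rw [e4]
  have e5 : 1 ≤ (L+M)/L := by rw [le_div_iff₀ (by positivity)]; linarith
  have hX : 0 ≤ (L+M^2)*(L-M) := by nlinarith [sq_nonneg L]
  calc L^2 * D ≤ L^2 * (4 * L^2) := by gcongr
    _ ≤ L^2 * (4 * (4 * ((L + M^2) * (L - M)))) := by gcongr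
    _ = 16 * L^2 * 1 * ((L + M^2) * (L - M)) := by ring
    _ ≤ _ := by
      gcongr ?_ * ?_ * _
      · nlinarith

def GG (s : ℝ) (m : ℤ) (F : ℕ → ℂ) (l : ℕ) : ℝ :=
  ((l:ℝ)+1)^(2*s) * ‖F l‖^2 + ((l:ℝ)+1)^(2*(s-1/2)) * ((m.natAbs:ℝ)^2 * ‖F l‖^2)

lemma GG_nonneg (s m F l) : 0 ≤ GG s m F l := by unfold GG; positivity

lemma per_m (s : ℝ) (hs : 1 < s) : ∃ C1 > 0, ∀ (m : ℤ) (F : ℕ → ℂ) (h0 : ℂ), Summable (GG s m F) →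
    (∀ N, ∑ k ∈ Finset.range N, ‖F (m.natAbs + 2*k+1)‖^2 ≤ 2 * (∑' l, GG s m F l) / ((m.natAbs:ℝ)+1)^(2*s+1)) ∧
    ∀ N, ∑ n ∈ Finset.range N, (((m.natAbs + n : ℕ):ℝ)+1)^(2*(s+1)) * ‖uS F m (tS F m h0) n‖^2 ≤
      C1 * (((m.natAbs:ℝ)+1)^(2*(s+3/4)) * ‖h0‖^2 + ∑' l, GG s m F l) := by
  obtain ⟨K, hK1, hK⟩ := exists_K (2*(s+1))
  have hp0 : 0 ≤ 2*(s+1) := by linarith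
  have hpi := Real.pi_pos
  have hY := Yc_nonneg
  refine ⟨((K:ℝ)+1)^(2*(s+1)) * (16 * π + 8 * Yc + 4), by positivity, fun m F h0 hG => ?_⟩
  set M : ℝ := (m.natAbs : ℝ) with hMd
  have hM0 : 0 ≤ M := by positivity
  set Γ := ∑' l, GG s m F l with hΓ
  have hΓ0 : 0 ≤ Γ := tsum_nonneg (GG_nonneg s m F)
  have hQ : ∀ N, ∑ k ∈ Finset.range N, ‖F (m.natAbs + 2*k+1)‖^2 ≤ 2 * Γ / (M+1)^(2*s+1) := by
    intro N
    rw [le_div_iff₀ (by positivity), Finset.sum_mul]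
    have i1 : Function.Injective (fun k : ℕ => m.natAbs + 2*k+1) := fun a b h => by simp at h; omega
    have h1 : ∑ k ∈ Finset.range N, GG s m F (m.natAbs + 2*k+1) ≤ Γ :=
      ((hG.comp_injective i1).sum_le_tsum _ (fun _ _ => GG_nonneg _ _ _ _)).trans
        (tsum_comp_le_tsum_of_inj hG (GG_nonneg s m F) i1)
    refine le_trans ?_ (mul_le_mul_of_nonneg_left h1 (by norm_num : (0:ℝ) ≤ 2))
    rw [Finset.mul_sum]
    apply Finset.sum_le_sum
    intro k _
    set l := m.natAbs + 2*k+1 with hl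
    have hlM : M + 1 ≤ (l:ℝ) + 1 := by rw [hl]; push_cast; rw [← hMd]; linarith [(Nat.cast_nonneg k : (0:ℝ) ≤ k)]
    unfold GG
    have e1 : (M+1)^(2*s+1) = (M+1)^(2*(s-1/2)) * (M+1)^2 := by
      rw [← Real.rpow_natCast (M+1) 2, ← Real.rpow_add (by positivity)]; congr 1; push_cast; ring
    have e2 : ((l:ℝ)+1)^(2*s) = ((l:ℝ)+1)^(2*(s-1/2)) * ((l:ℝ)+1) := by
      nth_rw 3 [← Real.rpow_one ((l:ℝ)+1)]
      rw [← Real.rpow_add (by positivity)]; congr 1; ring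
    have e3 : (M+1)^(2*(s-1/2)) ≤ ((l:ℝ)+1)^(2*(s-1/2)) := Real.rpow_le_rpow (by positivity) hlM (by linarith)
    rw [e1, e2]
    have e4 : (M+1)^2 ≤ 2 * ((l:ℝ)+1+M^2) := by nlinarith
    calc ‖F l‖^2 * ((M+1)^(2*(s-1/2)) * (M+1)^2) ≤ ‖F l‖^2 * (((l:ℝ)+1)^(2*(s-1/2)) * (2 * ((l:ℝ)+1+M^2))) := by gcongr
      _ = _ := by ring
  refine ⟨hQ, fun N => ?_⟩
  have ht := tS_bd F m h0 hQ
  rw [← hMd] at ht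
  set t := tS F m h0
  have e0 : uS F m t 0 = t := by rw [uS]
  have hw := wl2 (u := uS F m t) (a := fun n => aC F m (m.natAbs + n)) (g := fun n => gammaLM (m.natAbs + n + 1) m)
    (w := fun n : ℕ => (M + n + K)^(2*(s+1))) (fun n => by positivity)
    (fun n => by
      have := hK (M + n + K) (by linarith [(Nat.cast_nonneg n : (0:ℝ) ≤ n)])
      convert this using 2; push_cast; ring)
    (fun n => gamma_sq_le _ m (by omega)) (by rw [uS]; rfl) (fun n => by rw [uS]; rfl)
    (D := ((K:ℝ)+1)^(2*(s+1)) * Γ) (fun N => by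
      have i1 : Function.Injective (fun k : ℕ => m.natAbs + k) := fun a b h => by simpa using h
      have h1 : ∑ k ∈ Finset.range N, GG s m F (m.natAbs + k) ≤ Γ :=
        ((hG.comp_injective i1).sum_le_tsum _ (fun _ _ => GG_nonneg _ _ _ _)).trans
          (tsum_comp_le_tsum_of_inj hG (GG_nonneg s m F) i1)
      refine le_trans ?_ (mul_le_mul_of_nonneg_left h1 (by positivity))
      rw [Finset.mul_sum]
      apply Finset.sum_le_sum
      intro n _
      have hb := norm_aC_gen F m (m.natAbs + n) (by omega)
      set l := m.natAbs + n with hl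
      have hlr : (l:ℝ) = M + n := by rw [hl]; push_cast; rfl
      have hl0 : (0:ℝ) ≤ l := by positivity
      have e1 : (M + ((n+1:ℕ):ℝ) + K)^(2*(s+1)) ≤ ((K:ℝ)+1)^(2*(s+1)) * ((l:ℝ)+1)^(2*(s+1)) := by
        rw [← Real.mul_rpow (by positivity) (by positivity)]
        apply Real.rpow_le_rpow (by positivity) _ hp0
        push_cast
        nlinarith [mul_nonneg (Nat.cast_nonneg K : (0:ℝ) ≤ K) hl0]
      have e2 : ((l:ℝ)+1)^(2*(s+1)) = ((l:ℝ)+1)^(2*s) * ((l:ℝ)+1)^2 := by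
        rw [← Real.rpow_natCast ((l:ℝ)+1) 2, ← Real.rpow_add (by positivity)]; congr 1; push_cast; ring
      have e3 : ((l:ℝ)+1)^(2*s) = ((l:ℝ)+1)^(2*(s-1/2)) * ((l:ℝ)+1) := by
        nth_rw 3 [← Real.rpow_one ((l:ℝ)+1)]
        rw [← Real.rpow_add (by positivity)]; congr 1; ring
      calc _ ≤ ((K:ℝ)+1)^(2*(s+1)) * ((l:ℝ)+1)^(2*(s+1)) * ‖aC F m l‖^2 := by gcongr
        _ = ((K:ℝ)+1)^(2*(s+1)) * (((l:ℝ)+1)^(2*s) * (((l:ℝ)+1)^2 * ‖aC F m l‖^2)) := by rw [e2]; ring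
        _ ≤ ((K:ℝ)+1)^(2*(s+1)) * (((l:ℝ)+1)^(2*s) * ((1 + M^2 / ((l:ℝ)+1)) * ‖F l‖^2)) := by gcongr
        _ = _ := by
          unfold GG
          rw [e3]
          have : (l:ℝ)+1 ≠ 0 := by positivity
          rw [← hMd]; field_simp
          ) N
  rw [e0] at hw
  have hK1' : (1:ℝ) ≤ K := by exact_mod_cast hK1
  have s1 : ∑ n ∈ Finset.range N, (((m.natAbs + n : ℕ):ℝ)+1)^(2*(s+1)) * ‖uS F m t n‖^2 ≤
      ∑ n ∈ Finset.range N, (M + n + K)^(2*(s+1)) * ‖uS F m t n‖^2 := by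
    apply Finset.sum_le_sum
    intro n _
    apply mul_le_mul_of_nonneg_right _ (by positivity)
    apply Real.rpow_le_rpow (by positivity) _ hp0
    push_cast
    rw [← hMd]; linarith
  refine s1.trans (hw.trans ?_)
  have s2 : (M + ((0:ℕ):ℝ) + K)^(2*(s+1)) ≤ ((K:ℝ)+1)^(2*(s+1)) * (M+1)^(2*(s+1)) := by
    rw [← Real.mul_rpow (by positivity) (by positivity)]
    apply Real.rpow_le_rpow (by positivity) _ hp0
    push_cast
    nlinarith [mul_nonneg (Nat.cast_nonneg K : (0:ℝ) ≤ K) hM0]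
  have s3 : (M+1)^(2*(s+1)) * ‖t‖^2 ≤ 8 * π * ((M+1)^(2*(s+3/4)) * ‖h0‖^2) + 4 * Yc * Γ := by
    refine (mul_le_mul_of_nonneg_left ht (by positivity)).trans (le_of_eq ?_)
    have hM1 : 0 < M + 1 := by positivity
    have r1 : (M+1)^(2*(s+1)) = (M+1)^(2*(s+3/4)) * Real.sqrt (M+1) := by
      rw [Real.sqrt_eq_rpow, ← Real.rpow_add hM1]; congr 1; ring
    have r2 : (M+1)^(2*(s+1)) = (M+1)^(2*s+1) * (M+1) := by
      nth_rw 3 [← Real.rpow_one (M+1)]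
      rw [← Real.rpow_add hM1]; congr 1; ring
    have hq : Real.sqrt (M+1) ≠ 0 := (Real.sqrt_pos.2 hM1).ne'
    rw [mul_add]
    congr 1
    · rw [r1]; field_simp
    · rw [r2]; field_simp; ring
  have s4 : (M + ((0:ℕ):ℝ) + K)^(2*(s+1)) * ‖t‖^2 ≤ ((K:ℝ)+1)^(2*(s+1)) * (8 * π * ((M+1)^(2*(s+3/4)) * ‖h0‖^2) + 4 * Yc * Γ) := by
    calc _ ≤ ((K:ℝ)+1)^(2*(s+1)) * (M+1)^(2*(s+1)) * ‖t‖^2 := by gcongr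
      _ = ((K:ℝ)+1)^(2*(s+1)) * ((M+1)^(2*(s+1)) * ‖t‖^2) := by ring
      _ ≤ _ := by gcongr
  have hA : 0 ≤ (M+1)^(2*(s+3/4)) * ‖h0‖^2 := by positivity
  set A := (M+1)^(2*(s+3/4)) * ‖h0‖^2
  have hκ : 0 ≤ ((K:ℝ)+1)^(2*(s+1)) := by positivity
  set κ := ((K:ℝ)+1)^(2*(s+1))
  calc _ ≤ 2 * (κ * (8 * π * A + 4 * Yc * Γ)) + 4 * (κ * Γ) := by linarith
    _ = κ * (16 * π * A + (8 * Yc + 4) * Γ) := by ring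
    _ ≤ κ * ((16 * π + 8 * Yc + 4) * (A + Γ)) := by
      gcongr
      nlinarith [mul_nonneg hY hA, mul_nonneg hpi.le hΓ0]
    _ = _ := by ring

end Part19

section Part20

open MeasureTheory Real Filter
set_option linter.all false

lemma exp_pm (m : ℤ) : Complex.exp (-(Complex.I * m * ((π:ℝ):ℂ))) = Complex.exp (-(Complex.I * m * ((-π : ℝ):ℂ))) := by
  rw [Complex.exp_eq_exp_iff_exists_int]
  refine ⟨-m, ?_⟩
  push_cast; ring

lemma ibp_phi {g : ℝ → ℂ} (hg : Differentiable ℝ g) (hp : ∀ φ, g (φ + 2 * π) = g φ)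
    (hi : IntervalIntegrable (deriv g) volume (-π) π) (m : ℤ) :
    ∫ φ in (-π)..π, deriv g φ * Complex.exp (-(Complex.I * m * φ)) =
      Complex.I * m * ∫ φ in (-π)..π, g φ * Complex.exp (-(Complex.I * m * φ)) := by
  have hv : ∀ x : ℝ, HasDerivAt (fun φ : ℝ => Complex.exp (-(Complex.I * m * φ)))
      (-(Complex.I * m) * Complex.exp (-(Complex.I * m * x))) x := by
    intro x
    have h1 : HasDerivAt (fun z : ℂ => -(Complex.I * m * z)) (-(Complex.I * m)) (x:ℂ) := by
      have := (hasDerivAt_id (x:ℂ)).const_mul (-(Complex.I * (m:ℂ)))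
      simpa only [id, mul_one, neg_mul] using this
    have := (h1.cexp).comp_ofReal
    exact this.congr_deriv (mul_comm _ _)
  have hc : Continuous (fun x : ℝ => -(Complex.I * m) * Complex.exp (-(Complex.I * m * x))) := by fun_prop
  have h := intervalIntegral.integral_mul_deriv_eq_deriv_mul (a := -π) (b := π) (u := g) (u' := deriv g)
    (fun x _ => (hg x).hasDerivAt) (fun x _ => hv x) hi (hc.intervalIntegrable _ _)
  have hb : g π = g (-π) := by
    have := hp (-π); rw [← this]; congr 1; ring
  rw [hb, exp_pm, sub_self, zero_sub] at h
  have e : ∫ x in (-π)..π, g x * (-(Complex.I * m) * Complex.exp (-(Complex.I * m * x))) =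
      -(Complex.I * m) * ∫ x in (-π)..π, g x * Complex.exp (-(Complex.I * m * x)) := by
    rw [← intervalIntegral.integral_const_mul]
    congr 1; ext x; ring
  rw [e] at h
  linear_combination h

lemma flCoeff_dphi {f : ℝ → ℝ → ℂ} (hf : Continuous (fun q : ℝ × ℝ => f q.1 q.2))
    (hd : ∀ θ : ℝ, Differentiable ℝ (f θ)) (hp : ∀ θ φ : ℝ, f θ (φ + 2 * π) = f θ φ)
    (hL : MemLp (fun p : ℝ × ℝ => deriv (f p.1) p.2) 2 sphereMeasure) (l : ℕ) (m : ℤ) :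
    flCoeff (fun θ φ => deriv (f θ) φ) l m = Complex.I * m * flCoeff f l m := by
  have hI : Integrable (fun p : ℝ × ℝ => deriv (f p.1) p.2) sphereMeasure := hL.integrable (by norm_num)
  have hY := Yb_continuous l m
  have hI2 : Integrable (fun p : ℝ × ℝ => deriv (f p.1) p.2 * (starRingEnd ℂ) (Yb l m p.1 p.2)) sphereMeasure := by
    refine hI.mul_bdd (c := Real.sqrt (l+1)) ?_ ?_
    · have := Complex.continuous_conj
      exact Continuous.aestronglyMeasurable (by fun_prop)
    · filter_upwards with p
      rw [RCLike.norm_conj]; exact norm_Yb_le _ _ _ _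
  rw [flCoeff_cont hf, flCoeff_eq, integral_sphere]
  rw [integrable_sphere_iff] at hI2 hI
  rw [ioc_box (fun θ φ => (Real.cos θ : ℂ) * (deriv (f θ) φ * (starRingEnd ℂ) (Yb l m θ φ))) hI2]
  rw [← intervalIntegral.integral_const_mul]
  apply intervalIntegral.integral_congr_ae
  have hS : ∀ᵐ θ ∂(volume.restrict (Set.Icc (-(π/2)) (π/2))), IntegrableOn (fun φ => (Real.cos θ : ℂ) * deriv (f θ) φ) (Set.Ico (-π) π) := by
    unfold box at hI
    unfold IntegrableOn at hI
    rw [Measure.volume_eq_prod, ← Measure.prod_restrict] at hI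
    exact hI.prod_right_ae
  rw [ae_restrict_iff' measurableSet_Icc] at hS
  filter_upwards [hS] with θ hθ hm
  have hθ' := hθ (by
    rw [Set.uIoc_of_le (by linarith [pi_pos])] at hm; exact Set.Ioc_subset_Icc_self hm)
  by_cases hc : Real.cos θ = 0
  · simp [hc]
  have hc' : (Real.cos θ : ℂ) ≠ 0 := by exact_mod_cast hc
  have hi : IntervalIntegrable (deriv (f θ)) volume (-π) π := by
    rw [intervalIntegrable_iff_integrableOn_Ico_of_le (by linarith [pi_pos])]
    have := hθ'.const_mul ((Real.cos θ : ℂ)⁻¹)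
    refine this.congr (Eventually.of_forall fun φ => ?_)
    dsimp only; field_simp
  have h := ibp_phi (hd θ) (hp θ) hi m
  have e : ∫ φ in (-π)..π, (Real.cos θ : ℂ) * (deriv (f θ) φ * (starRingEnd ℂ) (Yb l m θ φ)) =
     (∫ φ in (-π)..π, deriv (f θ) φ * Complex.exp (-(Complex.I * m * φ))) * ((yr l m θ * Real.cos θ : ℝ) : ℂ) := by
    rw [← intervalIntegral.integral_mul_const]
    congr 1; ext φ
    rw [conj_Yb]; push_cast; ring
  rw [e, h]; ring

def aArr (F : ℕ → ℤ → ℂ) (H : ℤ → ℂ) : Arr := fun l m =>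
  if m.natAbs ≤ l then uS (fun l => F l m) m (tS (fun l => F l m) m (H m)) (l - m.natAbs) else 0

lemma aArr_sum (F : ℕ → ℤ → ℂ) (H : ℤ → ℂ) (s : ℝ) (m : ℤ) (N : ℕ) :
    ∑ l ∈ Finset.range N, ((l:ℝ)+1)^(2*(s+1)) * ‖aArr F H l m‖^2 ≤
    ∑ n ∈ Finset.range N, (((m.natAbs + n : ℕ):ℝ)+1)^(2*(s+1)) *
      ‖uS (fun l => F l m) m (tS (fun l => F l m) m (H m)) n‖^2 := by
  calc _ ≤ ∑ l ∈ Finset.range (m.natAbs + N), ((l:ℝ)+1)^(2*(s+1)) * ‖aArr F H l m‖^2 := by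
        apply Finset.sum_le_sum_of_subset_of_nonneg
        · intro x hx; simp at hx ⊢; omega
        · intro i _ _; positivity
    _ = _ := by
        rw [Finset.sum_range_add, Finset.sum_eq_zero, zero_add]
        · apply Finset.sum_congr rfl
          intro n _
          rw [aArr, if_pos (by omega), Nat.add_sub_cancel_left]
        · intro l hl
          rw [Finset.mem_range] at hl
          rw [aArr, if_neg (by omega)]; simp

lemma master (s : ℝ) (hs : 1 < s) : ∃ C1 > 0, ∀ (F : ℕ → ℤ → ℂ) (H : ℤ → ℂ),
    Summable (fun p : ℕ × ℤ => ((p.1:ℝ)+1)^(2*s) * ‖F p.1 p.2‖^2) →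
    Summable (fun p : ℕ × ℤ => ((p.1:ℝ)+1)^(2*(s-1/2)) * ((p.2.natAbs:ℝ)^2 * ‖F p.1 p.2‖^2)) →
    Summable (fun m : ℤ => ((m.natAbs:ℝ)+1)^(2*(s+3/4)) * ‖H m‖^2) →
    (∀ m, HasSum (TT (fun l => F l m) m (tS (fun l => F l m) m (H m))) (H m)) ∧
    Summable (fun p : ℕ × ℤ => ((p.1:ℝ)+1)^(2*(s+1)) * ‖aArr F H p.1 p.2‖^2) ∧
    ∑' p : ℕ × ℤ, ((p.1:ℝ)+1)^(2*(s+1)) * ‖aArr F H p.1 p.2‖^2 ≤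
      C1 * (∑' p : ℕ × ℤ, ((p.1:ℝ)+1)^(2*s) * ‖F p.1 p.2‖^2 +
        ∑' p : ℕ × ℤ, ((p.1:ℝ)+1)^(2*(s-1/2)) * ((p.2.natAbs:ℝ)^2 * ‖F p.1 p.2‖^2) +
        ∑' m : ℤ, ((m.natAbs:ℝ)+1)^(2*(s+3/4)) * ‖H m‖^2) := by
  obtain ⟨C1, hC, h⟩ := per_m s hs
  refine ⟨C1, hC, fun F H h1 h2 h3 => ?_⟩
  have hg : Summable (fun q : ℤ × ℕ => GG s q.1 (fun l => F l q.1) q.2) := (h1.add h2).prod_symm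
  have hgm : ∀ m, Summable (GG s m (fun l => F l m)) := fun m => hg.prod_factor m
  have hgs : Summable (fun m => ∑' l, GG s m (fun l => F l m) l) := hg.prod
  have hgt : ∑' m, ∑' l, GG s m (fun l => F l m) l = ∑' p : ℕ × ℤ, ((p.1:ℝ)+1)^(2*s) * ‖F p.1 p.2‖^2 +
        ∑' p : ℕ × ℤ, ((p.1:ℝ)+1)^(2*(s-1/2)) * ((p.2.natAbs:ℝ)^2 * ‖F p.1 p.2‖^2) := by
    rw [← h1.tsum_add h2, ← hg.tsum_prod, ← (Equiv.prodComm ℤ ℕ).tsum_eq]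
    rfl
  have hB : Summable (fun m : ℤ => C1 * (((m.natAbs:ℝ)+1)^(2*(s+3/4)) * ‖H m‖^2 + ∑' l, GG s m (fun l => F l m) l)) :=
    (h3.add hgs).mul_left C1
  have hbd : ∀ (m : ℤ) (N : ℕ), ∑ l ∈ Finset.range N, ((l:ℝ)+1)^(2*(s+1)) * ‖aArr F H l m‖^2 ≤
      C1 * (((m.natAbs:ℝ)+1)^(2*(s+3/4)) * ‖H m‖^2 + ∑' l, GG s m (fun l => F l m) l) := fun m N =>
    (aArr_sum F H s m N).trans ((h m _ (H m) (hgm m)).2 N)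
  have hin : ∀ m : ℤ, Summable (fun l : ℕ => ((l:ℝ)+1)^(2*(s+1)) * ‖aArr F H l m‖^2) := fun m =>
    summable_of_sum_range_le (fun l => by positivity) (hbd m)
  have hle : ∀ m : ℤ, ∑' l : ℕ, ((l:ℝ)+1)^(2*(s+1)) * ‖aArr F H l m‖^2 ≤
      C1 * (((m.natAbs:ℝ)+1)^(2*(s+3/4)) * ‖H m‖^2 + ∑' l, GG s m (fun l => F l m) l) := fun m =>
    Real.tsum_le_of_sum_range_le (fun l => by positivity) (hbd m)
  have hout : Summable (fun m : ℤ => ∑' l : ℕ, ((l:ℝ)+1)^(2*(s+1)) * ‖aArr F H l m‖^2) :=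
    Summable.of_nonneg_of_le (fun m => tsum_nonneg fun l => by positivity) hle hB
  have hT : Summable (fun q : ℤ × ℕ => ((q.2:ℝ)+1)^(2*(s+1)) * ‖aArr F H q.2 q.1‖^2) := by
    rw [summable_prod_of_nonneg (fun q => by positivity)]
    exact ⟨hin, hout⟩
  refine ⟨fun m => tS_hasSum _ m (H m) (h m _ (H m) (hgm m)).1, hT.prod_symm, ?_⟩
  have e : ∑' p : ℕ × ℤ, ((p.1:ℝ)+1)^(2*(s+1)) * ‖aArr F H p.1 p.2‖^2 =
     ∑' m : ℤ, ∑' l : ℕ, ((l:ℝ)+1)^(2*(s+1)) * ‖aArr F H l m‖^2 := by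
    rw [← hT.tsum_prod, ← (Equiv.prodComm ℤ ℕ).tsum_eq]
    rfl
  rw [e]
  refine (hout.tsum_le_tsum hle hB).trans (le_of_eq ?_)
  rw [tsum_mul_left, h3.tsum_add hgs, hgt]
  ring

end Part20

section Part21

open MeasureTheory Real Filter
set_option linter.all false

lemma wt_summable {s : ℝ} (hs : 1 < s) : Summable (fun l : ℕ => ((l:ℝ)+1)^(1 - 2*s)) := by
  have h : Summable fun k : ℕ => (k:ℝ)^(1-2*s) := Real.summable_nat_rpow.2 (by linarith)
  have h2 := (summable_nat_add_iff 1).2 h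
  refine h2.congr (fun k => ?_)
  push_cast; rfl

lemma amgm_wt {s : ℝ} {x y : ℝ} (hx : 1 ≤ x) (hy : 0 ≤ y) :
    y * (x * Real.sqrt x) ≤ x^(2*(s+1)) * y^2 + x^(1-2*s) := by
  have hx0 : 0 < x := by linarith
  have e1 : x^(2*(s+1)) = (x^(s+1))^2 := by
    rw [← Real.rpow_natCast (x^(s+1)) 2, ← Real.rpow_mul hx0.le]; congr 1; push_cast; ring
  have e2 : x^(1-2*s) = (x^(1/2 - s))^2 := by
    rw [← Real.rpow_natCast (x^(1/2 - s)) 2, ← Real.rpow_mul hx0.le]; congr 1; push_cast; ring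
  have e3 : x * Real.sqrt x = x^(s+1) * x^(1/2 - s) := by
    rw [Real.sqrt_eq_rpow, ← Real.rpow_add hx0]
    nth_rw 1 [← Real.rpow_one x]
    rw [← Real.rpow_add hx0]; congr 1; ring
  rw [e1, e2, e3]
  have : 0 ≤ x^(s+1) * y * x^(1/2-s) := by positivity
  nlinarith [sq_nonneg (x^(s+1) * y - x^(1/2-s))]

lemma adm_of {s : ℝ} (hs : 1 < s) {a : Arr}
    (h : Summable (fun p : ℕ × ℤ => ((p.1:ℝ)+1)^(2*(s+1)) * ‖a p.1 p.2‖^2)) : Adm 1 1 a := by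
  have h1 : Summable (fun l : ℕ => ((l:ℝ)+1)^(2*(s+1)) * nrm a l ^ 2) := by
    refine Summable.of_nonneg_of_le (fun l => by positivity) (fun l => ?_) h.prod
    rw [nrm_sq, Finset.mul_sum]
    exact (h.prod_factor l).sum_le_tsum _ (fun _ _ => by positivity)
  refine Summable.of_nonneg_of_le (fun l => ?_) (fun l => ?_) (h1.add (wt_summable hs))
  · have := nrm_nonneg a l; positivity
  · have := amgm_wt (s := s) (x := (l:ℝ)+1) (by linarith [(Nat.cast_nonneg l : (0:ℝ) ≤ l)]) (nrm_nonneg a l)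
    simpa using this

lemma equator_of_uS {g : ℝ → ℝ → ℂ} (hg : Continuous (fun q : ℝ × ℝ => g q.1 q.2)) (m : ℤ) (F : ℕ → ℂ) (t h0 : ℂ)
    (hc : ∀ n, flCoeff g (m.natAbs + n) m = uS F m t n) {s : ℝ} (hs : 1 < s) {B : ℝ}
    (hB : ∀ N, ∑ n ∈ Finset.range N, (((m.natAbs + n : ℕ):ℝ)+1)^(2*(s+1)) * ‖uS F m t n‖^2 ≤ B)
    (hT : HasSum (TT F m t) h0) : equatorCoeff (g 0) m = h0 := by
  have h1 : Summable (fun n : ℕ => (((m.natAbs + n : ℕ):ℝ)+1)^(2*(s+1)) * ‖uS F m t n‖^2) :=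
    summable_of_sum_range_le (fun n => by positivity) hB
  have h2 : Summable (fun n : ℕ => (((m.natAbs + n : ℕ):ℝ)+1)^(1-2*s)) :=
    (wt_summable hs).comp_injective (i := fun n => m.natAbs + n) (fun a b h => by simpa using h)
  have h3 : Summable fun l => ‖flCoeff g l m‖ * Real.sqrt (l+1) := by
    rw [← summable_nat_add_iff m.natAbs]
    refine Summable.of_nonneg_of_le (fun n => by positivity) (fun n => ?_) (h1.add h2)
    rw [add_comm n, hc]
    have hx : (1:ℝ) ≤ ((m.natAbs + n : ℕ):ℝ)+1 := by
      have : (0:ℝ) ≤ ((m.natAbs + n : ℕ):ℝ) := Nat.cast_nonneg _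
      linarith
    refine le_trans ?_ (amgm_wt hx (norm_nonneg _))
    apply mul_le_mul_of_nonneg_left _ (norm_nonneg _)
    exact le_mul_of_one_le_left (Real.sqrt_nonneg _) hx
  have h4 := equator_hasSum hg m h3
  have hi : Function.Injective (fun k : ℕ => m.natAbs + 2*k) := fun a b h => by simp at h; omega
  rw [← hi.hasSum_iff] at h4
  · have e : ((fun l => flCoeff g l m * (yr l m 0 : ℂ)) ∘ fun k : ℕ => m.natAbs + 2*k) = TT F m t := by
      funext k
      simp only [Function.comp]
      rw [hc]; rfl
    rw [e] at h4
    exact h4.unique hT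
  · intro l hl
    by_cases hlm : l < m.natAbs
    · rw [flCoeff_of_lt _ hlm, zero_mul]
    · have : ∃ k, l = m.natAbs + 2*k+1 := by
        by_contra hcon
        push Not at hcon
        apply hl
        refine ⟨(l - m.natAbs)/2, ?_⟩
        have := hcon ((l - m.natAbs)/2)
        dsimp only
        omega
      obtain ⟨k, rfl⟩ := this
      rw [yr_odd]; simp

lemma sph_per (θ φ : ℝ) : sphCoord θ (φ + 2*π) = sphCoord θ φ := by
  unfold sphCoord; simp

lemma obl_per (w : E3 → ℂ) (θ φ : ℝ) : obl w θ (φ + 2*π) = obl w θ φ := by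
  unfold obl radialDeriv thetaDeriv
  simp only [sph_per]

lemma flCoeff_traceSol {a : Arr} (h : Adm 0 1 a) (l : ℕ) (m : ℤ) (hz : l < m.natAbs → a l m = 0) :
    flCoeff (traceC (Sol a)) l m = a l m := by
  by_cases hm : m.natAbs ≤ l
  · have := flCoeff_Sol h (le_refl (1:ℝ)) l m hm
    simp only [one_smul, inv_one, Complex.ofReal_one, one_pow, one_mul] at this
    exact this
  · rw [flCoeff_of_lt _ (by omega), hz (by omega)]

lemma obl_coeff {w : E3 → ℂ} (hw : HarmC1 w) (F : ℕ → ℂ) (m : ℤ) (t : ℂ)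
    (hc : ∀ n, flCoeff (traceC w) (m.natAbs + n) m = uS F m t n) (l : ℕ) (hl : m.natAbs ≤ l) :
    flCoeff (obl w) l m = F l / 2 := by
  rw [flCoeff_obl hw l m hl]
  obtain ⟨n, rfl⟩ := Nat.exists_eq_add_of_le hl
  cases n with
  | zero =>
    rw [add_zero, betaLM_self, hc 1, uS_rec_zero]; simp
  | succ n =>
    have := uS_rec F m t n (m.natAbs + (n+1)) (by omega)
    rw [← this, ← hc, ← hc]
    rfl

lemma obl_coeff_conv {w : E3 → ℂ} (hw : HarmC1 w) (m : ℤ)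
    (h0 : ∀ l, flCoeff (obl w) l m = 0) (n : ℕ) :
    flCoeff (traceC w) (m.natAbs + n) m = uS (fun _ => 0) m (flCoeff (traceC w) m.natAbs m) n := by
  have key : ∀ l, m.natAbs ≤ l → (3 * ((l:ℂ)+2) * (betaLM (l+1) m : ℂ)) ≠ 0 := by
    intro l hl
    have hb : (betaLM (l+1) m : ℂ) ≠ 0 := by exact_mod_cast (betaLM_pos l m hl).ne'
    have hl : ((l:ℂ)+2) ≠ 0 := by exact_mod_cast (by positivity : ((l:ℝ)+2) ≠ 0)
    exact mul_ne_zero (mul_ne_zero three_ne_zero hl) hb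
  induction n using Nat.strong_induction_on with
  | _ n ih =>
    match n with
    | 0 => rw [uS]; rfl
    | 1 =>
      have h := flCoeff_obl hw m.natAbs m le_rfl
      rw [h0, betaLM_self] at h
      have h2 := uS_rec_zero (fun _ => 0) m (flCoeff (traceC w) m.natAbs m)
      apply mul_left_cancel₀ (key m.natAbs le_rfl)
      rw [h2]
      simp only [Complex.ofReal_zero, mul_zero, zero_mul, zero_add] at h
      rw [← h]; simp
    | n+2 =>
      have h := flCoeff_obl hw (m.natAbs + n + 1) m (by omega)
      rw [h0] at h
      have h2 := uS_rec (fun _ => 0) m (flCoeff (traceC w) m.natAbs m) n (m.natAbs + n + 1) rfl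
      have h3 := ih n (by omega)
      apply mul_left_cancel₀ (key (m.natAbs + n + 1) (by omega))
      rw [← h3] at h2
      have e : m.natAbs + n + 1 - 1 = m.natAbs + n := by omega
      rw [e] at h
      rw [show m.natAbs + (n+2) = m.natAbs + n + 1 + 1 by ring]
      have : (0:ℂ)/2 = 0 := by simp
      rw [this] at h2
      linear_combination -h - h2

lemma uS_zero (m : ℤ) (n : ℕ) : uS (fun _ => 0) m 0 n = 0 := by
  induction n using Nat.strong_induction_on with
  | _ n ih =>
    match n with
    | 0 => rw [uS]
    | 1 => rw [uS]; simp [aC]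
    | n+2 => rw [uS, ih n (by omega)]; simp [aC]

lemma tS_zero (m : ℤ) (t : ℂ) : tS (fun _ => 0) m (t * ((Eq0 m 0 : ℂ) * (SS m : ℂ))) = t := by
  have hE : (Eq0 m 0 : ℂ) ≠ 0 := by exact_mod_cast Eq0_zero_ne m
  have hS : (SS m : ℂ) ≠ 0 := by exact_mod_cast (by linarith [SS_ge m] : SS m ≠ 0)
  unfold tS
  have : ∀ k, TT (fun _ => 0) m 0 k = 0 := fun k => by rw [TT, uS_zero, zero_mul]
  simp only [this, tsum_zero, sub_zero]
  field_simp

lemma uniq_coeff {w : E3 → ℂ} (hw : HarmC1 w) (h0 : ∀ l m, flCoeff (obl w) l m = 0)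
    (he : ∀ φ, w (sphCoord 0 φ) = 0) (l : ℕ) (m : ℤ) : flCoeff (traceC w) l m = 0 := by
  by_cases hl : l < m.natAbs
  · exact flCoeff_of_lt _ hl
  have hc := obl_coeff_conv hw m (fun l => h0 l m)
  set t := flCoeff (traceC w) m.natAbs m
  set H := t * ((Eq0 m 0 : ℂ) * (SS m : ℂ)) with hH
  have ht : tS (fun _ => 0) m H = t := tS_zero m t
  obtain ⟨C1, -, hC⟩ := per_m 2 (by norm_num)
  have hG : Summable (GG 2 m (fun _ => (0:ℂ))) := by
    have : GG 2 m (fun _ => (0:ℂ)) = fun _ => 0 := by funext l; simp [GG]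
    rw [this]; exact summable_zero
  obtain ⟨q1, q2⟩ := hC m (fun _ => 0) H hG
  have hT := tS_hasSum (fun _ => 0) m H q1
  rw [ht] at hT q2
  have e := equator_of_uS hw.trace_cont m (fun _ => 0) t H hc (by norm_num : (1:ℝ) < 2) q2 hT
  have e2 : equatorCoeff (traceC w 0) m = 0 := by
    unfold equatorCoeff traceC
    simp [he]
  have hE : (Eq0 m 0 : ℂ) ≠ 0 := by exact_mod_cast Eq0_zero_ne m
  have hS : (SS m : ℂ) ≠ 0 := by exact_mod_cast (by linarith [SS_ge m] : SS m ≠ 0)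
  have ht0 : t = 0 := by
    rw [e2, hH] at e
    have := mul_ne_zero hE hS
    exact (mul_eq_zero.1 e.symm).resolve_right this
  obtain ⟨n, rfl⟩ := Nat.exists_eq_add_of_le (not_lt.1 hl)
  rw [hc, ht0, uS_zero]

end Part21

section Part22

open MeasureTheory Real Filter
set_option linter.all false

lemma flCoeff_congr_box {g k : ℝ → ℝ → ℂ} (h : ∀ θ ∈ Set.Icc (-(π/2)) (π/2), ∀ φ, g θ φ = k θ φ) (l : ℕ) (m : ℤ) :
    flCoeff g l m = flCoeff k l m := by
  unfold flCoeff
  apply integral_congr_ae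
  filter_upwards [ae_box] with p hp
  rw [h p.1 hp.1]

lemma solves_HarmC1 {v f h} (hv : SolvesObliqueC v f h) : HarmC1 v :=
  ⟨⟨hv.2.1.continuousOn, hv.1, hv.2.2.1, hv.2.2.2.2.1⟩, hv.2.1⟩

lemma obl_sub {u w : E3 → ℂ} (hu : HarmC1 u) (hw : HarmC1 w) (θ φ : ℝ) :
    obl (fun x => u x - w x) θ φ = obl u θ φ - obl w θ φ := by
  have hc : ContDiffOn ℝ 1 (fun x => u x - w x) closedExt := hu.c1.sub hw.c1
  have e : gradW (fun x => u x - w x) (sphCoord θ φ) = gradW u (sphCoord θ φ) - gradW w (sphCoord θ φ) :=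
    ((gradW_has hu.c1 (sph_mem θ φ)).sub (gradW_has hw.c1 (sph_mem θ φ))).fderivWithin
      (uniqueDiffOn_closedExt _ (sph_mem θ φ))
  unfold obl
  rw [radialDeriv_eq hc, radialDeriv_eq hu.c1, radialDeriv_eq hw.c1, thetaDeriv_eq hc, thetaDeriv_eq hu.c1,
    thetaDeriv_eq hw.c1, e, ContinuousLinearMap.sub_apply, ContinuousLinearMap.sub_apply]
  ring

lemma slice_cont {g : ℝ → ℝ → ℂ} (hg : Continuous (fun q : ℝ × ℝ => g q.1 q.2)) (t : ℝ) : Continuous (g t) := by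
  have h : Continuous (fun φ : ℝ => (t, φ)) := by fun_prop
  exact hg.comp h

lemma uniqueness {v v' : E3 → ℂ} {f : ℝ → ℝ → ℂ} {h : ℝ → ℂ} (hv : SolvesObliqueC v f h) (hv' : SolvesObliqueC v' f h) :
    Set.EqOn v' v closedExt := by
  have a := solves_HarmC1 hv
  have b := solves_HarmC1 hv'
  have hw : HarmC1 (fun x => v' x - v x) := ⟨b.h.sub a.h, b.c1.sub a.c1⟩
  have h0 : ∀ l m, flCoeff (obl (fun x => v' x - v x)) l m = 0 := by
    intro l m
    rw [flCoeff_congr_box (k := fun _ _ => 0)]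
    · simp [flCoeff]
    · intro θ hθ φ
      rw [obl_sub b a]
      have e1 : obl v' θ φ = f θ φ / 2 := hv'.2.2.2.1 θ hθ φ
      have e2 : obl v θ φ = f θ φ / 2 := hv.2.2.2.1 θ hθ φ
      rw [e1, e2, sub_self]
  have hc := uniq_coeff hw h0 (fun φ => by rw [hv.2.2.2.2.2 φ, hv'.2.2.2.2.2 φ, sub_self])
  have hz := complete_C1 hw.trace_cont (fun θ φ => by simp only [traceC, sph_per]) hc
  have hm := max_principle hw.h.c hw.h.c2 hw.h.l hw.h.d (le_refl 0) (fun x hx => by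
    obtain ⟨θ, hθ, φ, e⟩ := exists_sph x (by intro h; rw [h, norm_zero] at hx; exact zero_ne_one hx)
    have := hz θ hθ φ
    rw [hx, one_smul] at e
    unfold traceC at this
    try dsimp only at this
    try dsimp only
    rw [e, this, norm_zero])
  intro x hx
  have := hm x hx
  rw [norm_le_zero_iff, sub_eq_zero] at this
  exact this

lemma existence {s : ℝ} (hs : 1 < s) {f : ℝ → ℝ → ℂ} {h : ℝ → ℂ} (hf : Continuous (fun q : ℝ × ℝ => f q.1 q.2))
    (hp : ∀ θ φ : ℝ, f θ (φ + 2 * π) = f θ φ) (hh : Continuous h) (hhp : ∀ φ : ℝ, h (φ + 2 * π) = h φ)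
    (hT : ∀ m, HasSum (TT (fun l => flCoeff f l m) m (tS (fun l => flCoeff f l m) m (equatorCoeff h m))) (equatorCoeff h m))
    (hS : Summable (fun p : ℕ × ℤ => ((p.1:ℝ)+1)^(2*(s+1)) * ‖aArr (flCoeff f) (equatorCoeff h) p.1 p.2‖^2)) :
    SolvesObliqueC (Sol (aArr (flCoeff f) (equatorCoeff h))) f h ∧
    (∀ l m, flCoeff (traceC (Sol (aArr (flCoeff f) (equatorCoeff h)))) l m = aArr (flCoeff f) (equatorCoeff h) l m) := by
  set a := aArr (flCoeff f) (equatorCoeff h) with ha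
  have hA : Adm 1 1 a := adm_of hs hS
  have hA0 : Adm 0 1 a := hA.mono le_rfl (by norm_num)
  have hv : HarmC1 (Sol a) := ⟨HarmExt_Sol hA0, Sol_contDiffOn_one hA⟩
  have hc : ∀ l m, flCoeff (traceC (Sol a)) l m = a l m := fun l m =>
    flCoeff_traceSol hA0 l m (fun hl => by rw [ha, aArr, if_neg (by omega)])
  have hcn : ∀ (m : ℤ) (n : ℕ), flCoeff (traceC (Sol a)) (m.natAbs + n) m =
      uS (fun l => flCoeff f l m) m (tS (fun l => flCoeff f l m) m (equatorCoeff h m)) n := fun m n => by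
    rw [hc, ha, aArr, if_pos (by omega), Nat.add_sub_cancel_left]
  refine ⟨⟨hv.h.c2, hv.c1, hv.h.l, ?_, hv.h.d, ?_⟩, hc⟩
  · intro θ hθ φ
    have hoc := obl_continuous hv
    have hf2 : Continuous (fun q : ℝ × ℝ => (1/2 : ℂ) * f q.1 q.2) := by fun_prop
    have := complete_C1 (g := fun θ φ => obl (Sol a) θ φ - (1/2 : ℂ) * f θ φ) (by exact hoc.sub hf2)
      (fun θ φ => by rw [obl_per, hp]) (fun l m => by
        rw [flCoeff_sub hoc hf2, flCoeff_const_mul]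
        by_cases hl : m.natAbs ≤ l
        · rw [obl_coeff hv _ m _ (hcn m) l hl]; ring
        · rw [flCoeff_of_lt _ (by omega), flCoeff_of_lt _ (by omega)]; ring) θ hθ φ
    have e : obl (Sol a) θ φ = f θ φ / 2 := by linear_combination this
    exact e
  · have htc := hv.trace_cont
    have heq : ∀ m : ℤ, equatorCoeff (traceC (Sol a) 0) m = equatorCoeff h m := by
      intro m
      have hBs : Summable (fun l : ℕ => ((l:ℝ)+1)^(2*(s+1)) * ‖a l m‖^2) := hS.prod_symm.prod_factor m
      have hi : Function.Injective (fun n : ℕ => m.natAbs + n) := fun a b h => by simpa using h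
      refine equator_of_uS htc m _ _ _ (hcn m) hs (B := ∑' l : ℕ, ((l:ℝ)+1)^(2*(s+1)) * ‖a l m‖^2) (fun N => ?_) (hT m)
      refine le_trans (le_of_eq ?_) (((hBs.comp_injective hi).sum_le_tsum (Finset.range N) (fun _ _ => by
        simp only [Function.comp]; positivity)).trans
          (tsum_comp_le_tsum_of_inj hBs (fun l => by positivity) hi))
      apply Finset.sum_congr rfl
      intro n _
      simp only [Function.comp]
      rw [← hcn, hc]
    have ht0 : Continuous (fun φ : ℝ => traceC (Sol a) 0 φ) := slice_cont (g := traceC (Sol a)) htc 0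
    have hz := fourier_uniq (g := fun φ => traceC (Sol a) 0 φ - h φ) (ht0.sub hh)
      (fun φ => by rw [hhp]; simp only [traceC, sph_per]) (fun m => by
        have := heq m
        unfold equatorCoeff at this
        have hp0 : (1 / (2 * (π:ℂ))) ≠ 0 := by
          have : (π:ℂ) ≠ 0 := by exact_mod_cast pi_ne_zero
          simpa using this
        have this := mul_left_cancel₀ hp0 this
        have e1 : IntervalIntegrable (fun φ : ℝ => traceC (Sol a) 0 φ * Complex.exp (-(Complex.I * m * φ))) volume (-π) π :=
          Continuous.intervalIntegrable (by fun_prop) _ _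
        have e2 : IntervalIntegrable (fun φ : ℝ => h φ * Complex.exp (-(Complex.I * m * φ))) volume (-π) π :=
          Continuous.intervalIntegrable (by fun_prop) _ _
        simp only [sub_mul]
        rw [intervalIntegral.integral_sub e1 e2, this, sub_self])
    intro φ
    have := congrFun hz φ
    exact sub_eq_zero.1 this

end Part22

section Part23

open MeasureTheory Real Filter
set_option linter.all false

lemma memLp_of_cont {g : ℝ → ℝ → ℂ} (hg : Continuous (fun q : ℝ × ℝ => g q.1 q.2)) :
    MemLp (fun p : ℝ × ℝ => g p.1 p.2) 2 sphereMeasure := by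
  have hK : IsCompact (Set.Icc (-(π/2)) (π/2) ×ˢ Set.Icc (-π) π) := isCompact_Icc.prod isCompact_Icc
  obtain ⟨B, hB⟩ := hK.exists_bound_of_continuousOn hg.continuousOn
  refine MemLp.of_bound hg.aestronglyMeasurable B ?_
  filter_upwards [ae_box] with p hp
  exact hB p ⟨hp.1, Set.Ico_subset_Icc_self hp.2⟩

lemma tS_zero' (m : ℤ) : tS (fun _ => 0) m 0 = 0 := by
  have := tS_zero m 0
  rwa [zero_mul] at this

lemma aArr_zero {F : ℕ → ℤ → ℂ} {H : ℤ → ℂ} {m : ℤ} (hF : ∀ l, F l m = 0) (hH : H m = 0) (l : ℕ) : aArr F H l m = 0 := by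
  unfold aArr
  rw [show (fun l => F l m) = fun _ => 0 from funext hF, hH, tS_zero', uS_zero, ite_self]

lemma lev_axial {a : Arr} (ha : ∀ l m, m ≠ 0 → a l m = 0) (l : ℕ) (θ φ φ' : ℝ) :
    lev a l (sphCoord θ φ) = lev a l (sphCoord θ φ') := by
  have e := lev_sph a l one_pos θ φ
  have e' := lev_sph a l one_pos θ φ'
  rw [one_smul] at e e'
  rw [e, e']
  apply Finset.sum_congr rfl
  intro m _
  by_cases hm : m = 0
  · subst hm; simp [Yb]
  · rw [ha l m hm]; simp

lemma equatorCoeff_const {h : ℝ → ℂ} (hc : ∀ a b : ℝ, h a = h b) (m : ℤ) :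
    equatorCoeff h m = if m = 0 then h 0 else 0 := by
  unfold equatorCoeff
  have e : (fun φ : ℝ => h φ * Complex.exp (-(Complex.I * m * φ))) =
      fun φ : ℝ => h 0 * Complex.exp (Complex.I * ((-m : ℤ) : ℂ) * φ) := by
    funext φ
    rw [hc φ 0]
    congr 2
    push_cast; ring
  rw [e, intervalIntegral.integral_const_mul, integral_exp_int]
  have hp : (π:ℂ) ≠ 0 := by exact_mod_cast pi_ne_zero
  by_cases hm : m = 0
  · subst hm
    simp only [neg_zero, if_true]
    field_simp
  · rw [if_neg (by simpa using hm), if_neg hm, mul_zero, mul_zero]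

lemma HsNorm_sq (s : ℝ) (ψ : ℝ → ℝ → ℂ) :
    HsNorm s ψ ^ 2 = ∑' p : ℕ × ℤ, ((p.1 : ℝ) + 1) ^ (2 * s) * ‖flCoeff ψ p.1 p.2‖ ^ 2 :=
  Real.sq_sqrt (tsum_nonneg fun p => by positivity)

lemma HsNormE_sq (s : ℝ) (h : ℝ → ℂ) :
    HsNormE s h ^ 2 = ∑' m : ℤ, ((m.natAbs : ℝ) + 1) ^ (2 * s) * ‖equatorCoeff h m‖ ^ 2 :=
  Real.sq_sqrt (tsum_nonneg fun p => by positivity)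

theorem main_thm (s : ℝ) (hs : 1 < s) :
    ∃ C > 0, ∀ (f : ℝ → ℝ → ℂ) (h : ℝ → ℂ),
      Continuous (fun q : ℝ × ℝ => f q.1 q.2) →
      (∀ θ : ℝ, Differentiable ℝ (f θ)) →
      (∀ θ φ : ℝ, f θ (φ + 2 * Real.pi) = f θ φ) →
      MemHs s f →
      MemHs (s - 1 / 2) (fun θ φ => deriv (f θ) φ) →
      Continuous h →
      (∀ φ : ℝ, h (φ + 2 * Real.pi) = h φ) →
      MemHsE (s + 3 / 4) h →
      ∃ v : EuclideanSpace ℝ (Fin 3) → ℂ,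
        SolvesObliqueC v f h ∧
        (∀ v' : EuclideanSpace ℝ (Fin 3) → ℂ,
          SolvesObliqueC v' f h → Set.EqOn v' v closedExt) ∧
        MemHs (s + 1) (traceC v) ∧
        HsNorm (s + 1) (traceC v) ≤
          C * (HsNorm s f + HsNorm (s - 1 / 2) (fun θ φ => deriv (f θ) φ) +
            HsNormE (s + 3 / 4) h) ∧
        (Axial f → (∀ φ₁ φ₂ : ℝ, h φ₁ = h φ₂) →
          Axial (traceC v) ∧
          HsNorm (s + 1) (traceC v) ≤ C * (HsNorm s f + ‖h 0‖)) := by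
  obtain ⟨C1, hC1, HM⟩ := master s hs
  refine ⟨Real.sqrt C1, Real.sqrt_pos.2 hC1, ?_⟩
  intro f h hf hd hp hm1 hm2 hh hhp hmE
  have hn : ∀ p : ℕ × ℤ, ((p.1 : ℝ) + 1) ^ (2 * (s - 1/2)) * ((p.2.natAbs:ℝ)^2 * ‖flCoeff f p.1 p.2‖^2) =
      ((p.1 : ℝ) + 1) ^ (2 * (s - 1/2)) * ‖flCoeff (fun θ φ => deriv (f θ) φ) p.1 p.2‖ ^ 2 := by
    intro p
    rw [flCoeff_dphi hf hd hp hm2.1, norm_mul, norm_mul, Complex.norm_I, one_mul, mul_pow, Complex.norm_intCast]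
    congr 3
    rw [Nat.cast_natAbs, Int.cast_abs]
  have hn' := funext hn
  obtain ⟨hT, hS, hE⟩ := HM (flCoeff f) (equatorCoeff h) hm1.2 (by rw [hn']; exact hm2.2) hmE.2
  rw [hn', ← HsNorm_sq, ← HsNorm_sq, ← HsNormE_sq] at hE
  obtain ⟨hsol, hc⟩ := existence hs hf hp hh hhp hT hS
  have hN : HsNorm (s + 1) (traceC (Sol (aArr (flCoeff f) (equatorCoeff h)))) ^ 2 ≤
      C1 * (HsNorm s f ^ 2 + HsNorm (s - 1 / 2) (fun θ φ => deriv (f θ) φ) ^ 2 + HsNormE (s + 3 / 4) h ^ 2) := by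
    rw [HsNorm_sq]
    simp_rw [hc]
    exact hE
  have hA : 0 ≤ HsNorm s f := Real.sqrt_nonneg _
  have hB : 0 ≤ HsNorm (s - 1 / 2) (fun θ φ => deriv (f θ) φ) := Real.sqrt_nonneg _
  have hD : 0 ≤ HsNormE (s + 3 / 4) h := Real.sqrt_nonneg _
  have hest : HsNorm (s + 1) (traceC (Sol (aArr (flCoeff f) (equatorCoeff h)))) ≤
      Real.sqrt C1 * (HsNorm s f + HsNorm (s - 1 / 2) (fun θ φ => deriv (f θ) φ) + HsNormE (s + 3 / 4) h) := by
    apply le_of_sq_le_sq _ (by positivity)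
    rw [mul_pow, Real.sq_sqrt hC1.le]
    refine hN.trans (mul_le_mul_of_nonneg_left ?_ hC1.le)
    nlinarith [mul_nonneg hA hB, mul_nonneg hA hD, mul_nonneg hB hD]
  refine ⟨_, hsol, fun v' hv' => uniqueness hsol hv', ⟨memLp_of_cont (solves_HarmC1 hsol).trace_cont, ?_⟩, hest, ?_⟩
  · simp_rw [hc]; exact hS
  · intro hax hhc
    have hd0 : (fun θ φ => deriv (f θ) φ) = fun _ _ => 0 := by
      funext θ φ
      rw [show f θ = fun _ => f θ 0 from funext fun x => hax θ x 0]
      simp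
    have hF0 : ∀ (m : ℤ), m ≠ 0 → ∀ l, flCoeff f l m = 0 := by
      intro m hm l
      have e := flCoeff_dphi hf hd hp hm2.1 l m
      rw [hd0] at e
      have e0 : flCoeff (fun _ _ => 0) l m = 0 := by simp [flCoeff]
      rw [e0] at e
      have hm' : (m:ℂ) ≠ 0 := by exact_mod_cast hm
      have := mul_eq_zero.1 e.symm
      simpa [Complex.I_ne_zero, hm'] using this
    have hH0 : ∀ (m : ℤ), m ≠ 0 → equatorCoeff h m = 0 := fun m hm => by
      rw [equatorCoeff_const hhc, if_neg hm]
    constructor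
    · intro θ φ₁ φ₂
      unfold traceC Sol
      exact tsum_congr fun l => lev_axial (fun l m hm => aArr_zero (hF0 m hm) (hH0 m hm) l) l θ φ₁ φ₂
    · have eB : HsNorm (s - 1 / 2) (fun θ φ => deriv (f θ) φ) = 0 := by
        rw [hd0]; simp [HsNorm, flCoeff]
      have eD : HsNormE (s + 3 / 4) h = ‖h 0‖ := by
        unfold HsNormE
        rw [tsum_eq_single 0 (fun m hm => by rw [hH0 m hm]; simp), equatorCoeff_const hhc]
        simp
      rw [eB, eD, add_zero] at hest
      exact hest

end Part23

/-- Theorem 3.1: unique solvability and fractional Sobolev estimates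
for the linearized problem. For `s > 1` there is `C > 0` such that for every
`f ∈ H^s(𝕊)` with `f_φ ∈ H^{s-1/2}(𝕊)` and `h ∈ H^{s+3/4}(ℰ)` (realized by continuous,
`2π`-periodic representatives), the oblique derivative problem has a unique classical
solution `v ∈ C²(Ω) ∩ C¹(cl Ω)`, with `v|_𝕊 ∈ H^{s+1}(𝕊)` and
`‖v‖_{H^{s+1}} ≤ C (‖f‖_{H^s} + ‖f_φ‖_{H^{s-1/2}} + ‖h‖_{H^{s+3/4}(ℰ)})`; moreover if
`f ∈ H^s_ax(𝕊)` and `h` is constant then `v|_𝕊 ∈ H^{s+1}_ax(𝕊)` and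
`‖v‖_{H^{s+1}} ≤ C (‖f‖_{H^s} + |h|)`. -/
theorem oblique_problem_existence_uniqueness_estimate (s : ℝ) (hs : 1 < s) :
    ∃ C > 0, ∀ (f : ℝ → ℝ → ℂ) (h : ℝ → ℂ),
      Continuous (fun q : ℝ × ℝ => f q.1 q.2) →
      (∀ θ : ℝ, Differentiable ℝ (f θ)) →
      (∀ θ φ : ℝ, f θ (φ + 2 * Real.pi) = f θ φ) →
      MemHs s f →
      MemHs (s - 1 / 2) (fun θ φ => deriv (f θ) φ) →
      Continuous h →
      (∀ φ : ℝ, h (φ + 2 * Real.pi) = h φ) →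
      MemHsE (s + 3 / 4) h →
      ∃ v : EuclideanSpace ℝ (Fin 3) → ℂ,
        SolvesObliqueC v f h ∧
        (∀ v' : EuclideanSpace ℝ (Fin 3) → ℂ,
          SolvesObliqueC v' f h → Set.EqOn v' v closedExt) ∧
        MemHs (s + 1) (traceC v) ∧
        HsNorm (s + 1) (traceC v) ≤
          C * (HsNorm s f + HsNorm (s - 1 / 2) (fun θ φ => deriv (f θ) φ) +
            HsNormE (s + 3 / 4) h) ∧
        (Axial f → (∀ φ₁ φ₂ : ℝ, h φ₁ = h φ₂) →
          Axial (traceC v) ∧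
          HsNorm (s + 1) (traceC v) ≤ C * (HsNorm s f + ‖h 0‖)) := by
  exact main_thm s hs

end
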